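/- arXiv:1703.03472 — 10 statements merged into one kernel-verified Lean document; each statement's English description precedes it below -/
import Mathlib

section
/- Let (X₁, X₂) be standard max-stable with generator (Z₁, Z₂) and D-norm ‖·‖_D. Then the product X₁X₂ is integrable and E[X₁X₂] = ∫₀^∞ ‖(1,u)‖_D^{-2} du. -/
open MeasureTheory ProbabilityTheory

/-- The layer-cake formula for a product of two nonnegative random variables. -/
theorem lintegral_ofReal_mul_ofReal_eq {Ω : Type*} [MeasurableSpace Ω] {μ : Measure Ω}
    [SFinite μ] {X Y : Ω → ℝ} (hX : Measurable X) (hY : Measurable Y) :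
    ∫⁻ ω, ENNReal.ofReal (X ω) * ENNReal.ofReal (Y ω) ∂μ
      = ∫⁻ s in Set.Ioi (0 : ℝ), ∫⁻ t in Set.Ioi (0 : ℝ), μ {ω | s ≤ X ω ∧ t ≤ Y ω} := by
  have layer : ∀ x : ℝ, ENNReal.ofReal x
      = ∫⁻ s in Set.Ioi (0 : ℝ), (Set.Iic x).indicator 1 s := fun x ↦ by
    rw [lintegral_indicator_one measurableSet_Iic, Measure.restrict_apply measurableSet_Iic,
      Set.inter_comm, Set.Ioi_inter_Iic, Real.volume_Ioc, sub_zero]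
  have meas {Z : Ω → ℝ} (hZ : Measurable Z) :
      Measurable fun p : Ω × ℝ ↦ (Set.Iic (Z p.1)).indicator (1 : ℝ → ENNReal) p.2 :=
    (measurable_const (a := (1 : ENNReal))).indicator
      (measurableSet_le measurable_snd (hZ.comp measurable_fst))
  have measF : Measurable fun p : Ω × (ℝ × ℝ) ↦
      (Set.Iic (X p.1)).indicator (1 : ℝ → ENNReal) p.2.1 *
        (Set.Iic (Y p.1)).indicator (1 : ℝ → ENNReal) p.2.2 :=
    ((meas hX).comp (measurable_fst.prodMk (measurable_fst.comp measurable_snd))).mul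
      ((meas hY).comp (measurable_fst.prodMk (measurable_snd.comp measurable_snd)))
  calc
    _ = ∫⁻ ω, ∫⁻ p, (Set.Iic (X ω)).indicator 1 p.1 * (Set.Iic (Y ω)).indicator 1 p.2
          ∂((volume.restrict (Set.Ioi (0 : ℝ))).prod (volume.restrict (Set.Ioi (0 : ℝ)))) ∂μ := by
      refine lintegral_congr fun ω ↦ ?_
      rw [layer (X ω), layer (Y ω)]
      exact (lintegral_prod_mul (measurable_one.indicator measurableSet_Iic).aemeasurable
        (measurable_one.indicator measurableSet_Iic).aemeasurable).symm
    _ = ∫⁻ p, ∫⁻ ω, (Set.Iic (X ω)).indicator 1 p.1 * (Set.Iic (Y ω)).indicator 1 p.2 ∂μ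
          ∂((volume.restrict (Set.Ioi (0 : ℝ))).prod (volume.restrict (Set.Ioi (0 : ℝ)))) :=
      lintegral_lintegral_swap measF.aemeasurable
    _ = _ := by
      rw [lintegral_prod _ measF.lintegral_prod_left'.aemeasurable]
      refine lintegral_congr fun s ↦ lintegral_congr fun t ↦ ?_
      have hset : MeasurableSet {ω | s ≤ X ω ∧ t ≤ Y ω} :=
        (measurableSet_le measurable_const hX).inter (measurableSet_le measurable_const hY)
      rw [← lintegral_indicator_one hset]
      refine lintegral_congr fun ω ↦ ?_
      by_cases h₁ : s ≤ X ω <;> by_cases h₂ : t ≤ Y ω <;> simp [Set.indicator, h₁, h₂]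

theorem setLIntegral_Ioi_zero_eq_mul_comp_mul_left (f : ℝ → ENNReal) {s : ℝ} (hs : 0 < s) :
    ∫⁻ t in Set.Ioi (0 : ℝ), f t
      = ∫⁻ u in Set.Ioi (0 : ℝ), ENNReal.ofReal s * f (s * u) := by
  have h := lintegral_image_eq_lintegral_abs_deriv_mul (s := Set.Ioi (0 : ℝ))
    (f := fun u ↦ s * u) (f' := fun _ ↦ s) measurableSet_Ioi
    (fun u _ ↦ by simpa using ((hasDerivAt_id u).const_mul s).hasDerivWithinAt)
    (mul_right_injective₀ hs.ne').injOn f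
  rwa [Set.image_const_mul_Ioi_zero hs, abs_of_pos hs] at h

theorem setLIntegral_Ioi_zero_mul_exp_neg_mul {c : ℝ} (hc : 0 < c) :
    ∫⁻ s in Set.Ioi (0 : ℝ), ENNReal.ofReal (s * Real.exp (-(c * s)))
      = ENNReal.ofReal ((c ^ 2)⁻¹) := by
  have h : ∫ s in Set.Ioi (0 : ℝ), s * Real.exp (-(c * s)) = (c ^ 2)⁻¹ := by
    have := Real.integral_rpow_mul_exp_neg_mul_Ioi (a := 2) two_pos hc
    norm_num [Real.Gamma_two] at this
    exact this
  have hint : IntegrableOn (fun s ↦ s * Real.exp (-(c * s))) (Set.Ioi 0) :=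
    Integrable.of_integral_ne_zero (by rw [h]; positivity)
  rw [← h, ofReal_integral_eq_lintegral_ofReal hint]
  filter_upwards [ae_restrict_mem measurableSet_Ioi] with s hs
  have : 0 < s := hs
  simp only [Pi.zero_apply]
  positivity

/-- Let `(X₁, X₂)` be standard max-stable with generator `(Z₁, Z₂)` and
`D`-norm `‖(x,y)‖_D = E (max (|x| Z₁) (|y| Z₂))`. Then `X₁ * X₂` is integrable and
`E (X₁ X₂) = ∫₀^∞ ‖(1,u)‖_D⁻² du`. -/
theorem product_moment_of_standard_max_stable
    {Ω : Type*} [MeasureSpace Ω] [IsProbabilityMeasure (ℙ : Measure Ω)]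
    (Z₁ Z₂ X₁ X₂ : Ω → ℝ)
    (hZ₁int : Integrable Z₁) (hZ₂int : Integrable Z₂)
    (hZ₁pos : ∀ᵐ ω ∂ℙ, 0 ≤ Z₁ ω) (hZ₂pos : ∀ᵐ ω ∂ℙ, 0 ≤ Z₂ ω)
    (hZ₁one : ∫ ω, Z₁ ω = 1) (hZ₂one : ∫ ω, Z₂ ω = 1)
    (hX₁meas : Measurable X₁) (hX₂meas : Measurable X₂)
    (hX₁neg : ∀ᵐ ω ∂ℙ, X₁ ω ≤ 0) (hX₂neg : ∀ᵐ ω ∂ℙ, X₂ ω ≤ 0)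
    (hmaxstable : ∀ x y : ℝ, x ≤ 0 → y ≤ 0 →
      (ℙ {ω | X₁ ω ≤ x ∧ X₂ ω ≤ y}).toReal
        = Real.exp (-(∫ ω, max (|x| * Z₁ ω) (|y| * Z₂ ω)))) :
    Integrable (fun ω => X₁ ω * X₂ ω) ∧
      ∫ ω, X₁ ω * X₂ ω
        = ∫ u in Set.Ioi (0 : ℝ), ((∫ ω, max (|1| * Z₁ ω) (|u| * Z₂ ω)) ^ 2)⁻¹ := by
  set h : ℝ → ℝ := fun v ↦ ∫ ω, max (Z₁ ω) (v * Z₂ ω) with h_def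
  have hint (v : ℝ) : Integrable fun ω ↦ max (Z₁ ω) (v * Z₂ ω) := hZ₁int.sup (hZ₂int.const_mul v)
  have h_mono : Monotone h := fun v w hvw ↦ by
    refine integral_mono_ae (hint v) (hint w) ?_
    filter_upwards [hZ₂pos] with ω hω
    exact max_le_max le_rfl (mul_le_mul_of_nonneg_right hvw hω)
  have one_le_h (v : ℝ) : 1 ≤ h v := by
    rw [← hZ₁one]
    exact integral_mono hZ₁int (hint v) fun ω ↦ le_max_left _ _
  have le_h (v : ℝ) : v ≤ h v := by
    calc v = ∫ ω, v * Z₂ ω := by rw [integral_const_mul, hZ₂one, mul_one]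
      _ ≤ h v := integral_mono (hZ₂int.const_mul v) (hint v) fun ω ↦ le_max_right _ _
  have h_meas : Measurable h := h_mono.measurable
  have norm_eq : ∀ u ∈ Set.Ioi (0 : ℝ),
      ((∫ ω, max (|1| * Z₁ ω) (|u| * Z₂ ω)) ^ 2)⁻¹ = (h u ^ 2)⁻¹ := fun u hu ↦ by
    rw [abs_one, abs_of_pos (Set.mem_Ioi.1 hu)]
    simp only [one_mul, h_def]
  have survival {s u : ℝ} (hs : 0 < s) (hu : 0 < u) :
      ℙ {ω | s ≤ -X₁ ω ∧ s * u ≤ -X₂ ω} = ENNReal.ofReal (Real.exp (-(h u * s))) := by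
    have hset : {ω | s ≤ -X₁ ω ∧ s * u ≤ -X₂ ω} = {ω | X₁ ω ≤ -s ∧ X₂ ω ≤ -(s * u)} := by
      ext ω
      simp only [Set.mem_ofPred_eq, le_neg]
    rw [hset, ← ENNReal.ofReal_toReal (measure_ne_top ℙ _),
      hmaxstable _ _ (by linarith) (by nlinarith [mul_pos hs hu]), abs_neg, abs_neg,
      abs_of_pos hs, abs_of_pos (mul_pos hs hu), mul_comm (h u), h_def]
    simp only [← integral_const_mul, mul_max_of_nonneg _ _ hs.le, mul_assoc]
  have h_int : IntegrableOn (fun u ↦ (h u ^ 2)⁻¹) (Set.Ioi 0) := by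
    refine (integrable_inv_one_add_sq.const_mul 2).integrableOn.mono'
      (h_meas.pow_const 2).inv.aestronglyMeasurable ?_
    filter_upwards [ae_restrict_mem measurableSet_Ioi] with u hu
    have hu : 0 < u := hu
    have h₁ := one_le_h u
    have h₂ := le_h u
    rw [Real.norm_of_nonneg (by positivity), ← div_eq_mul_inv, inv_eq_one_div,
      div_le_div_iff₀ (by positivity) (by positivity)]
    nlinarith
  have key : ∫⁻ ω, ENNReal.ofReal (X₁ ω * X₂ ω)
      = ∫⁻ u in Set.Ioi (0 : ℝ), ENNReal.ofReal ((h u ^ 2)⁻¹) := by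
    calc
      _ = ∫⁻ ω, ENNReal.ofReal (-X₁ ω) * ENNReal.ofReal (-X₂ ω) := by
        refine lintegral_congr_ae ?_
        filter_upwards [hX₁neg] with ω hω
        rw [← ENNReal.ofReal_mul (neg_nonneg.2 hω), neg_mul_neg]
      _ = ∫⁻ s in Set.Ioi (0 : ℝ), ∫⁻ t in Set.Ioi (0 : ℝ), ℙ {ω | s ≤ -X₁ ω ∧ t ≤ -X₂ ω} :=
        lintegral_ofReal_mul_ofReal_eq hX₁meas.neg hX₂meas.neg
      _ = ∫⁻ s in Set.Ioi (0 : ℝ), ∫⁻ u in Set.Ioi (0 : ℝ),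
            ENNReal.ofReal (s * Real.exp (-(h u * s))) := by
        refine setLIntegral_congr_fun measurableSet_Ioi fun s hs ↦ ?_
        have hs : 0 < s := hs
        rw [setLIntegral_Ioi_zero_eq_mul_comp_mul_left _ hs]
        refine setLIntegral_congr_fun measurableSet_Ioi fun u hu ↦ ?_
        rw [survival hs hu, ENNReal.ofReal_mul hs.le]
      _ = ∫⁻ u in Set.Ioi (0 : ℝ), ∫⁻ s in Set.Ioi (0 : ℝ),
            ENNReal.ofReal (s * Real.exp (-(h u * s))) :=
        lintegral_lintegral_swap (by fun_prop)
      _ = _ := lintegral_congr fun u ↦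
        setLIntegral_Ioi_zero_mul_exp_neg_mul (zero_lt_one.trans_le (one_le_h u))
  have prod_nonneg : 0 ≤ᵐ[ℙ] fun ω ↦ X₁ ω * X₂ ω := by
    filter_upwards [hX₁neg, hX₂neg] with ω h₁ h₂
    exact mul_nonneg_of_nonpos_of_nonpos h₁ h₂
  have prod_meas : AEStronglyMeasurable (fun ω ↦ X₁ ω * X₂ ω) :=
    (hX₁meas.mul hX₂meas).aestronglyMeasurable
  have h_nonneg : 0 ≤ᵐ[volume.restrict (Set.Ioi (0 : ℝ))] fun u ↦ (h u ^ 2)⁻¹ :=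
    .of_forall fun u ↦ by simp only [Pi.zero_apply]; positivity
  refine ⟨⟨prod_meas, ?_⟩, ?_⟩
  · rw [hasFiniteIntegral_iff_ofReal prod_nonneg, key,
      ← hasFiniteIntegral_iff_ofReal h_nonneg]
    exact h_int.2
  · rw [setIntegral_congr_fun measurableSet_Ioi norm_eq,
      integral_eq_lintegral_of_nonneg_ae prod_nonneg prod_meas,
      integral_eq_lintegral_of_nonneg_ae h_nonneg h_int.1, key]
end

section
/- Let (X₁, X₂) be standard max-stable with generator (Z₁, Z₂). Then E[(X₁ − X₂)²] ≤ 6·E[|Z₁ − Z₂|]. -/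
open MeasureTheory ProbabilityTheory

/-- The second moment of an exponentially distributed variable with rate `c`, for a variable given
through its survival function. -/
theorem integrable_sq_and_integral_sq_of_exponential_tail
    {Ω : Type*} [MeasurableSpace Ω] {μ : Measure Ω} [IsProbabilityMeasure μ]
    {Y : Ω → ℝ} (hY : Measurable Y) (hY0 : ∀ᵐ ω ∂μ, 0 ≤ Y ω) {c : ℝ} (hc : 0 < c)
    (htail : ∀ t : ℝ, 0 ≤ t → (μ {ω | t ≤ Y ω}).toReal = Real.exp (-(c * t))) :
    Integrable (fun ω ↦ Y ω ^ 2) μ ∧ ∫ ω, Y ω ^ 2 ∂μ = 2 / c ^ 2 := by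
  have hgamma : ∫ t in Set.Ioi (0 : ℝ), t ^ ((2 : ℝ) - 1) * Real.exp (-(c * t)) = 1 / c ^ 2 := by
    rw [Real.integral_rpow_mul_exp_neg_mul_Ioi two_pos hc, Real.Gamma_two]
    simp
  have hint : IntegrableOn (fun t : ℝ ↦ t ^ ((2 : ℝ) - 1) * Real.exp (-(c * t))) (Set.Ioi 0) :=
    Integrable.of_integral_ne_zero (by rw [hgamma]; positivity)
  have hlint : ∫⁻ ω, ENNReal.ofReal (Y ω ^ 2) ∂μ = ENNReal.ofReal (2 / c ^ 2) := by
    have hlayer := lintegral_rpow_eq_lintegral_meas_le_mul μ hY0 hY.aemeasurable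
      (p := 2) two_pos
    simp only [Real.rpow_two] at hlayer
    rw [hlayer]
    have hcongr : ∫⁻ t in Set.Ioi (0 : ℝ), μ {ω | t ≤ Y ω} * ENNReal.ofReal (t ^ ((2 : ℝ) - 1))
        = ∫⁻ t in Set.Ioi (0 : ℝ),
            ENNReal.ofReal (t ^ ((2 : ℝ) - 1) * Real.exp (-(c * t))) := by
      refine setLIntegral_congr_fun measurableSet_Ioi fun t ht ↦ ?_
      have ht0 : (0 : ℝ) ≤ t := le_of_lt ht
      rw [ENNReal.ofReal_mul (by positivity), ← htail t ht0,
        ENNReal.ofReal_toReal (measure_ne_top μ _), mul_comm]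
    rw [hcongr, ← ofReal_integral_eq_lintegral_ofReal hint, hgamma, ← ENNReal.ofReal_mul two_pos.le]
    · congr 1; ring
    · filter_upwards [ae_restrict_mem measurableSet_Ioi] with t ht
      have ht0 : (0 : ℝ) ≤ t := le_of_lt ht
      positivity
  have hval : ∫ ω, Y ω ^ 2 ∂μ = 2 / c ^ 2 := by
    rw [integral_eq_lintegral_of_nonneg_ae (.of_forall fun ω ↦ sq_nonneg (Y ω))
      (hY.pow_const 2).aestronglyMeasurable, hlint, ENNReal.toReal_ofReal (by positivity)]
  exact ⟨Integrable.of_integral_ne_zero (by rw [hval]; positivity), hval⟩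

/-- Let `(X₁, X₂)` be standard max-stable with generator `(Z₁, Z₂)`.
Then `E ((X₁ - X₂)²) ≤ 6 E |Z₁ - Z₂|`. -/
theorem mse_le_six_expectation_abs_diff
    {Ω : Type*} [MeasureSpace Ω] [IsProbabilityMeasure (ℙ : Measure Ω)]
    (Z₁ Z₂ X₁ X₂ : Ω → ℝ)
    (hZ₁int : Integrable Z₁) (hZ₂int : Integrable Z₂)
    (hZ₁pos : ∀ᵐ ω ∂ℙ, 0 ≤ Z₁ ω) (hZ₂pos : ∀ᵐ ω ∂ℙ, 0 ≤ Z₂ ω)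
    (hZ₁one : ∫ ω, Z₁ ω = 1) (hZ₂one : ∫ ω, Z₂ ω = 1)
    (hX₁meas : Measurable X₁) (hX₂meas : Measurable X₂)
    (hX₁neg : ∀ᵐ ω ∂ℙ, X₁ ω ≤ 0) (hX₂neg : ∀ᵐ ω ∂ℙ, X₂ ω ≤ 0)
    (hmaxstable : ∀ x y : ℝ, x ≤ 0 → y ≤ 0 →
      (ℙ {ω | X₁ ω ≤ x ∧ X₂ ω ≤ y}).toReal
        = Real.exp (-(∫ ω, max (|x| * Z₁ ω) (|y| * Z₂ ω)))) :
    ∫ ω, (X₁ ω - X₂ ω) ^ 2 ≤ 6 * ∫ ω, |Z₁ ω - Z₂ ω| := by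
  set δ := ∫ ω, |Z₁ ω - Z₂ ω|
  have hδ0 : 0 ≤ δ := integral_nonneg fun ω ↦ abs_nonneg _
  have hmax : ∫ ω, max (Z₁ ω) (Z₂ ω) = 1 + δ / 2 := by
    have hpt : ∀ ω, max (Z₁ ω) (Z₂ ω) = (Z₁ ω + Z₂ ω + |Z₁ ω - Z₂ ω|) / 2 := fun ω ↦ by
      rcases le_total (Z₁ ω) (Z₂ ω) with h | h
      · rw [max_eq_right h, abs_of_nonpos (sub_nonpos.2 h)]
        ring
      · rw [max_eq_left h, abs_of_nonneg (sub_nonneg.2 h)]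
        ring
    simp_rw [hpt]
    rw [integral_div, integral_add (by exact hZ₁int.add hZ₂int) (by exact (hZ₁int.sub hZ₂int).abs),
      integral_add hZ₁int hZ₂int, hZ₁one, hZ₂one]
    ring
  obtain ⟨hint₁, hval₁⟩ := integrable_sq_and_integral_sq_of_exponential_tail (μ := ℙ)
    (Y := fun ω ↦ -X₁ ω) hX₁meas.neg (hX₁neg.mono fun ω h ↦ neg_nonneg.2 h) one_pos fun t ht ↦ by
      have hset : ℙ {ω | t ≤ -X₁ ω} = ℙ {ω | X₁ ω ≤ -t ∧ X₂ ω ≤ 0} := measure_congr <| by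
        filter_upwards [hX₂neg] with ω h
        exact propext ⟨fun h' ↦ ⟨le_neg_of_le_neg h', h⟩, fun h' ↦ le_neg_of_le_neg h'.1⟩
      have hnorm : ∫ ω, max (|-t| * Z₁ ω) (|(0 : ℝ)| * Z₂ ω) = 1 * t := by
        rw [integral_congr_ae (g := fun ω ↦ t * Z₁ ω), integral_const_mul, hZ₁one, mul_comm]
        filter_upwards [hZ₁pos] with ω h
        simp [abs_of_nonneg ht, mul_nonneg ht h]
      rw [hset, hmaxstable _ _ (neg_nonpos.2 ht) le_rfl, hnorm]
  obtain ⟨hint₂, hval₂⟩ := integrable_sq_and_integral_sq_of_exponential_tail (μ := ℙ)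
    (Y := fun ω ↦ -X₂ ω) hX₂meas.neg (hX₂neg.mono fun ω h ↦ neg_nonneg.2 h) one_pos fun t ht ↦ by
      have hset : ℙ {ω | t ≤ -X₂ ω} = ℙ {ω | X₁ ω ≤ 0 ∧ X₂ ω ≤ -t} := measure_congr <| by
        filter_upwards [hX₁neg] with ω h
        exact propext ⟨fun h' ↦ ⟨h, le_neg_of_le_neg h'⟩, fun h' ↦ le_neg_of_le_neg h'.2⟩
      have hnorm : ∫ ω, max (|(0 : ℝ)| * Z₁ ω) (|-t| * Z₂ ω) = 1 * t := by
        rw [integral_congr_ae (g := fun ω ↦ t * Z₂ ω), integral_const_mul, hZ₂one, mul_comm]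
        filter_upwards [hZ₂pos] with ω h
        simp [abs_of_nonneg ht, mul_nonneg ht h]
      rw [hset, hmaxstable _ _ le_rfl (neg_nonpos.2 ht), hnorm]
  obtain ⟨hint₃, hval₃⟩ := integrable_sq_and_integral_sq_of_exponential_tail (μ := ℙ)
    (Y := fun ω ↦ min (-X₁ ω) (-X₂ ω)) (hX₁meas.neg.min hX₂meas.neg)
    (by filter_upwards [hX₁neg, hX₂neg] with ω h₁ h₂ using
      le_min (neg_nonneg.2 h₁) (neg_nonneg.2 h₂))
    (show 0 < 1 + δ / 2 by positivity) fun t ht ↦ by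
      have hset : {ω | t ≤ min (-X₁ ω) (-X₂ ω)} = {ω | X₁ ω ≤ -t ∧ X₂ ω ≤ -t} := by
        ext ω
        simp only [Set.mem_ofPred_eq, le_min_iff, le_neg (a := t)]
      have hnorm : ∫ ω, max (|-t| * Z₁ ω) (|-t| * Z₂ ω) = (1 + δ / 2) * t := by
        simp_rw [abs_neg, abs_of_nonneg ht, ← mul_max_of_nonneg _ _ ht]
        rw [integral_const_mul, hmax, mul_comm]
      rw [hset, hmaxstable _ _ (neg_nonpos.2 ht) (neg_nonpos.2 ht), hnorm]
  calc ∫ ω, (X₁ ω - X₂ ω) ^ 2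
      ≤ ∫ ω, ((-X₁ ω) ^ 2 + (-X₂ ω) ^ 2 - 2 * min (-X₁ ω) (-X₂ ω) ^ 2) := by
        refine integral_mono_of_nonneg (.of_forall fun ω ↦ sq_nonneg _)
          ((hint₁.add hint₂).sub (hint₃.const_mul 2)) ?_
        filter_upwards [hX₁neg, hX₂neg] with ω h₁ h₂
        rcases le_total (-X₁ ω) (-X₂ ω) with h | h
        · rw [min_eq_left h]
          nlinarith
        · rw [min_eq_right h]
          nlinarith
    _ = 4 - 4 / (1 + δ / 2) ^ 2 := by
        rw [integral_sub (by exact hint₁.add hint₂) (hint₃.const_mul 2), integral_add hint₁ hint₂,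
          integral_const_mul, hval₁, hval₂, hval₃]
        ring
    _ ≤ 6 * δ := by
        rw [sub_le_iff_le_add, ← sub_le_iff_le_add', le_div_iff₀ (by positivity)]
        nlinarith [pow_nonneg hδ0 2, pow_nonneg hδ0 3]
end

section
/- Let Z₁, Z₂ be a generator with associated D-norm ‖·‖_D, so ‖(1,u)‖_D = E[max(Z₁, u·Z₂)] for u ≥ 0. Then 2 − ∫₀^∞ ‖(1,u)‖_D^{-2} du ≤ 3·E[|Z₁ − Z₂|]. -/
open MeasureTheory ProbabilityTheory

/-- The integral `∫₁^∞ (u + c)⁻² du` converges, with value `(1 + c)⁻¹`. -/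
lemma integrableOn_and_integral_Ioi_inv_add_sq {c : ℝ} (hc : 0 ≤ c) :
    IntegrableOn (fun u : ℝ => ((u + c) ^ 2)⁻¹) (Set.Ioi 1) ∧
      ∫ u in Set.Ioi (1 : ℝ), ((u + c) ^ 2)⁻¹ = (1 + c)⁻¹ := by
  have hderiv : ∀ x ∈ Set.Ici (1 : ℝ),
      HasDerivAt (fun u : ℝ => -(u + c)⁻¹) ((x + c) ^ 2)⁻¹ x := by
    intro x hx
    have hx0 : x + c ≠ 0 := by
      have : (1 : ℝ) ≤ x := hx
      positivity
    have h := (((hasDerivAt_id x).add_const c).inv hx0).neg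
    simpa [neg_div, Pi.neg_def, Pi.inv_def] using h
  have hlim : Filter.Tendsto (fun u : ℝ => -(u + c)⁻¹) Filter.atTop (nhds 0) := by
    have h := (tendsto_inv_atTop_zero.comp
      (Filter.tendsto_atTop_add_const_right Filter.atTop c Filter.tendsto_id)).neg
    simpa using h
  have hInt : IntegrableOn (fun u : ℝ => ((u + c) ^ 2)⁻¹) (Set.Ioi 1) :=
    integrableOn_Ioi_deriv_of_nonneg' hderiv (fun x _ => by positivity) hlim
  refine ⟨hInt, ?_⟩
  rw [integral_Ioi_of_hasDerivAt_of_tendsto' hderiv hInt hlim]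
  ring

/-- A monotone function squeezed between `max 1 u` and `max 1 u + c` on the positive half-line
satisfies `2 - ∫₀^∞ f⁻² ≤ 3 c`. -/
lemma two_sub_integral_inv_sq_le {f : ℝ → ℝ} {c : ℝ} (hc : 0 ≤ c) (hmono : Monotone f)
    (hlow : ∀ u, 0 < u → max 1 u ≤ f u) (hup : ∀ u, 0 < u → f u ≤ max 1 u + c) :
    2 - ∫ u in Set.Ioi (0 : ℝ), (f u ^ 2)⁻¹ ≤ 3 * c := by
  have hpos : ∀ u, 0 < u → 0 < f u := fun u hu =>
    lt_of_lt_of_le one_pos ((le_max_left 1 u).trans (hlow u hu))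
  have hmeas : Measurable fun u => (f u ^ 2)⁻¹ := (hmono.measurable.pow_const 2).inv
  have hInt₁ : IntegrableOn (fun u => (f u ^ 2)⁻¹) (Set.Ioc 0 1) := by
    refine Integrable.mono' (g := fun _ => (1 : ℝ)) (integrable_const 1)
      hmeas.aestronglyMeasurable ?_
    filter_upwards [ae_restrict_mem measurableSet_Ioc] with u hu
    have h1 : 1 ≤ f u := (le_max_left 1 u).trans (hlow u hu.1)
    rw [Real.norm_of_nonneg (by positivity)]
    exact inv_le_one_of_one_le₀ (one_le_pow₀ h1)
  have hInt₂ : IntegrableOn (fun u => (f u ^ 2)⁻¹) (Set.Ioi 1) := by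
    refine Integrable.mono' (integrableOn_and_integral_Ioi_inv_add_sq le_rfl).1
      hmeas.aestronglyMeasurable ?_
    filter_upwards [ae_restrict_mem measurableSet_Ioi] with u hu
    have hu0 : 0 < u := one_pos.trans hu
    have h1 : u ≤ f u := (le_max_right 1 u).trans (hlow u hu0)
    rw [Real.norm_of_nonneg (by positivity), add_zero]
    gcongr
  have hle₁ : ((1 + c) ^ 2)⁻¹ ≤ ∫ u in Set.Ioc (0 : ℝ) 1, (f u ^ 2)⁻¹ := by
    calc ((1 + c) ^ 2)⁻¹ = ∫ _ in Set.Ioc (0 : ℝ) 1, ((1 + c) ^ 2)⁻¹ := by simp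
      _ ≤ _ := by
        refine setIntegral_mono_on (integrable_const _) hInt₁ measurableSet_Ioc fun u hu => ?_
        have h1 := hup u hu.1
        rw [max_eq_left hu.2] at h1
        have h2 := hpos u hu.1
        gcongr
  have hle₂ : (1 + c)⁻¹ ≤ ∫ u in Set.Ioi (1 : ℝ), (f u ^ 2)⁻¹ := by
    obtain ⟨hi, he⟩ := integrableOn_and_integral_Ioi_inv_add_sq hc
    rw [← he]
    refine setIntegral_mono_on hi hInt₂ measurableSet_Ioi fun u hu => ?_
    have hu0 : 0 < u := one_pos.trans hu
    have h1 := hup u hu0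
    rw [max_eq_right (le_of_lt hu)] at h1
    have h2 := hpos u hu0
    gcongr
  have hsplit : ∫ u in Set.Ioi (0 : ℝ), (f u ^ 2)⁻¹ =
      (∫ u in Set.Ioc (0 : ℝ) 1, (f u ^ 2)⁻¹) + ∫ u in Set.Ioi (1 : ℝ), (f u ^ 2)⁻¹ := by
    rw [← Set.Ioc_union_Ioi_eq_Ioi (zero_le_one' ℝ)]
    exact setIntegral_union Set.Ioc_disjoint_Ioi_same measurableSet_Ioi hInt₁ hInt₂
  have hinv : 1 - c ≤ (1 + c)⁻¹ := by
    rw [← one_div, le_div_iff₀ (by positivity)]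
    nlinarith [mul_nonneg hc hc]
  have hinv_sq : 1 - 2 * c ≤ ((1 + c) ^ 2)⁻¹ := by
    rw [← one_div, le_div_iff₀ (by positivity)]
    nlinarith [mul_nonneg hc hc, mul_nonneg hc (mul_nonneg hc hc)]
  rw [hsplit]
  linarith

/-- For a generator `(Z₁, Z₂)` with `D`-norm
`‖(1,u)‖_D = E (max Z₁ (u Z₂))` for `u ≥ 0`, one has
`2 - ∫₀^∞ ‖(1,u)‖_D⁻² du ≤ 3 E |Z₁ - Z₂|`. -/
theorem two_sub_integral_le_three_expectation_abs_diff
    {Ω : Type*} [MeasureSpace Ω] [IsProbabilityMeasure (ℙ : Measure Ω)]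
    (Z₁ Z₂ : Ω → ℝ)
    (hZ₁int : Integrable Z₁) (hZ₂int : Integrable Z₂)
    (hZ₁pos : ∀ᵐ ω ∂ℙ, 0 ≤ Z₁ ω) (hZ₂pos : ∀ᵐ ω ∂ℙ, 0 ≤ Z₂ ω)
    (hZ₁one : ∫ ω, Z₁ ω = 1) (hZ₂one : ∫ ω, Z₂ ω = 1) :
    2 - ∫ u in Set.Ioi (0 : ℝ), ((∫ ω, max (Z₁ ω) (u * Z₂ ω)) ^ 2)⁻¹
      ≤ 3 * ∫ ω, |Z₁ ω - Z₂ ω| := by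
  have hInt (u : ℝ) : Integrable fun ω => max (Z₁ ω) (u * Z₂ ω) :=
    hZ₁int.sup (hZ₂int.const_mul u)
  have hdiff : Integrable fun ω => |Z₁ ω - Z₂ ω| := (hZ₁int.sub hZ₂int).abs
  refine two_sub_integral_inv_sq_le (f := fun u => ∫ ω, max (Z₁ ω) (u * Z₂ ω))
    (integral_nonneg fun ω => abs_nonneg _) ?_ ?_ ?_
  · intro u v huv
    refine integral_mono_ae (hInt u) (hInt v) ?_
    filter_upwards [hZ₂pos] with ω h₂
    exact max_le_max le_rfl (mul_le_mul_of_nonneg_right huv h₂)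
  · intro u _
    refine max_le ?_ ?_
    · rw [← hZ₁one]
      exact integral_mono hZ₁int (hInt u) fun ω => le_max_left _ _
    · have h := integral_mono (hZ₂int.const_mul u) (hInt u) fun ω => le_max_right _ _
      rwa [integral_const_mul, hZ₂one, mul_one] at h
  · intro u hu
    rcases le_total u 1 with h1 | h1
    · rw [max_eq_left h1, ← hZ₁one, ← integral_add hZ₁int hdiff]
      refine integral_mono_ae (hInt u) (hZ₁int.add hdiff) ?_
      filter_upwards [hZ₂pos] with ω h₂
      refine max_le (le_add_of_nonneg_right (abs_nonneg _)) ?_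
      have := neg_abs_le (Z₁ ω - Z₂ ω)
      have := mul_le_of_le_one_left h₂ h1
      linarith
    · have hu2 : u = ∫ ω, u * Z₂ ω := by rw [integral_const_mul, hZ₂one, mul_one]
      rw [max_eq_right h1]
      calc _ ≤ ∫ ω, (u * Z₂ ω + |Z₁ ω - Z₂ ω|) := by
            refine integral_mono_ae (hInt u) ((hZ₂int.const_mul u).add hdiff) ?_
            filter_upwards [hZ₂pos] with ω h₂
            refine max_le ?_ (le_add_of_nonneg_right (abs_nonneg _))
            have := le_abs_self (Z₁ ω - Z₂ ω)
            have := le_mul_of_one_le_left h₂ h1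
            linarith
        _ = _ := by rw [integral_add (hZ₂int.const_mul u) hdiff, ← hu2]
end

section
/- Let Z₁, …, Z_d (d ≥ 2) be a generator with associated D-norm ‖·‖_D on ℝ^d, let s₁, …, s_d be pairwise distinct points of [0,1]^k and ‖·‖ a norm on ℝ^k. Define g̃_i(t) := min_{j≠i} ‖t − s_j‖ and g_i(t) := g̃_i(t) / ‖(g̃₁(t), …, g̃_d(t))‖_D for t ∈ [0,1]^k. Then the g_i are well defined (the denominator never vanishes), continuous and nonnegative, and satisfy ‖(g₁(t), …, g_d(t))‖_D = 1 for all t ∈ [0,1]^k and g_i(s_j) = δ_{ij} for all 1 ≤ i, j ≤ d. -/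
open MeasureTheory ProbabilityTheory

/-- A subadditive, absolutely homogeneous real function on a finite-dimensional space is
continuous. -/
lemma continuous_of_subadditive_of_homogeneous {E : Type*} [NormedAddCommGroup E]
    [NormedSpace ℝ E] [FiniteDimensional ℝ E] {f : E → ℝ}
    (hadd : ∀ x y, f (x + y) ≤ f x + f y) (hsmul : ∀ (c : ℝ) x, f (c • x) = |c| * f x) :
    Continuous f :=
  (Seminorm.of f hadd hsmul).convexOn.locallyLipschitz.continuous

section DNorm

variable {Ω ι : Type*} [MeasurableSpace Ω] {μ : Measure Ω} {Z : ι → Ω → ℝ}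

lemma integral_iSup_abs_smul_mul (c : ℝ) (x : ι → ℝ) :
    ∫ ω, ⨆ i, |(c • x) i| * Z i ω ∂μ = |c| * ∫ ω, ⨆ i, |x i| * Z i ω ∂μ := by
  rw [← integral_const_mul]
  simp_rw [Real.mul_iSup_of_nonneg (abs_nonneg c), Pi.smul_apply, smul_eq_mul, abs_mul,
    mul_assoc]

variable [Fintype ι]

lemma integrable_iSup_abs_mul (hZint : ∀ i, Integrable (Z i) μ) (x : ι → ℝ) :
    Integrable (fun ω => ⨆ i, |x i| * Z i ω) μ := by
  have hbound : Integrable (fun ω => ∑ i, |(|x i| * Z i ω)|) μ :=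
    integrable_finsetSum _ fun i _ => ((hZint i).const_mul _).abs
  refine hbound.mono' (AEMeasurable.iSup fun i =>
    ((hZint i).const_mul _).aemeasurable).aestronglyMeasurable (ae_of_all _ fun ω => ?_)
  rcases isEmpty_or_nonempty ι with _ | _
  · simp
  · obtain ⟨i, hi⟩ := exists_eq_ciSup_of_finite (f := fun i => |x i| * Z i ω)
    rw [← hi]
    exact Finset.single_le_sum (f := fun i => |(|x i| * Z i ω)|)
      (fun _ _ => abs_nonneg _) (Finset.mem_univ i)

lemma integral_iSup_abs_add_mul_le (hZint : ∀ i, Integrable (Z i) μ)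
    (hZpos : ∀ i, ∀ᵐ ω ∂μ, 0 ≤ Z i ω) (x y : ι → ℝ) :
    ∫ ω, ⨆ i, |(x + y) i| * Z i ω ∂μ ≤
      ∫ ω, ⨆ i, |x i| * Z i ω ∂μ + ∫ ω, ⨆ i, |y i| * Z i ω ∂μ := by
  rw [← integral_add (integrable_iSup_abs_mul hZint x) (integrable_iSup_abs_mul hZint y)]
  refine integral_mono_ae (integrable_iSup_abs_mul hZint _)
    ((integrable_iSup_abs_mul hZint x).add (integrable_iSup_abs_mul hZint y)) ?_
  filter_upwards [ae_all_iff.2 hZpos] with ω hω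
  rcases isEmpty_or_nonempty ι with _ | _
  · simp
  · refine ciSup_le fun i => ?_
    calc |(x + y) i| * Z i ω ≤ (|x i| + |y i|) * Z i ω :=
          mul_le_mul_of_nonneg_right (abs_add_le _ _) (hω i)
      _ = |x i| * Z i ω + |y i| * Z i ω := add_mul _ _ _
      _ ≤ _ := add_le_add
          (le_ciSup (f := fun i => |x i| * Z i ω) (Set.finite_range _).bddAbove i)
          (le_ciSup (f := fun i => |y i| * Z i ω) (Set.finite_range _).bddAbove i)

lemma abs_le_integral_iSup_abs_mul (hZint : ∀ i, Integrable (Z i) μ)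
    (hZone : ∀ i, ∫ ω, Z i ω ∂μ = 1) (x : ι → ℝ) (i : ι) :
    |x i| ≤ ∫ ω, ⨆ i, |x i| * Z i ω ∂μ := by
  calc |x i| = ∫ ω, |x i| * Z i ω ∂μ := by rw [integral_const_mul, hZone, mul_one]
    _ ≤ _ := integral_mono ((hZint i).const_mul _) (integrable_iSup_abs_mul hZint x) fun ω =>
      le_ciSup (f := fun i => |x i| * Z i ω) (Set.finite_range _).bddAbove i

lemma integral_iSup_abs_mul_of_forall_ne (hZpos : ∀ i, ∀ᵐ ω ∂μ, 0 ≤ Z i ω)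
    (hZone : ∀ i, ∫ ω, Z i ω ∂μ = 1) (x : ι → ℝ) (j : ι) (hx : ∀ i, i ≠ j → x i = 0) :
    ∫ ω, ⨆ i, |x i| * Z i ω ∂μ = |x j| := by
  calc ∫ ω, ⨆ i, |x i| * Z i ω ∂μ = ∫ ω, |x j| * Z j ω ∂μ := by
        refine integral_congr_ae ?_
        filter_upwards [hZpos j] with ω hω
        have : Nonempty ι := ⟨j⟩
        refine le_antisymm (ciSup_le fun i => ?_)
          (le_ciSup (f := fun i => |x i| * Z i ω) (Set.finite_range _).bddAbove j)
        rcases eq_or_ne i j with rfl | hij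
        · exact le_rfl
        · rw [hx i hij, abs_zero, zero_mul]
          positivity
    _ = |x j| := by rw [integral_const_mul, hZone, mul_one]

end DNorm

/-- Let `Z₁, …, Z_d` (`d ≥ 2`) be a generator with `D`-norm
`‖x‖_D = E (max_i |x_i| Z_i)`, let `s₁, …, s_d ∈ [0,1]^k` be pairwise distinct and `N = ‖·‖`
a norm on `ℝ^k`.  With `g̃_i(t) = min_{j ≠ i} ‖t - s_j‖` and
`g_i(t) = g̃_i(t) / ‖(g̃₁(t), …, g̃_d(t))‖_D`, the `g_i` are well defined (the denominator
never vanishes on `[0,1]^k`), continuous and nonnegative on `[0,1]^k`, satisfy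
`‖(g₁(t), …, g_d(t))‖_D = 1` for all `t ∈ [0,1]^k`, and `g_i(s_j) = δ_{ij}`. -/
theorem multidimensional_generalized_max_linear_weights
    {Ω : Type*} [MeasureSpace Ω] [IsProbabilityMeasure (ℙ : Measure Ω)]
    {k d : ℕ} (hd : 2 ≤ d)
    (Z : Fin d → Ω → ℝ)
    (hZint : ∀ i, Integrable (Z i))
    (hZpos : ∀ i, ∀ᵐ ω ∂ℙ, 0 ≤ Z i ω)
    (hZone : ∀ i, ∫ ω, Z i ω = 1)
    (N : (Fin k → ℝ) → ℝ)
    (hN0 : ∀ x, 0 ≤ N x)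
    (hNeq0 : ∀ x, N x = 0 ↔ x = 0)
    (hNadd : ∀ x y, N (x + y) ≤ N x + N y)
    (hNsmul : ∀ (c : ℝ) x, N (c • x) = |c| * N x)
    (s : Fin d → (Fin k → ℝ)) (hs : Function.Injective s)
    (hsI : ∀ i, s i ∈ Set.Icc (0 : Fin k → ℝ) 1)
    (Dnorm : (Fin d → ℝ) → ℝ) (hD : Dnorm = fun x => ∫ ω, ⨆ i, |x i| * Z i ω)
    (gt : Fin d → (Fin k → ℝ) → ℝ)
    (hgt : gt = fun i t => ⨅ j : {j : Fin d // j ≠ i}, N (t - s j.1))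
    (g : Fin d → (Fin k → ℝ) → ℝ)
    (hg : g = fun i t => gt i t / Dnorm (fun m => gt m t)) :
    (∀ t ∈ Set.Icc (0 : Fin k → ℝ) 1, Dnorm (fun m => gt m t) ≠ 0) ∧
    (∀ i, ContinuousOn (g i) (Set.Icc (0 : Fin k → ℝ) 1)) ∧
    (∀ i, ∀ t ∈ Set.Icc (0 : Fin k → ℝ) 1, 0 ≤ g i t) ∧
    (∀ t ∈ Set.Icc (0 : Fin k → ℝ) 1, Dnorm (fun i => g i t) = 1) ∧
    (∀ i j, g i (s j) = if i = j then 1 else 0) := by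
  have hne : ∀ i : Fin d, Nonempty {j : Fin d // j ≠ i} := fun i => by
    have : Nontrivial (Fin d) := Fin.nontrivial_iff_two_le.2 hd
    obtain ⟨j, hj⟩ := exists_ne i
    exact ⟨⟨j, hj⟩⟩
  have hgt_nonneg : ∀ i t, 0 ≤ gt i t := fun i t => by
    rw [hgt]
    exact Real.iInf_nonneg fun j => hN0 _
  have hgt_pos : ∀ i t, (∀ j, j ≠ i → t ≠ s j) → 0 < gt i t := fun i t h => by
    have := hne i
    obtain ⟨j, hj⟩ := exists_eq_ciInf_of_finite
      (f := fun j : {j : Fin d // j ≠ i} => N (t - s j.1))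
    rw [hgt]
    change 0 < ⨅ j : {j : Fin d // j ≠ i}, N (t - s j.1)
    rw [← hj]
    exact (hN0 _).lt_of_ne' fun h0 => h j.1 j.2 (sub_eq_zero.1 ((hNeq0 _).1 h0))
  have hgt_zero : ∀ i j, i ≠ j → gt i (s j) = 0 := fun i j hij => by
    refine le_antisymm ?_ (hgt_nonneg _ _)
    rw [hgt]
    refine (ciInf_le (f := fun l : {l : Fin d // l ≠ i} => N (s j - s l.1))
      (Set.finite_range _).bddBelow ⟨j, hij.symm⟩).trans_eq ?_
    rw [sub_self, (hNeq0 0).2 rfl]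
  have hNcont : Continuous N := continuous_of_subadditive_of_homogeneous hNadd hNsmul
  have hgt_cont : ∀ i, Continuous (gt i) := fun i => by
    have := hne i
    rw [hgt]
    simp_rw [← Finset.inf'_univ_eq_ciInf]
    exact Continuous.finset_inf'_apply _ fun j _ =>
      hNcont.comp (continuous_id.sub continuous_const)
  have hDsmul : ∀ (c : ℝ) x, Dnorm (c • x) = |c| * Dnorm x := fun c x => by
    rw [hD]
    exact integral_iSup_abs_smul_mul c x
  have hDcont : Continuous Dnorm := continuous_of_subadditive_of_homogeneous
    (fun x y => by
      rw [hD]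
      exact integral_iSup_abs_add_mul_le hZint hZpos x y) hDsmul
  have hDpos : ∀ t, 0 < Dnorm (fun m => gt m t) := fun t => by
    obtain ⟨m, hm⟩ : ∃ m, 0 < gt m t := by
      by_cases h : ∃ j, t = s j
      · obtain ⟨j, rfl⟩ := h
        exact ⟨j, hgt_pos _ _ fun i hij => hs.ne hij.symm⟩
      · push Not at h
        exact ⟨⟨0, by omega⟩, hgt_pos _ _ fun j _ => h j⟩
    rw [hD]
    exact (abs_pos.2 hm.ne').trans_le
      (abs_le_integral_iSup_abs_mul hZint hZone (fun m => gt m t) m)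
  have hg_apply : ∀ i t, g i t = gt i t / Dnorm (fun m => gt m t) := fun i t => by rw [hg]
  refine ⟨fun t _ => (hDpos t).ne', fun i => ?_, fun i t _ => ?_, fun t _ => ?_, fun i j => ?_⟩
  · rw [hg]
    exact ((hgt_cont i).div (hDcont.comp (continuous_pi hgt_cont))
      fun t => (hDpos t).ne').continuousOn
  · rw [hg_apply]
    exact div_nonneg (hgt_nonneg i t) (hDpos t).le
  · have h : (fun i => g i t) = (Dnorm (fun m => gt m t))⁻¹ • fun m => gt m t := by
      funext i
      rw [hg_apply, Pi.smul_apply, smul_eq_mul, div_eq_inv_mul]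
    rw [h, hDsmul, abs_of_pos (inv_pos.2 (hDpos t)), inv_mul_cancel₀ (hDpos t).ne']
  · rw [hg_apply]
    split_ifs with hij
    · subst hij
      have h : Dnorm (fun m => gt m (s i)) = gt i (s i) := by
        rw [hD, ← abs_of_nonneg (hgt_nonneg i (s i))]
        exact integral_iSup_abs_mul_of_forall_ne hZpos hZone (fun m => gt m (s i)) i
          fun m hm => hgt_zero m i hm
      have hpos := hDpos (s i)
      rw [h] at hpos ⊢
      exact div_self hpos.ne'
    · rw [hgt_zero i j hij, zero_div]
end

section
/- Let Z₁, …, Z_d be a generator and let 0 = s₁ < s₂ < ⋯ < s_{d-1} < s_d = 1 be a grid of [0,1]. Write ‖(x,y)‖_{D_{i-1,i}} := E[max(|x|·Z_{i-1}, |y|·Z_i)] for i = 2, …, d. Define g₁(t) := (s₂ − t)/‖(s₂ − t, t)‖_{D_{1,2}} for t ∈ [0, s₂] and g₁(t) := 0 otherwise; for i = 2, …, d−1 define g_i(t) := (t − s_{i-1})/‖(s_i − t, t − s_{i-1})‖_{D_{i-1,i}} for t ∈ [s_{i-1}, s_i], g_i(t) := (s_{i+1} − t)/‖(s_{i+1}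 − t, t − s_i)‖_{D_{i,i+1}} for t ∈ [s_i, s_{i+1}], and g_i(t) := 0 otherwise; define g_d(t) := (t − s_{d-1})/‖(s_d − t, t − s_{d-1})‖_{D_{d-1,d}} for t ∈ [s_{d-1}, 1] and g_d(t) := 0 otherwise. Then each g_i is continuous and nonnegative on [0,1], g_i(s_j) = δ_{ij} for all 1 ≤ i, j ≤ d, and E[max_{1≤i≤d} g_i(t)·Z_i] = 1 for all t ∈ [0,1]. -/
open MeasureTheory ProbabilityTheory

/-- The bivariate `D`-norm `‖(x, y)‖_D = E (max (|x| X) (|y| Y))` generated by `(X, Y)`. -/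
noncomputable def bivariateDNorm {Ω : Type*} [MeasureSpace Ω] (X Y : Ω → ℝ) (x y : ℝ) : ℝ :=
  ∫ ω, max (|x| * X ω) (|y| * Y ω)

section BivariateDNorm

variable {Ω : Type*} [MeasureSpace Ω] {X Y : Ω → ℝ}

lemma continuous_bivariateDNorm (hX : Integrable X) (hY : Integrable Y) :
    Continuous fun p : ℝ × ℝ => bivariateDNorm X Y p.1 p.2 := by
  rw [continuous_iff_continuousAt]
  intro p
  unfold bivariateDNorm
  refine continuousAt_of_dominated
    (bound := fun ω => (|p.1| + 1) * |X ω| + (|p.2| + 1) * |Y ω|) ?_ ?_ ?_ ?_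
  · exact .of_forall fun q => ((hX.const_mul _).sup (hY.const_mul _)).aestronglyMeasurable
  · have h1 : ∀ᶠ q : ℝ × ℝ in nhds p, |q.1| < |p.1| + 1 :=
      (continuous_abs.comp continuous_fst).continuousAt.eventually_lt continuousAt_const
        (by simp)
    have h2 : ∀ᶠ q : ℝ × ℝ in nhds p, |q.2| < |p.2| + 1 :=
      (continuous_abs.comp continuous_snd).continuousAt.eventually_lt continuousAt_const
        (by simp)
    filter_upwards [h1, h2] with q hq1 hq2
    refine .of_forall fun ω => ?_
    have h3 := mul_le_mul_of_nonneg_right hq1.le (abs_nonneg (X ω))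
    have h4 := mul_le_mul_of_nonneg_right hq2.le (abs_nonneg (Y ω))
    have h5 := abs_max_le_max_abs_abs (a := |q.1| * X ω) (b := |q.2| * Y ω)
    simp only [abs_mul, abs_abs] at h5
    have h6 : 0 ≤ |q.1| * |X ω| := by positivity
    have h7 : 0 ≤ |q.2| * |Y ω| := by positivity
    exact h5.trans (max_le (by linarith) (by linarith))
  · exact (hX.abs.const_mul _).add (hY.abs.const_mul _)
  · exact .of_forall fun ω => by fun_prop

lemma abs_left_le_bivariateDNorm (hX : Integrable X) (hY : Integrable Y) (hX1 : ∫ ω, X ω = 1)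
    (x y : ℝ) : |x| ≤ bivariateDNorm X Y x y := by
  calc |x| = ∫ ω, |x| * X ω := by rw [integral_const_mul, hX1, mul_one]
    _ ≤ _ := integral_mono (hX.const_mul _) ((hX.const_mul _).sup (hY.const_mul _))
      fun ω => le_max_left _ _

lemma abs_right_le_bivariateDNorm (hX : Integrable X) (hY : Integrable Y) (hY1 : ∫ ω, Y ω = 1)
    (x y : ℝ) : |y| ≤ bivariateDNorm X Y x y := by
  calc |y| = ∫ ω, |y| * Y ω := by rw [integral_const_mul, hY1, mul_one]
    _ ≤ _ := integral_mono (hY.const_mul _) ((hX.const_mul _).sup (hY.const_mul _))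
      fun ω => le_max_right _ _

lemma bivariateDNorm_zero_right (hX0 : ∀ᵐ ω ∂ℙ, 0 ≤ X ω) (hX1 : ∫ ω, X ω = 1) (x : ℝ) :
    bivariateDNorm X Y x 0 = |x| := by
  calc bivariateDNorm X Y x 0 = ∫ ω, |x| * X ω := by
        refine integral_congr_ae ?_
        filter_upwards [hX0] with ω h
        simpa using mul_nonneg (abs_nonneg x) h
    _ = |x| := by rw [integral_const_mul, hX1, mul_one]

lemma bivariateDNorm_zero_left (hY0 : ∀ᵐ ω ∂ℙ, 0 ≤ Y ω) (hY1 : ∫ ω, Y ω = 1) (y : ℝ) :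
    bivariateDNorm X Y 0 y = |y| := by
  calc bivariateDNorm X Y 0 y = ∫ ω, |y| * Y ω := by
        refine integral_congr_ae ?_
        filter_upwards [hY0] with ω h
        simpa using mul_nonneg (abs_nonneg y) h
    _ = |y| := by rw [integral_const_mul, hY1, mul_one]

lemma bivariateDNorm_pos (hX : Integrable X) (hY : Integrable Y) (hX1 : ∫ ω, X ω = 1)
    (hY1 : ∫ ω, Y ω = 1) {x y : ℝ} (h : x ≠ 0 ∨ y ≠ 0) : 0 < bivariateDNorm X Y x y := by
  rcases h with h | h
  · exact (abs_pos.2 h).trans_le (abs_left_le_bivariateDNorm hX hY hX1 x y)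
  · exact (abs_pos.2 h).trans_le (abs_right_le_bivariateDNorm hX hY hY1 x y)

lemma integral_max_div_bivariateDNorm {x y : ℝ} (hx : 0 ≤ x) (hy : 0 ≤ y)
    (h : 0 < bivariateDNorm X Y x y) :
    ∫ ω, max (x / bivariateDNorm X Y x y * X ω) (y / bivariateDNorm X Y x y * Y ω) = 1 := by
  set N := bivariateDNorm X Y x y with hN
  have : ∀ ω, max (x / N * X ω) (y / N * Y ω) = N⁻¹ * max (|x| * X ω) (|y| * Y ω) := by
    intro ω
    rw [mul_max_of_nonneg _ _ (inv_nonneg.2 h.le), abs_of_nonneg hx, abs_of_nonneg hy]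
    congr 1 <;> ring
  simp_rw [this]
  rw [integral_const_mul]
  exact inv_mul_cancel₀ h.ne'

end BivariateDNorm

lemma exists_mem_Icc_grid {s : ℕ → ℝ} {n : ℕ} {t : ℝ} (hn : 0 < n)
    (ht : t ∈ Set.Icc (s 0) (s n)) : ∃ k, k + 1 ≤ n ∧ t ∈ Set.Icc (s k) (s (k + 1)) := by
  induction n, hn using Nat.le_induction with
  | base => exact ⟨0, le_rfl, ht⟩
  | succ n _ ih =>
    rcases le_total t (s n) with h | h
    · obtain ⟨k, hk, hkt⟩ := ih ⟨ht.1, h⟩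
      exact ⟨k, by omega, hkt⟩
    · exact ⟨n, le_rfl, h, ht.2⟩

lemma continuousOn_Icc_grid {f : ℝ → ℝ} {s : ℕ → ℝ} {n : ℕ} (hs : ∀ k, k + 1 ≤ n → s k ≤ s (k + 1))
    (hf : ∀ k, k + 1 ≤ n → ContinuousOn f (Set.Icc (s k) (s (k + 1)))) :
    ContinuousOn f (Set.Icc (s 0) (s n)) := by
  have key : ∀ m ≤ n, s 0 ≤ s m ∧ ContinuousOn f (Set.Icc (s 0) (s m)) := by
    intro m
    induction m with
    | zero => simp
    | succ m ih =>
      intro hm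
      obtain ⟨h0, hc⟩ := ih (by omega)
      refine ⟨h0.trans (hs m hm), ?_⟩
      rw [← Set.Icc_union_Icc_eq_Icc h0 (hs m hm)]
      exact hc.union_of_isClosed (hf m hm) isClosed_Icc isClosed_Icc
  exact (key n le_rfl).2

lemma ciSup_fin_eq_max {d k : ℕ} (hk : k + 1 < d) (f : ℕ → ℝ) (hk0 : 0 ≤ f k)
    (hf : ∀ i < d, i ≠ k → i ≠ k + 1 → f i = 0) :
    ⨆ i : Fin d, f i = max (f k) (f (k + 1)) := by
  have hbdd : BddAbove (Set.range fun i : Fin d => f i) := Set.finite_range _ |>.bddAbove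
  have : Nonempty (Fin d) := ⟨⟨k, by omega⟩⟩
  refine le_antisymm (ciSup_le fun i => ?_) (max_le ?_ ?_)
  · by_cases h1 : i.1 = k
    · rw [h1]; exact le_max_left _ _
    by_cases h2 : i.1 = k + 1
    · rw [h2]; exact le_max_right _ _
    rw [hf i i.2 h1 h2]
    exact hk0.trans (le_max_left _ _)
  · exact le_ciSup hbdd (⟨k, by omega⟩ : Fin d)
  · exact le_ciSup hbdd (⟨k + 1, hk⟩ : Fin d)

/-- The one-dimensional generalized max-linear model.  Let `Z_0, …, Z_{d-1}`
(0-based indexing of `Z₁, …, Z_d`) be a generator and `0 = s_0 < s_1 < ⋯ < s_{d-1} = 1` a grid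
of `[0,1]`.  With the bivariate `D`-norms `‖(x,y)‖_{D_{i,i+1}} = E (max (|x| Z_i) (|y| Z_{i+1}))`,
define `g_i` piecewise by `g_i(t) = (t - s_{i-1}) / ‖(s_i - t, t - s_{i-1})‖_{D_{i-1,i}}` on
`[s_{i-1}, s_i]` (for `i ≥ 1`), `g_i(t) = (s_{i+1} - t) / ‖(s_{i+1} - t, t - s_i)‖_{D_{i,i+1}}`
on `[s_i, s_{i+1}]` (for `i ≤ d - 2`), and `g_i(t) = 0` elsewhere.  Then each `g_i` is
continuous and nonnegative on `[0,1]`, `g_i(s_j) = δ_{ij}`, and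
`E (max_i g_i(t) Z_i) = 1` for all `t ∈ [0,1]`. -/
theorem one_dimensional_generalized_max_linear_weights
    {Ω : Type*} [MeasureSpace Ω] [IsProbabilityMeasure (ℙ : Measure Ω)]
    {d : ℕ} (hd : 2 ≤ d)
    (Z : ℕ → Ω → ℝ)
    (hZint : ∀ i ≤ d - 1, Integrable (Z i))
    (hZpos : ∀ i ≤ d - 1, ∀ᵐ ω ∂ℙ, 0 ≤ Z i ω)
    (hZone : ∀ i ≤ d - 1, ∫ ω, Z i ω = 1)
    (s : ℕ → ℝ) (hs0 : s 0 = 0) (hs1 : s (d - 1) = 1)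
    (hsmono : ∀ i, i + 1 ≤ d - 1 → s i < s (i + 1))
    (g : ℕ → ℝ → ℝ)
    (hgleft : ∀ i, 1 ≤ i → i ≤ d - 1 → ∀ t ∈ Set.Icc (s (i - 1)) (s i),
      g i t = (t - s (i - 1))
        / ∫ ω, max (|s i - t| * Z (i - 1) ω) (|t - s (i - 1)| * Z i ω))
    (hgright : ∀ i, i + 1 ≤ d - 1 → ∀ t ∈ Set.Icc (s i) (s (i + 1)),
      g i t = (s (i + 1) - t)
        / ∫ ω, max (|s (i + 1) - t| * Z i ω) (|t - s i| * Z (i + 1) ω))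
    (hgzero : ∀ i ≤ d - 1, ∀ t : ℝ,
      t ∉ Set.Icc (s (i - 1)) (s (min (i + 1) (d - 1))) → g i t = 0) :
    (∀ i ≤ d - 1, ContinuousOn (g i) (Set.Icc (0 : ℝ) 1)) ∧
    (∀ i ≤ d - 1, ∀ t ∈ Set.Icc (0 : ℝ) 1, 0 ≤ g i t) ∧
    (∀ i ≤ d - 1, ∀ j ≤ d - 1, g i (s j) = if i = j then 1 else 0) ∧
    (∀ t ∈ Set.Icc (0 : ℝ) 1, ∫ ω, ⨆ i : Fin d, g i.1 t * Z i.1 ω = 1) := by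
  have hmono : ∀ i j, i < j → j ≤ d - 1 → s i < s j := by
    intro i j hij
    induction j, hij using Nat.le_induction with
    | base => exact hsmono i
    | succ j _ ih => exact fun hj => (ih (by omega)).trans (hsmono j hj)
  have hmono' : ∀ i j, i ≤ j → j ≤ d - 1 → s i ≤ s j := fun i j hij hj =>
    hij.eq_or_lt.elim (fun h => h ▸ le_rfl) fun h => (hmono i j h hj).le
  let N : ℕ → ℝ → ℝ := fun k t => bivariateDNorm (Z k) (Z (k + 1)) (s (k + 1) - t) (t - s k)
  have hNpos : ∀ k, k + 1 ≤ d - 1 → ∀ t, 0 < N k t := by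
    intro k hk t
    refine bivariateDNorm_pos (hZint k (by omega)) (hZint _ hk) (hZone k (by omega))
      (hZone _ hk) ?_
    by_contra! h
    linarith [hsmono k hk]
  have hNcont : ∀ k, k + 1 ≤ d - 1 → Continuous (N k) := fun k hk =>
    (continuous_bivariateDNorm (hZint k (by omega)) (hZint _ hk)).comp
      (by fun_prop : Continuous fun t : ℝ => (s (k + 1) - t, t - s k))
  have hgl : ∀ k, k + 1 ≤ d - 1 → ∀ t ∈ Set.Icc (s k) (s (k + 1)),
      g k t = (s (k + 1) - t) / N k t := hgright
  have hgr : ∀ k, k + 1 ≤ d - 1 → ∀ t ∈ Set.Icc (s k) (s (k + 1)),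
      g (k + 1) t = (t - s k) / N k t := fun k hk => hgleft (k + 1) (by omega) hk
  have hg0 : ∀ k, k + 1 ≤ d - 1 → ∀ t ∈ Set.Icc (s k) (s (k + 1)), ∀ i ≤ d - 1,
      i ≠ k → i ≠ k + 1 → g i t = 0 := by
    intro k hk t ht i hi hik hik1
    by_cases hmem : t ∈ Set.Icc (s (i - 1)) (s (min (i + 1) (d - 1)))
    · rcases lt_or_gt_of_ne hik with h | h
      · rw [min_eq_left (by omega)] at hmem
        have h1 : t = s (i + 1) :=
          le_antisymm hmem.2 ((hmono' (i + 1) k h (by omega)).trans ht.1)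
        rw [hgl i (by omega) t ⟨h1 ▸ (hsmono i (by omega)).le, h1.le⟩, h1, sub_self, zero_div]
      · obtain ⟨j, rfl⟩ : ∃ j, i = j + 1 := ⟨i - 1, by omega⟩
        have h1 : t = s j := le_antisymm (ht.2.trans (hmono' (k + 1) j (by omega) (by omega)))
          hmem.1
        rw [hgr j hi t ⟨h1.ge, h1 ▸ (hsmono j hi).le⟩, h1, sub_self, zero_div]
    · exact hgzero i hi t hmem
  have hcell : ∀ t ∈ Set.Icc (0 : ℝ) 1, ∃ k, k + 1 ≤ d - 1 ∧ t ∈ Set.Icc (s k) (s (k + 1)) :=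
    fun t ht => exists_mem_Icc_grid (by omega) (by rwa [hs0, hs1])
  have hnonneg : ∀ i ≤ d - 1, ∀ t ∈ Set.Icc (0 : ℝ) 1, 0 ≤ g i t := by
    intro i hi t ht
    obtain ⟨k, hk, htk⟩ := hcell t ht
    by_cases h1 : i = k
    · rw [h1, hgl k hk t htk]
      exact div_nonneg (sub_nonneg.2 htk.2) (hNpos k hk t).le
    by_cases h2 : i = k + 1
    · rw [h2, hgr k hk t htk]
      exact div_nonneg (sub_nonneg.2 htk.1) (hNpos k hk t).le
    exact (hg0 k hk t htk i hi h1 h2).ge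
  refine ⟨fun i hi => ?_, hnonneg, fun i hi j hj => ?_, fun t ht => ?_⟩
  · rw [← hs0, ← hs1]
    refine continuousOn_Icc_grid (fun k hk => (hsmono k hk).le) fun k hk => ?_
    have hne : ∀ t ∈ Set.Icc (s k) (s (k + 1)), N k t ≠ 0 := fun t _ => (hNpos k hk t).ne'
    by_cases h1 : i = k
    · subst h1
      exact ((continuousOn_const.sub continuousOn_id).div (hNcont i hk).continuousOn hne).congr
        (hgl i hk)
    by_cases h2 : i = k + 1
    · subst h2
      exact ((continuousOn_id.sub continuousOn_const).div (hNcont k hk).continuousOn hne).congr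
        (hgr k hk)
    exact continuousOn_const.congr fun t ht => hg0 k hk t ht i hi h1 h2
  · by_cases hjd : j + 1 ≤ d - 1
    · have hlt := hsmono j hjd
      have hmem : s j ∈ Set.Icc (s j) (s (j + 1)) := ⟨le_rfl, hlt.le⟩
      split_ifs with h1
      · have hN : N j (s j) = s (j + 1) - s j := by
          simp only [N, sub_self]
          rw [bivariateDNorm_zero_right (hZpos j hj) (hZone j hj), abs_of_pos (sub_pos.2 hlt)]
        rw [h1, hgl j hjd _ hmem, hN, div_self (sub_pos.2 hlt).ne']
      by_cases h2 : i = j + 1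
      · rw [h2, hgr j hjd _ hmem, sub_self, zero_div]
      exact hg0 j hjd _ hmem i hi h1 h2
    · obtain ⟨k, rfl⟩ : ∃ k, j = k + 1 := ⟨j - 1, by omega⟩
      have hlt := hsmono k hj
      have hmem : s (k + 1) ∈ Set.Icc (s k) (s (k + 1)) := ⟨hlt.le, le_rfl⟩
      split_ifs with h1
      · have hN : N k (s (k + 1)) = s (k + 1) - s k := by
          simp only [N, sub_self]
          rw [bivariateDNorm_zero_left (hZpos _ hj) (hZone _ hj), abs_of_pos (sub_pos.2 hlt)]
        rw [h1, hgr k hj _ hmem, hN, div_self (sub_pos.2 hlt).ne']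
      by_cases h2 : i = k
      · rw [h2, hgl k hj _ hmem, sub_self, zero_div]
      exact hg0 k hj _ hmem i hi h2 h1
  · obtain ⟨k, hk, htk⟩ := hcell t ht
    rw [← integral_max_div_bivariateDNorm (sub_nonneg.2 htk.2) (sub_nonneg.2 htk.1)
      (hNpos k hk t)]
    refine integral_congr_ae ?_
    filter_upwards [hZpos k (by omega)] with ω hω
    rw [ciSup_fin_eq_max (k := k) (by omega) (fun i => g i t * Z i ω)
      (mul_nonneg (hnonneg k (by omega) t ht) hω)
      fun i hi h1 h2 => by simp [hg0 k hk t htk i (by omega) h1 h2],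
      hgl k hk t htk, hgr k hk t htk]
end

section
/- Let K be an admissible kernel, Z₁, …, Z_d a generator, and s₁, …, s_d pairwise distinct points of [0,1]^k with a norm ‖·‖ on ℝ^k. For h > 0 define g_{i,h}(t) := K(‖t − s_i‖/h) / E[max_{1≤j≤d} K(‖t − s_j‖/h)·Z_j]. Then: (a) 0 < g_{i,h}(t) ≤ 1 for all t ∈ [0,1]^k, h > 0 and i; (b) g_{i,h}(s_i) → 1 as h → 0⁺; (c) if t ∈ [0,1]^k is such that ‖t − s_j‖ < ‖t − s_i‖ for some j ≠ i (i.e. t does not lie in the set N(s_i) of points closest to s_i), then g_{i,h}(t) → 0 as h → 0⁺. -/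
open MeasureTheory ProbabilityTheory Filter Topology

/-- A finite supremum of integrable functions is integrable. -/
theorem integrable_iSup_fin {Ω : Type*} [MeasurableSpace Ω] {μ : Measure Ω} {ι : Type*}
    [Fintype ι] [Nonempty ι] {f : ι → Ω → ℝ} (hf : ∀ i, Integrable (f i) μ) :
    Integrable (fun ω => ⨆ j, f j ω) μ := by
  refine (integrable_finsetSum Finset.univ fun i _ => (hf i).norm).mono'
    (AEMeasurable.iSup fun i => (hf i).aemeasurable).aestronglyMeasurable
    (Eventually.of_forall fun ω => ?_)
  have hle : ∀ i, ‖f i ω‖ ≤ ∑ j, ‖f j ω‖ := fun i =>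
    Finset.single_le_sum (f := fun j => ‖f j ω‖) (fun j _ => norm_nonneg _) (Finset.mem_univ i)
  obtain ⟨i, hi⟩ := exists_eq_ciSup_of_finite (f := fun j => f j ω)
  rw [← hi]
  exact hle i

/-- Each coefficient is bounded by the expected weighted maximum of a generator. -/
theorem le_integral_iSup_mul {Ω : Type*} [MeasurableSpace Ω] {μ : Measure Ω} {ι : Type*}
    [Fintype ι] [Nonempty ι] {Z : ι → Ω → ℝ} (hint : ∀ i, Integrable (Z i) μ)
    (hone : ∀ i, ∫ ω, Z i ω ∂μ = 1) (c : ι → ℝ) (i : ι) :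
    c i ≤ ∫ ω, ⨆ j, c j * Z j ω ∂μ := by
  calc c i = ∫ ω, c i * Z i ω ∂μ := by rw [integral_const_mul, hone, mul_one]
    _ ≤ _ := integral_mono ((hint i).const_mul _)
      (integrable_iSup_fin fun j => (hint j).const_mul (c j))
      fun ω => le_ciSup (f := fun j => c j * Z j ω) (Set.finite_range _).bddAbove i

/-- The expected weighted maximum of a generator is bounded by the sum of the weights. -/
theorem integral_iSup_mul_le {Ω : Type*} [MeasurableSpace Ω] {μ : Measure Ω} {ι : Type*}
    [Fintype ι] [Nonempty ι] {Z : ι → Ω → ℝ} (hint : ∀ i, Integrable (Z i) μ)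
    (hpos : ∀ i, ∀ᵐ ω ∂μ, 0 ≤ Z i ω) (hone : ∀ i, ∫ ω, Z i ω ∂μ = 1)
    {c : ι → ℝ} (hc : ∀ i, 0 ≤ c i) :
    ∫ ω, ⨆ j, c j * Z j ω ∂μ ≤ ∑ j, c j := by
  calc _ ≤ ∫ ω, ∑ j, c j * Z j ω ∂μ := by
        refine integral_mono_ae (integrable_iSup_fin fun j => (hint j).const_mul (c j))
          (integrable_finsetSum _ fun j _ => (hint j).const_mul (c j)) ?_
        filter_upwards [ae_all_iff.2 hpos] with ω hω
        exact ciSup_le fun i => Finset.single_le_sum (f := fun j => c j * Z j ω)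
          (fun j _ => mul_nonneg (hc j) (hω j)) (Finset.mem_univ i)
    _ = ∑ j, c j := by
        rw [integral_finsetSum _ fun j _ => (hint j).const_mul (c j)]
        simp [integral_const_mul, hone]

/-- Kernel weights.  Let `K` be an admissible kernel, `Z₁, …, Z_d` a
generator, `s₁, …, s_d ∈ [0,1]^k` pairwise distinct, `N = ‖·‖` a norm on `ℝ^k`, and for
`h > 0` put `g_{i,h}(t) = K(‖t - s_i‖/h) / E (max_j K(‖t - s_j‖/h) Z_j)`.  Then:
(a) `0 < g_{i,h}(t) ≤ 1` for all `t ∈ [0,1]^k`, `h > 0`, `i`;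
(b) `g_{i,h}(s_i) → 1` as `h → 0⁺`;
(c) if `‖t - s_j‖ < ‖t - s_i‖` for some `j ≠ i`, then `g_{i,h}(t) → 0` as `h → 0⁺`. -/
theorem kernel_weights_properties
    {Ω : Type*} [MeasureSpace Ω] [IsProbabilityMeasure (ℙ : Measure Ω)]
    {k d : ℕ} (hd : 0 < d)
    (Z : Fin d → Ω → ℝ)
    (hZint : ∀ i, Integrable (Z i))
    (hZpos : ∀ i, ∀ᵐ ω ∂ℙ, 0 ≤ Z i ω)
    (hZone : ∀ i, ∫ ω, Z i ω = 1)
    (N : (Fin k → ℝ) → ℝ)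
    (hN0 : ∀ x, 0 ≤ N x)
    (hNeq0 : ∀ x, N x = 0 ↔ x = 0)
    (hNadd : ∀ x y, N (x + y) ≤ N x + N y)
    (hNsmul : ∀ (c : ℝ) x, N (c • x) = |c| * N x)
    (s : Fin d → (Fin k → ℝ)) (hs : Function.Injective s)
    (hsI : ∀ i, s i ∈ Set.Icc (0 : Fin k → ℝ) 1)
    (K : ℝ → ℝ)
    (hKcont : ContinuousOn K (Set.Ici 0))
    (hKanti : StrictAntiOn K (Set.Ici 0))
    (hKzero : K 0 = 1)
    (hKrange : ∀ x ∈ Set.Ici (0 : ℝ), K x ∈ Set.Ioc (0 : ℝ) 1)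
    (hKratio : ∀ a b : ℝ, 0 ≤ b → b < a →
      Tendsto (fun x => K (a * x) / K (b * x)) atTop (𝓝 0))
    (g : Fin d → ℝ → (Fin k → ℝ) → ℝ)
    (hg : g = fun i h t =>
      K (N (t - s i) / h) / ∫ ω, ⨆ j, K (N (t - s j) / h) * Z j ω) :
    (∀ h : ℝ, 0 < h → ∀ t ∈ Set.Icc (0 : Fin k → ℝ) 1, ∀ i,
      0 < g i h t ∧ g i h t ≤ 1) ∧
    (∀ i, Tendsto (fun h => g i h (s i)) (𝓝[>] (0 : ℝ)) (𝓝 1)) ∧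
    (∀ i, ∀ t ∈ Set.Icc (0 : Fin k → ℝ) 1,
      (∃ j, j ≠ i ∧ N (t - s j) < N (t - s i)) →
      Tendsto (fun h => g i h t) (𝓝[>] (0 : ℝ)) (𝓝 0)) := by
  have : Nonempty (Fin d) := ⟨⟨0, hd⟩⟩
  have hK : ∀ {h : ℝ}, 0 < h → ∀ x, 0 < K (N x / h) := fun hh x =>
    (hKrange _ (div_nonneg (hN0 x) hh.le)).1
  have hlow : ∀ h t i, K (N (t - s i) / h) ≤ ∫ ω, ⨆ j, K (N (t - s j) / h) * Z j ω :=
    fun h t i => le_integral_iSup_mul hZint hZone (fun j => K (N (t - s j) / h)) i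
  have hbd : ∀ h : ℝ, 0 < h → ∀ t i, 0 < g i h t ∧ g i h t ≤ 1 := by
    intro h hh t i
    have hpos := (hK hh (t - s i)).trans_le (hlow h t i)
    rw [hg]
    exact ⟨div_pos (hK hh _) hpos, (div_le_one hpos).2 (hlow h t i)⟩
  have hinv : ∀ a b : ℝ, 0 ≤ b → b < a →
      Tendsto (fun h => K (a / h) / K (b / h)) (𝓝[>] (0 : ℝ)) (𝓝 0) := fun a b hb hab => by
    simpa only [div_eq_mul_inv, Function.comp_def] using
      (hKratio a b hb hab).comp tendsto_inv_nhdsGT_zero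
  refine ⟨fun h hh t _ i => hbd h hh t i, fun i => ?_, fun i t _ ⟨j, _, hlt⟩ => ?_⟩
  · have hN00 : N 0 = 0 := (hNeq0 0).2 rfl
    have hsum : Tendsto (fun h => ∑ j, K (N (s i - s j) / h)) (𝓝[>] (0 : ℝ)) (𝓝 1) := by
      have hterm : ∀ j ∈ Finset.univ, Tendsto (fun h => K (N (s i - s j) / h)) (𝓝[>] (0 : ℝ))
          (𝓝 (if j = i then 1 else 0)) := by
        intro j _
        split_ifs with hji
        · simp [hji, hN00, hKzero]
        · have hne : 0 < N (s i - s j) := (hN0 _).lt_of_ne' fun h0 =>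
            hji (hs (sub_eq_zero.1 ((hNeq0 _).1 h0))).symm
          simpa [hKzero] using hinv _ 0 le_rfl hne
      simpa using tendsto_finsetSum Finset.univ hterm
    refine tendsto_of_tendsto_of_tendsto_of_le_of_le' (by simpa using hsum.inv₀ one_ne_zero)
      tendsto_const_nhds ?_ (eventually_mem_nhdsWithin.mono fun h hh => (hbd h hh (s i) i).2)
    filter_upwards [self_mem_nhdsWithin] with h hh
    have hpos := (hK hh (s i - s i)).trans_le (hlow h (s i) i)
    have hup := integral_iSup_mul_le hZint hZpos hZone
      (c := fun j => K (N (s i - s j) / h)) fun j => (hK hh _).le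
    simp only [hg, sub_self, hN00, zero_div, hKzero, one_div]
    exact inv_anti₀ hpos hup
  · refine tendsto_of_tendsto_of_tendsto_of_le_of_le' tendsto_const_nhds
      (hinv _ _ (hN0 _) hlt)
      (eventually_mem_nhdsWithin.mono fun h hh => (hbd h hh t i).1.le) ?_
    filter_upwards [self_mem_nhdsWithin] with h hh
    rw [hg]
    exact div_le_div_of_nonneg_left (hK hh _).le (hK hh _) (hlow h t j)
end

section
/- Let Z be a generator process on I = [0,1]^k, K an admissible kernel, and let grids 𝒢_n with mesh ε_n → 0 and bandwidths h_n → 0 with ε_n/h_n → ∞ be given, with kernel weights g_{i,n}. Fix t ∈ I and for each n choose an index i(n) with ‖t − s_{i(n),n}‖ ≤ ‖t − s_{j,n}‖ for all j = 1, …, d(n) (a nearest grid point). Then g_{i(n),n}(t) → 1 as n → ∞. -/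
open MeasureTheory ProbabilityTheory Filter Topology

/-- A linear map out of a finite-dimensional space is bounded with respect to any norm on it. -/
theorem exists_norm_apply_le_mul_of_isNorm {E F : Type*} [AddCommGroup E] [Module ℝ E]
    [FiniteDimensional ℝ E] [NormedAddCommGroup F] [NormedSpace ℝ F] (N : E → ℝ)
    (hN0 : ∀ x, 0 ≤ N x) (hNeq0 : ∀ x, N x = 0 ↔ x = 0)
    (hNadd : ∀ x y, N (x + y) ≤ N x + N y) (hNsmul : ∀ (c : ℝ) x, N (c • x) = |c| * N x)
    (L : E →ₗ[ℝ] F) : ∃ C, 0 < C ∧ ∀ x, ‖L x‖ ≤ C * N x := by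
  let _ : Norm E := ⟨N⟩
  have core : NormedSpace.Core ℝ E :=
    { norm_nonneg := hN0
      norm_smul := hNsmul
      norm_triangle := hNadd
      norm_eq_zero_iff := hNeq0 }
  let _ : NormedAddCommGroup E := NormedAddCommGroup.ofCore core
  let _ : NormedSpace ℝ E := NormedSpace.ofCore core
  exact (LinearMap.toContinuousLinearMap L).bound

/-- Kernel ratios with argument outside a fixed radius `δ` become uniformly small, relative to
arguments shrinking to `0`, as the bandwidth tends to `0`. -/
theorem eventually_kernel_div_le {K : ℝ → ℝ} (hKanti : StrictAntiOn K (Set.Ici 0))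
    (hKpos : ∀ x ∈ Set.Ici (0 : ℝ), 0 < K x)
    (hKratio : ∀ a b : ℝ, 0 ≤ b → b < a →
      Tendsto (fun x => K (a * x) / K (b * x)) atTop (𝓝 0))
    {h r : ℕ → ℝ} (hhpos : ∀ n, 0 < h n) (hh : Tendsto h atTop (𝓝 0))
    (hr0 : ∀ n, 0 ≤ r n) (hr : Tendsto r atTop (𝓝 0)) {δ η : ℝ} (hδ : 0 < δ) (hη : 0 < η) :
    ∀ᶠ n in atTop, ∀ x, δ ≤ x → K (x / h n) / K (r n / h n) ≤ η := by
  have hinv : Tendsto (fun n => (h n)⁻¹) atTop atTop :=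
    tendsto_inv_nhdsGT_zero.comp
      (tendsto_nhdsWithin_iff.2 ⟨hh, Eventually.of_forall hhpos⟩)
  have hlim := (hKratio δ (δ / 2) (by positivity) (by linarith)).comp hinv
  filter_upwards [hlim.eventually_lt_const hη, hr.eventually_lt_const (half_pos hδ)]
    with n hn hrn x hx
  have hhn := hhpos n
  have hrn0 := hr0 n
  refine le_trans ?_ hn.le
  simp only [Function.comp_apply, ← div_eq_mul_inv]
  have hδn : 0 ≤ δ / h n := by positivity
  have hδn2 : 0 ≤ δ / 2 / h n := by positivity
  have hrhn : 0 ≤ r n / h n := by positivity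
  have hxn : 0 ≤ x / h n := div_nonneg (hδ.le.trans hx) hhn.le
  exact div_le_div₀ (hKpos _ hδn).le
    (hKanti.antitoneOn hδn hxn (by gcongr)) (hKpos _ hδn2)
    (hKanti.antitoneOn hrhn hδn2 (by gcongr))

/-- Maxima of weighted samples of a function `f` on a compact set converge to `f t`, when the
weights are at most `1`, equal `1` at sample points tending to `t`, and vanish uniformly away
from `t`. -/
theorem tendsto_iSup_mul_of_weights {E : Type*} [TopologicalSpace E] {A : Set E} {t : E}
    (ht : t ∈ A) {f : E → ℝ} (hf : ContinuousOn f A) {d : ℕ → ℕ} {s : (n : ℕ) → Fin (d n) → E}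
    (hs : ∀ n j, s n j ∈ A) (hfs : ∀ n j, 0 ≤ f (s n j)) (hft : 0 ≤ f t)
    {B : ℝ} (hB : ∀ n j, f (s n j) ≤ B)
    {w : (n : ℕ) → Fin (d n) → ℝ} (hw1 : ∀ n j, w n j ≤ 1)
    {i : (n : ℕ) → Fin (d n)} (hwi : ∀ n, w n (i n) = 1)
    (hi : Tendsto (fun n => s n (i n)) atTop (𝓝 t))
    (hw : ∀ U ∈ 𝓝 t, ∀ η > 0, ∀ᶠ n in atTop, ∀ j, s n j ∉ U → w n j ≤ η) :
    Tendsto (fun n => ⨆ j, w n j * f (s n j)) atTop (𝓝 (f t)) := by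
  have hB0 : 0 ≤ B := (hfs 0 (i 0)).trans (hB 0 (i 0))
  have hlow : Tendsto (fun n => f (s n (i n))) atTop (𝓝 (f t)) :=
    (hf t ht).tendsto.comp
      (tendsto_nhdsWithin_iff.2 ⟨hi, Eventually.of_forall fun n => hs n (i n)⟩)
  refine tendsto_order.2 ⟨fun a ha => ?_, fun a ha => ?_⟩
  · filter_upwards [hlow.eventually_const_lt ha] with n hn
    refine hn.trans_le ?_
    have := le_ciSup (Finite.bddAbove_range fun j => w n j * f (s n j)) (i n)
    simpa [hwi] using this
  · obtain ⟨b, hb, hba⟩ := exists_between ha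
    obtain ⟨U, hU, hUb⟩ := mem_nhdsWithin_iff_exists_mem_nhds_inter.1
      ((hf t ht).tendsto.eventually_lt_const hb)
    have hb0 : 0 < b := hft.trans_lt hb
    filter_upwards [hw U hU (b / (B + 1)) (by positivity)] with n hn
    have : Nonempty (Fin (d n)) := ⟨i n⟩
    refine (ciSup_le fun j => ?_).trans_lt hba
    by_cases hj : s n j ∈ U
    · have hlt : f (s n j) < b := hUb ⟨hj, hs n j⟩
      exact (mul_le_of_le_one_left (hfs n j) (hw1 n j)).trans hlt.le
    · calc w n j * f (s n j) ≤ b / (B + 1) * (B + 1) :=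
            mul_le_mul (hn j hj) ((hB n j).trans (by linarith)) (hfs n j) (by positivity)
        _ = b := by field_simp

/-- Let `Z` be a generator process on `I = [0,1]^k`, `K` an admissible
kernel, `𝒢_n = {s_{1,n}, …, s_{d(n),n}}` grids with mesh `ε_n → 0`, bandwidths `h_n → 0`
with `ε_n / h_n → ∞`, and kernel weights
`g_{i,n}(t) = K(‖t - s_{i,n}‖/h_n) / E (max_j K(‖t - s_{j,n}‖/h_n) Z_{s_{j,n}})`.
If `t ∈ I` and `i(n)` is a nearest grid point of `t` in `𝒢_n` for each `n`, then
`g_{i(n),n}(t) → 1`. -/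
theorem kernel_weight_at_nearest_grid_point_tendsto_one
    {Ω : Type*} [MeasureSpace Ω] [IsProbabilityMeasure (ℙ : Measure Ω)]
    {k : ℕ} (hk : 1 ≤ k)
    (N : (Fin k → ℝ) → ℝ)
    (hN0 : ∀ x, 0 ≤ N x)
    (hNeq0 : ∀ x, N x = 0 ↔ x = 0)
    (hNadd : ∀ x y, N (x + y) ≤ N x + N y)
    (hNsmul : ∀ (c : ℝ) x, N (c • x) = |c| * N x)
    (Z : Ω → (Fin k → ℝ) → ℝ)
    (hZcont : ∀ ω, ContinuousOn (Z ω) (Set.Icc (0 : Fin k → ℝ) 1))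
    (hZmeas : ∀ t ∈ Set.Icc (0 : Fin k → ℝ) 1, Measurable fun ω => Z ω t)
    (hZpos : ∀ t ∈ Set.Icc (0 : Fin k → ℝ) 1, ∀ᵐ ω ∂ℙ, 0 ≤ Z ω t)
    (hZone : ∀ t ∈ Set.Icc (0 : Fin k → ℝ) 1, ∫ ω, Z ω t = 1)
    (hZsup : Integrable (fun ω => ⨆ t : Set.Icc (0 : Fin k → ℝ) 1, Z ω t.1))
    (K : ℝ → ℝ)
    (hKcont : ContinuousOn K (Set.Ici 0))
    (hKanti : StrictAntiOn K (Set.Ici 0))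
    (hKzero : K 0 = 1)
    (hKrange : ∀ x ∈ Set.Ici (0 : ℝ), K x ∈ Set.Ioc (0 : ℝ) 1)
    (hKratio : ∀ a b : ℝ, 0 ≤ b → b < a →
      Tendsto (fun x => K (a * x) / K (b * x)) atTop (𝓝 0))
    (d : ℕ → ℕ) (hd : ∀ n, 0 < d n)
    (s : (n : ℕ) → Fin (d n) → (Fin k → ℝ))
    (hsI : ∀ n i, s n i ∈ Set.Icc (0 : Fin k → ℝ) 1)
    (hsinj : ∀ n, Function.Injective (s n))
    (ε : ℕ → ℝ)
    (hmesh : ∀ n, ∀ t ∈ Set.Icc (0 : Fin k → ℝ) 1, ∃ i, N (t - s n i) ≤ ε n)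
    (hε : Tendsto ε atTop (𝓝 0))
    (h : ℕ → ℝ) (hhpos : ∀ n, 0 < h n) (hh : Tendsto h atTop (𝓝 0))
    (hratio : Tendsto (fun n => ε n / h n) atTop atTop)
    (g : (n : ℕ) → Fin (d n) → (Fin k → ℝ) → ℝ)
    (hgdef : ∀ n i t, g n i t
      = K (N (t - s n i) / h n) / ∫ ω, ⨆ j, K (N (t - s n j) / h n) * Z ω (s n j))
    (t : Fin k → ℝ) (ht : t ∈ Set.Icc (0 : Fin k → ℝ) 1)
    (i : (n : ℕ) → Fin (d n))
    (hnear : ∀ n j, N (t - s n (i n)) ≤ N (t - s n j)) :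
    Tendsto (fun n => g n (i n) t) atTop (𝓝 1) := by
  have hKpos : ∀ x ∈ Set.Ici (0 : ℝ), 0 < K x := fun x hx => (hKrange x hx).1
  have hq0 : ∀ n j, N (t - s n j) / h n ∈ Set.Ici (0 : ℝ) := fun n j =>
    div_nonneg (hN0 _) (hhpos n).le
  have hr : Tendsto (fun n => N (t - s n (i n))) atTop (𝓝 0) := by
    refine squeeze_zero (fun n => hN0 _) (fun n => ?_) hε
    obtain ⟨j, hj⟩ := hmesh n t ht
    exact (hnear n j).trans hj
  obtain ⟨C, hC, hCN⟩ := exists_norm_apply_le_mul_of_isNorm N hN0 hNeq0 hNadd hNsmul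
    (LinearMap.id : (Fin k → ℝ) →ₗ[ℝ] (Fin k → ℝ))
  simp only [LinearMap.id_apply] at hCN
  have hi : Tendsto (fun n => s n (i n)) atTop (𝓝 t) := by
    rw [tendsto_iff_dist_tendsto_zero]
    refine squeeze_zero (fun n => dist_nonneg) (fun n => ?_) (by simpa using hr.const_mul C)
    rw [dist_comm, dist_eq_norm]
    exact hCN _
  set w : (n : ℕ) → Fin (d n) → ℝ :=
    fun n j => K (N (t - s n j) / h n) / K (N (t - s n (i n)) / h n) with hwdef
  have hw0 : ∀ n j, 0 ≤ w n j := fun n j =>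
    div_nonneg (hKpos _ (hq0 n j)).le (hKpos _ (hq0 n (i n))).le
  have hw1 : ∀ n j, w n j ≤ 1 := fun n j =>
    div_le_one_of_le₀ (hKanti.antitoneOn (hq0 n (i n)) (hq0 n j)
      (div_le_div_of_nonneg_right (hnear n j) (hhpos n).le)) (hKpos _ (hq0 n (i n))).le
  have hwi : ∀ n, w n (i n) = 1 := fun n => div_self (hKpos _ (hq0 n (i n))).ne'
  have hw : ∀ U ∈ 𝓝 t, ∀ η > 0, ∀ᶠ n in atTop, ∀ j, s n j ∉ U → w n j ≤ η := by
    intro U hU η hη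
    obtain ⟨ρ, hρ, hρU⟩ := Metric.mem_nhds_iff.1 hU
    filter_upwards [eventually_kernel_div_le hKanti hKpos hKratio hhpos hh
      (fun n => hN0 (t - s n (i n))) hr (div_pos hρ hC) hη] with n hn j hj
    refine hn _ ?_
    have hfar : ρ ≤ ‖t - s n j‖ := by
      by_contra! hlt
      exact hj (hρU (by rwa [Metric.mem_ball, dist_comm, dist_eq_norm]))
    rw [div_le_iff₀' hC]
    exact hfar.trans (hCN _)
  have hle : ∀ ω, ∀ u ∈ Set.Icc (0 : Fin k → ℝ) 1,
      Z ω u ≤ ⨆ v : Set.Icc (0 : Fin k → ℝ) 1, Z ω v.1 := fun ω u hu => by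
    have hbdd := isCompact_Icc.bddAbove_image (hZcont ω)
    rw [Set.image_eq_range] at hbdd
    exact le_ciSup hbdd ⟨u, hu⟩
  have hpos : ∀ᵐ ω ∂(ℙ : Measure Ω), 0 ≤ Z ω t ∧ ∀ n j, 0 ≤ Z ω (s n j) :=
    (hZpos t ht).and (ae_all_iff.2 fun n => ae_all_iff.2 fun j => hZpos _ (hsI n j))
  have hint : Tendsto (fun n => ∫ ω, ⨆ j, w n j * Z ω (s n j)) atTop (𝓝 (∫ ω, Z ω t)) := by
    refine tendsto_integral_of_dominated_convergence _ (fun n => ?_) hZsup (fun n => ?_) ?_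
    · exact (Measurable.iSup fun j =>
        (hZmeas _ (hsI n j)).const_mul (w n j)).aestronglyMeasurable
    · filter_upwards [hpos] with ω hω
      have : Nonempty (Fin (d n)) := ⟨i n⟩
      rw [Real.norm_of_nonneg (Real.iSup_nonneg fun j => mul_nonneg (hw0 n j) (hω.2 n j))]
      exact ciSup_le fun j => (mul_le_of_le_one_left (hω.2 n j) (hw1 n j)).trans
        (hle ω _ (hsI n j))
    · filter_upwards [hpos] with ω hω
      exact tendsto_iSup_mul_of_weights ht (hZcont ω) hsI hω.2 hω.1
        (fun n j => hle ω _ (hsI n j)) hw1 hwi hi hw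
  rw [hZone t ht] at hint
  have hg : ∀ n, g n (i n) t = (∫ ω, ⨆ j, w n j * Z ω (s n j))⁻¹ := fun n => by
    have hKi := hKpos _ (hq0 n (i n))
    have hfactor : ∀ ω, ⨆ j, K (N (t - s n j) / h n) * Z ω (s n j)
        = K (N (t - s n (i n)) / h n) * ⨆ j, w n j * Z ω (s n j) := fun ω => by
      rw [Real.mul_iSup_of_nonneg hKi.le]
      congr 1 with j
      rw [← mul_assoc, mul_div_cancel₀ _ hKi.ne']
    rw [hgdef]
    simp only [hfactor]
    rw [integral_const_mul, div_mul_cancel_left₀ hKi.ne']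
  simp only [hg]
  simpa using hint.inv₀ one_ne_zero
end

section
/- Let Z be a generator process on I = [0,1]^k, K an admissible kernel, grids 𝒢_n with mesh ε_n → 0, bandwidths h_n → 0 with ε_n/h_n → ∞, kernel weights g_{i,n} and Ẑ_{t,n} := max_{1≤i≤d(n)} g_{i,n}(t)·Z_{s_{i,n}}. Then for every t ∈ I, E[|Z_t − Ẑ_{t,n}|] → 0 as n → ∞. -/
open MeasureTheory ProbabilityTheory Filter Topology

/-- A norm on `ℝ^k`, given as a bare function, dominates a multiple of the sup norm. -/
lemma exists_pos_mul_norm_le {k : ℕ} (N : (Fin k → ℝ) → ℝ)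
    (hN0 : ∀ x, 0 ≤ N x) (hNeq0 : ∀ x, N x = 0 ↔ x = 0)
    (hNadd : ∀ x y, N (x + y) ≤ N x + N y)
    (hNsmul : ∀ (c : ℝ) x, N (c • x) = |c| * N x) :
    ∃ c > 0, ∀ x, c * ‖x‖ ≤ N x := by
  have hconv : ConvexOn ℝ Set.univ N := by
    refine ⟨convex_univ, fun x _ y _ a b ha hb _ => ?_⟩
    calc N (a • x + b • y) ≤ N (a • x) + N (b • y) := hNadd _ _
      _ = a • N x + b • N y := by
        rw [hNsmul, hNsmul, abs_of_nonneg ha, abs_of_nonneg hb, smul_eq_mul, smul_eq_mul]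
  have hcont : ContinuousOn N Set.univ := hconv.continuousOn isOpen_univ
  have hsphere : ∃ c > 0, ∀ x ∈ Metric.sphere (0 : Fin k → ℝ) 1, c ≤ N x := by
    rcases (Metric.sphere (0 : Fin k → ℝ) 1).eq_empty_or_nonempty with he | hne
    · exact ⟨1, one_pos, by simp [he]⟩
    · obtain ⟨x, hx, hmin⟩ := (isCompact_sphere (0 : Fin k → ℝ) 1).exists_isMinOn hne
        (hcont.mono (Set.subset_univ _))
      refine ⟨N x, (hN0 x).lt_of_ne' fun h => ?_, fun y hy => hmin hy⟩
      rw [(hNeq0 x).1 h] at hx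
      simp at hx
  obtain ⟨c, hc, hle⟩ := hsphere
  refine ⟨c, hc, fun x => ?_⟩
  rcases eq_or_ne x 0 with rfl | hx
  · simpa using hN0 0
  · have hxn : 0 < ‖x‖ := norm_pos_iff.2 hx
    have := hle (‖x‖⁻¹ • x) (by simp [norm_smul, hxn.ne'])
    rw [hNsmul, abs_of_pos (inv_pos.2 hxn), inv_mul_eq_div, le_div_iff₀ hxn] at this
    exact this

/-- Weighted maxima of a function over grids converge to its value at `t` if the weights are at
most one, attain one near `t`, and are uniformly small away from `t`. -/
lemma tendsto_iSup_weight_mul {E : Type*} [SeminormedAddCommGroup E] {I : Set E} {f : E → ℝ}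
    {t : E} {S c : ℝ} (hc : 0 < c) {N : E → ℝ} (hN : ∀ x, c * ‖x‖ ≤ N x)
    (hf : ContinuousWithinAt f I t) (hft : 0 ≤ f t) (hS : ∀ x ∈ I, f x ≤ S)
    {d : ℕ → ℕ} {s : (n : ℕ) → Fin (d n) → E} (hsI : ∀ n i, s n i ∈ I)
    (hfs : ∀ n i, 0 ≤ f (s n i)) {w : (n : ℕ) → Fin (d n) → ℝ}
    (hw0 : ∀ n i, 0 ≤ w n i) (hw1 : ∀ n i, w n i ≤ 1) {ε ρ : ℕ → ℝ}
    (hnear : ∀ n, ∃ i, w n i = 1 ∧ N (t - s n i) ≤ ε n)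
    (hfar : ∀ n i, 2 * ε n < N (t - s n i) → w n i ≤ ρ n)
    (hε : Tendsto ε atTop (𝓝 0)) (hρ : Tendsto ρ atTop (𝓝 0)) :
    Tendsto (fun n => ⨆ i, w n i * f (s n i)) atTop (𝓝 (f t)) := by
  rw [Metric.tendsto_atTop']
  intro η hη
  obtain ⟨δ, hδ, hclose⟩ := Metric.continuousWithinAt_iff.1 hf (η / 2) (half_pos hη)
  have hρS : ∀ᶠ n in atTop, ρ n * S < η / 2 :=
    (hρ.mul_const S).eventually_lt_const (by simpa using hη)
  have hεδ : ∀ᶠ n in atTop, 2 * ε n < c * δ :=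
    (hε.const_mul 2).eventually_lt_const (by simpa using mul_pos hc hδ)
  suffices h : ∀ᶠ n in atTop, dist (⨆ i, w n i * f (s n i)) (f t) < η by
    obtain ⟨n, hn⟩ := eventually_atTop.1 h
    exact ⟨n, fun m hm => hn m hm.le⟩
  filter_upwards [hρS, hεδ] with n h1 h2
  have hval : ∀ i, N (t - s n i) ≤ 2 * ε n → |f (s n i) - f t| < η / 2 := fun i hi => by
    refine hclose (hsI n i) ?_
    rw [dist_comm, dist_eq_norm]
    exact lt_of_mul_lt_mul_left (((hN _).trans hi).trans_lt h2) hc.le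
  obtain ⟨i₀, hi₀, hi₀N⟩ := hnear n
  have hε0 : 0 ≤ ε n := le_trans (by positivity) ((hN _).trans hi₀N)
  have : Nonempty (Fin (d n)) := ⟨i₀⟩
  have hupper : ⨆ i, w n i * f (s n i) ≤ f t + η / 2 := by
    refine ciSup_le fun i => ?_
    rcases le_or_gt (N (t - s n i)) (2 * ε n) with hi | hi
    · have := (abs_lt.1 (hval i hi)).2
      have := mul_le_of_le_one_left (hfs n i) (hw1 n i)
      linarith
    · have h3 : w n i * f (s n i) ≤ w n i * S :=
        mul_le_mul_of_nonneg_left (hS _ (hsI n i)) (hw0 n i)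
      have h4 : w n i * S ≤ ρ n * S :=
        mul_le_mul_of_nonneg_right (hfar n i hi) ((hfs n i).trans (hS _ (hsI n i)))
      linarith
  have hlower : f (s n i₀) ≤ ⨆ i, w n i * f (s n i) := by
    have := le_ciSup (Set.finite_range fun i => w n i * f (s n i)).bddAbove i₀
    simpa only [hi₀, one_mul] using this
  have := (abs_lt.1 (hval i₀ (by linarith))).1
  rw [Real.dist_eq, abs_lt]
  constructor <;> linarith

/-- Normalising an `L¹`-dominated, almost surely convergent sequence by its expectations does not
change its limit if the limit has expectation one. -/
lemma tendsto_integral_abs_sub_div_integral {Ω : Type*} [MeasurableSpace Ω] {μ : Measure Ω}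
    {X S : Ω → ℝ} {Y : ℕ → Ω → ℝ} (hX : AEStronglyMeasurable X μ)
    (hY : ∀ n, AEStronglyMeasurable (Y n) μ) (hS : Integrable S μ) (hXS : ∀ᵐ ω ∂μ, |X ω| ≤ S ω)
    (hYS : ∀ n, ∀ᵐ ω ∂μ, |Y n ω| ≤ S ω)
    (hlim : ∀ᵐ ω ∂μ, Tendsto (fun n => Y n ω) atTop (𝓝 (X ω))) (hX1 : ∫ ω, X ω ∂μ = 1) :
    Tendsto (fun n => ∫ ω, |X ω - Y n ω / ∫ ω', Y n ω' ∂μ| ∂μ) atTop (𝓝 0) := by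
  have he : Tendsto (fun n => ∫ ω, Y n ω ∂μ) atTop (𝓝 1) := hX1 ▸
    tendsto_integral_of_dominated_convergence S hY hS (by simpa using hYS) hlim
  have key : Tendsto (fun n => ∫ ω, |X ω - Y n ω / ∫ ω', Y n ω' ∂μ| ∂μ) atTop
      (𝓝 (∫ _, (0 : ℝ) ∂μ)) := by
    refine tendsto_integral_filter_of_dominated_convergence (fun ω => 3 * S ω)
      (Eventually.of_forall fun n => by
        simp only [div_eq_mul_inv]
        exact (hX.sub ((hY n).mul_const _)).norm) ?_
      (hS.const_mul 3) ?_
    · filter_upwards [he.eventually_const_lt (show (1 / 2 : ℝ) < 1 by norm_num)] with n hn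
      filter_upwards [hXS, hYS n] with ω h1 h2
      have hpos : 0 < ∫ ω', Y n ω' ∂μ := by linarith
      have h3 : |Y n ω / ∫ ω', Y n ω' ∂μ| ≤ 2 * S ω := by
        rw [abs_div, abs_of_pos hpos, div_le_iff₀ hpos]
        nlinarith [abs_nonneg (Y n ω)]
      rw [Real.norm_eq_abs, abs_abs]
      have := abs_sub (X ω) (Y n ω / ∫ ω', Y n ω' ∂μ)
      linarith
    · filter_upwards [hlim] with ω hω
      simpa using ((hω.div he one_ne_zero).const_sub (X ω)).abs
  simpa using key

/-- Let `Z` be a generator process on `I = [0,1]^k`, `K` an admissible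
kernel, grids `𝒢_n` with mesh `ε_n → 0`, bandwidths `h_n → 0` with `ε_n / h_n → ∞`,
kernel weights `g_{i,n}` and `Ẑ_{t,n} = max_i g_{i,n}(t) Z_{s_{i,n}}`.  Then for every
`t ∈ I`, `E |Z_t - Ẑ_{t,n}| → 0` as `n → ∞`. -/
theorem kernel_generator_L1_convergence
    {Ω : Type*} [MeasureSpace Ω] [IsProbabilityMeasure (ℙ : Measure Ω)]
    {k : ℕ} (hk : 1 ≤ k)
    (N : (Fin k → ℝ) → ℝ)
    (hN0 : ∀ x, 0 ≤ N x)
    (hNeq0 : ∀ x, N x = 0 ↔ x = 0)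
    (hNadd : ∀ x y, N (x + y) ≤ N x + N y)
    (hNsmul : ∀ (c : ℝ) x, N (c • x) = |c| * N x)
    (Z : Ω → (Fin k → ℝ) → ℝ)
    (hZcont : ∀ ω, ContinuousOn (Z ω) (Set.Icc (0 : Fin k → ℝ) 1))
    (hZmeas : ∀ t ∈ Set.Icc (0 : Fin k → ℝ) 1, Measurable fun ω => Z ω t)
    (hZpos : ∀ t ∈ Set.Icc (0 : Fin k → ℝ) 1, ∀ᵐ ω ∂ℙ, 0 ≤ Z ω t)
    (hZone : ∀ t ∈ Set.Icc (0 : Fin k → ℝ) 1, ∫ ω, Z ω t = 1)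
    (hZsup : Integrable (fun ω => ⨆ t : Set.Icc (0 : Fin k → ℝ) 1, Z ω t.1))
    (K : ℝ → ℝ)
    (hKcont : ContinuousOn K (Set.Ici 0))
    (hKanti : StrictAntiOn K (Set.Ici 0))
    (hKzero : K 0 = 1)
    (hKrange : ∀ x ∈ Set.Ici (0 : ℝ), K x ∈ Set.Ioc (0 : ℝ) 1)
    (hKratio : ∀ a b : ℝ, 0 ≤ b → b < a →
      Tendsto (fun x => K (a * x) / K (b * x)) atTop (𝓝 0))
    (d : ℕ → ℕ) (hd : ∀ n, 0 < d n)
    (s : (n : ℕ) → Fin (d n) → (Fin k → ℝ))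
    (hsI : ∀ n i, s n i ∈ Set.Icc (0 : Fin k → ℝ) 1)
    (hsinj : ∀ n, Function.Injective (s n))
    (ε : ℕ → ℝ)
    (hmesh : ∀ n, ∀ t ∈ Set.Icc (0 : Fin k → ℝ) 1, ∃ i, N (t - s n i) ≤ ε n)
    (hε : Tendsto ε atTop (𝓝 0))
    (h : ℕ → ℝ) (hhpos : ∀ n, 0 < h n) (hh : Tendsto h atTop (𝓝 0))
    (hratio : Tendsto (fun n => ε n / h n) atTop atTop)
    (g : (n : ℕ) → Fin (d n) → (Fin k → ℝ) → ℝ)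
    (hgdef : ∀ n i t, g n i t
      = K (N (t - s n i) / h n) / ∫ ω, ⨆ j, K (N (t - s n j) / h n) * Z ω (s n j)) :
    ∀ t ∈ Set.Icc (0 : Fin k → ℝ) 1,
      Tendsto (fun n => ∫ ω, |Z ω t - ⨆ i, g n i t * Z ω (s n i)|) atTop (𝓝 0) := by
  intro t ht
  obtain ⟨c, hc, hcN⟩ := exists_pos_mul_norm_le N hN0 hNeq0 hNadd hNsmul
  have : ∀ n, Nonempty (Fin (d n)) := fun n => ⟨⟨0, hd n⟩⟩
  have hε0 : ∀ n, 0 ≤ ε n := fun n =>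
    let ⟨_, hi⟩ := hmesh n t ht
    (hN0 _).trans hi
  have harg : ∀ n i, N (t - s n i) / h n ∈ Set.Ici (0 : ℝ) := fun n i =>
    div_nonneg (hN0 _) (hhpos n).le
  choose m hm using fun n => Finite.exists_max fun i => K (N (t - s n i) / h n)
  have hmN : ∀ n, N (t - s n (m n)) ≤ ε n := fun n => by
    obtain ⟨i, hi⟩ := hmesh n t ht
    have := (hKanti.le_iff_ge (harg n i) (harg n (m n))).1 (hm n i)
    exact ((div_le_div_iff_of_pos_right (hhpos n)).1 this).trans hi
  set M : ℕ → ℝ := fun n => K (N (t - s n (m n)) / h n)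
  have hM : ∀ n, 0 < M n := fun n => (hKrange _ (harg n (m n))).1
  set w : (n : ℕ) → Fin (d n) → ℝ := fun n i => K (N (t - s n i) / h n) / M n
  have hw0 : ∀ n i, 0 ≤ w n i := fun n i => div_nonneg (hKrange _ (harg n i)).1.le (hM n).le
  have hw1 : ∀ n i, w n i ≤ 1 := fun n i => (div_le_one (hM n)).2 (hm n i)
  have hfar : ∀ n i, 2 * ε n < N (t - s n i) →
      w n i ≤ K (2 * (ε n / h n)) / K (1 * (ε n / h n)) := fun n i hi => by
    have hq : 0 ≤ ε n / h n := div_nonneg (hε0 n) (hhpos n).le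
    have h1q : 1 * (ε n / h n) ∈ Set.Ici (0 : ℝ) := by simpa using hq
    have h2q : 2 * (ε n / h n) ∈ Set.Ici (0 : ℝ) := mul_nonneg zero_le_two hq
    refine div_le_div₀ (hKrange _ h2q).1.le ?_ (hKrange _ h1q).1 ?_
    · refine hKanti.antitoneOn h2q (harg n i) ?_
      rw [← mul_div_assoc]
      exact div_le_div_of_nonneg_right hi.le (hhpos n).le
    · refine hKanti.antitoneOn (harg n (m n)) h1q ?_
      rw [one_mul]
      exact div_le_div_of_nonneg_right (hmN n) (hhpos n).le
  have hρ : Tendsto (fun n => K (2 * (ε n / h n)) / K (1 * (ε n / h n))) atTop (𝓝 0) :=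
    (hKratio 2 1 zero_le_one one_lt_two).comp hratio
  have hle : ∀ ω, ∀ x ∈ Set.Icc (0 : Fin k → ℝ) 1,
      Z ω x ≤ ⨆ u : Set.Icc (0 : Fin k → ℝ) 1, Z ω u.1 := fun ω x hx => by
    have hb := isCompact_Icc.bddAbove_image (hZcont ω)
    rw [Set.image_eq_range] at hb
    exact le_ciSup hb ⟨x, hx⟩
  have hgrid : ∀ᵐ ω ∂ℙ, ∀ n i, 0 ≤ Z ω (s n i) :=
    ae_all_iff.2 fun n => ae_all_iff.2 fun i => hZpos _ (hsI n i)
  have hY0 : ∀ n, ∀ᵐ ω ∂ℙ, 0 ≤ ⨆ i, w n i * Z ω (s n i) := fun n => by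
    filter_upwards [hgrid] with ω hω
    exact Real.iSup_nonneg fun i => mul_nonneg (hw0 n i) (hω n i)
  have hlim := tendsto_integral_abs_sub_div_integral (μ := (ℙ : Measure Ω))
    (X := fun ω => Z ω t) (Y := fun n ω => ⨆ i, w n i * Z ω (s n i))
    (hZmeas t ht).aestronglyMeasurable
    (fun n => (Measurable.iSup fun i =>
      (hZmeas _ (hsI n i)).const_mul (w n i)).aestronglyMeasurable) hZsup
    (by
      filter_upwards [hZpos t ht] with ω hω
      rw [abs_of_nonneg hω]
      exact hle ω t ht)
    (fun n => by
      filter_upwards [hgrid, hY0 n] with ω hω hω0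
      rw [abs_of_nonneg hω0]
      exact ciSup_le fun i =>
        (mul_le_of_le_one_left (hω n i) (hw1 n i)).trans (hle ω _ (hsI n i)))
    (by
      filter_upwards [hgrid, hZpos t ht] with ω hω hωt
      exact tendsto_iSup_weight_mul hc hcN (hZcont ω t ht) hωt (hle ω) hsI hω hw0 hw1
        (fun n => ⟨m n, div_self (hM n).ne', hmN n⟩) hfar hε hρ)
    (hZone t ht)
  refine hlim.congr fun n => ?_
  have hden : ∫ ω, ⨆ j, K (N (t - s n j) / h n) * Z ω (s n j)
      = M n * ∫ ω, ⨆ i, w n i * Z ω (s n i) := by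
    rw [← integral_const_mul]
    congr 1 with ω
    rw [Real.mul_iSup_of_nonneg (hM n).le]
    congr 1 with i
    rw [← mul_assoc, mul_div_cancel₀ _ (hM n).ne']
  congr 1 with ω
  rw [div_eq_mul_inv, Real.iSup_mul_of_nonneg (inv_nonneg.2 (integral_nonneg_of_ae (hY0 n)))]
  congr 3 with i
  rw [hgdef, hden, ← div_div, div_eq_mul_inv (_ / M n), mul_right_comm]
end

section
/- Let Z be a generator process on I = [0,1]^k and let η be a standard max-stable process with generator process Z. Let K be an admissible kernel, grids 𝒢_n with mesh ε_n → 0, bandwidths h_n → 0 with ε_n/h_n → ∞, kernel weights g_{i,n}, and define the kernel-based discretized version η̂_{t,n} := max_{1≤i≤d(n)} η_{s_{i,n}} / g_{i,n}(t) for t ∈ I. Then for every t ∈ I, the mean squared error MSE(η̂_{t,n}) := E[(η_t − η̂_{t,n})²] converges to 0 as n → ∞. -/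
open MeasureTheory ProbabilityTheory Filter Topology

/-- Finite maxima converge to `L` as soon as one selected entry converges to `L` and all entries are
eventually bounded by `L + e`. -/
lemma tendsto_iSup_fin_of_eventually_le {d : ℕ → ℕ} {f : ∀ n, Fin (d n) → ℝ}
    (i : ∀ n, Fin (d n)) {L : ℝ} (hlow : Tendsto (fun n => f n (i n)) atTop (𝓝 L))
    (hup : ∀ e > 0, ∀ᶠ n in atTop, ∀ j, f n j ≤ L + e) :
    Tendsto (fun n => ⨆ j, f n j) atTop (𝓝 L) := by
  have hle : ∀ n, f n (i n) ≤ ⨆ j, f n j := fun n => le_ciSup (Set.finite_range _).bddAbove (i n)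
  refine tendsto_order.2 ⟨fun a ha => ?_, fun a ha => ?_⟩
  · filter_upwards [(tendsto_order.1 hlow).1 a ha] with n hn
    exact hn.trans_le (hle n)
  · filter_upwards [hup ((a - L) / 2) (by linarith)] with n hn
    have : Nonempty (Fin (d n)) := ⟨i n⟩
    have := ciSup_le hn
    linarith

/-- Weights in `(0, 1]`, attaining the value `1`, which become negligible away from `t`. -/
structure ConcentratesAt {E : Type*} [PseudoMetricSpace E] (t : E) {d : ℕ → ℕ}
    (s : ∀ n, Fin (d n) → E) (w : ∀ n, Fin (d n) → ℝ) : Prop where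
  pos : ∀ n i, 0 < w n i
  le_one : ∀ n i, w n i ≤ 1
  exists_eq_one : ∀ n, ∃ i, w n i = 1
  eventually_small : ∀ δ > 0, ∀ ρ > 0, ∀ᶠ n in atTop, ∀ i, dist (s n i) t < δ ∨ w n i ≤ ρ

namespace ConcentratesAt

variable {E : Type*} [PseudoMetricSpace E] {t : E} {d : ℕ → ℕ}
  {s : ∀ n, Fin (d n) → E} {w : ∀ n, Fin (d n) → ℝ}

lemma tendsto_of_eq_one (hw : ConcentratesAt t s w) {i : ∀ n, Fin (d n)}
    (hi : ∀ n, w n (i n) = 1) : Tendsto (fun n => s n (i n)) atTop (𝓝 t) := by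
  refine Metric.tendsto_nhds.2 fun δ hδ => ?_
  filter_upwards [hw.eventually_small δ hδ (1 / 2) (by norm_num)] with n hn
  rcases hn (i n) with h | h
  · exact h
  · rw [hi n] at h; norm_num at h

lemma tendsto_iSup_mul (hw : ConcentratesAt t s w) {I : Set E} (hI : IsCompact I) (ht : t ∈ I)
    (hs : ∀ n i, s n i ∈ I) {z : E → ℝ} (hz : ContinuousOn z I) (hzt : 0 ≤ z t)
    (hzs : ∀ n i, 0 ≤ z (s n i)) :
    Tendsto (fun n => ⨆ i, w n i * z (s n i)) atTop (𝓝 (z t)) := by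
  choose i hi using hw.exists_eq_one
  refine tendsto_iSup_fin_of_eventually_le i ?_ fun e he => ?_
  · simp only [hi, one_mul]
    exact (hz t ht).tendsto.comp
      (tendsto_nhdsWithin_iff.2 ⟨hw.tendsto_of_eq_one hi, .of_forall fun n => hs n _⟩)
  · obtain ⟨δ, hδ, hδz⟩ := Metric.continuousOn_iff.1 hz t ht e he
    obtain ⟨C, hC⟩ := hI.exists_bound_of_continuousOn hz
    have hC0 : 0 ≤ C := (norm_nonneg _).trans (hC t ht)
    filter_upwards [hw.eventually_small δ hδ (e / (C + 1)) (by positivity)] with n hn j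
    have hzj := hzs n j
    rcases hn j with h | h
    · have h1 := hδz _ (hs n j) h
      rw [Real.dist_eq] at h1
      have h2 := (abs_lt.1 h1).2
      have := mul_le_of_le_one_left hzj (hw.le_one n j)
      linarith
    · have h1 : z (s n j) ≤ C := (le_abs_self _).trans (hC _ (hs n j))
      calc w n j * z (s n j) ≤ e / (C + 1) * (C + 1) := by
            gcongr
            linarith
        _ = e := by field_simp
        _ ≤ z t + e := by linarith

lemma tendsto_iSup_div (hw : ConcentratesAt t s w) {I : Set E} (hI : IsCompact I) (ht : t ∈ I)
    (hs : ∀ n i, s n i ∈ I) {y : E → ℝ} (hy : ContinuousOn y I) (hneg : ∀ u ∈ I, y u < 0) :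
    Tendsto (fun n => ⨆ i, y (s n i) / w n i) atTop (𝓝 (y t)) := by
  choose i hi using hw.exists_eq_one
  refine tendsto_iSup_fin_of_eventually_le i ?_ fun e he => ?_
  · simp only [hi, div_one]
    exact (hy t ht).tendsto.comp
      (tendsto_nhdsWithin_iff.2 ⟨hw.tendsto_of_eq_one hi, .of_forall fun n => hs n _⟩)
  · obtain ⟨δ, hδ, hδy⟩ := Metric.continuousOn_iff.1 hy t ht e he
    obtain ⟨u, hu, hmax⟩ := hI.exists_isMaxOn ⟨t, ht⟩ hy
    have hyu := hneg u hu
    have hyt := hneg t ht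
    filter_upwards [hw.eventually_small δ hδ (y u / y t) (div_pos_of_neg_of_neg hyu hyt)]
      with n hn j
    have hwj := hw.pos n j
    rw [div_le_iff₀ hwj]
    have hyj := hneg _ (hs n j)
    rcases hn j with h | h
    · have h1 := hδy _ (hs n j) h
      rw [Real.dist_eq] at h1
      have h2 := (abs_lt.1 h1).2
      nlinarith [hw.le_one n j]
    · have h1 : y (s n j) ≤ y u := hmax (hs n j)
      rw [le_div_iff_of_neg hyt] at h
      nlinarith

end ConcentratesAt

lemma continuous_of_subadditive_of_abs_homogeneous {k : ℕ} {N : (Fin k → ℝ) → ℝ}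
    (hNadd : ∀ x y, N (x + y) ≤ N x + N y) (hNsmul : ∀ (c : ℝ) x, N (c • x) = |c| * N x) :
    Continuous N := by
  have hconv : ConvexOn ℝ Set.univ N := by
    refine ⟨convex_univ, fun x _ y _ a b ha hb _ => (hNadd _ _).trans ?_⟩
    simp [hNsmul, abs_of_nonneg ha, abs_of_nonneg hb]
  exact hconv.locallyLipschitz.continuous

/-- On a compact set, points with small `N (t - u)` are close to `t`. -/
lemma exists_pos_forall_dist_lt {E : Type*} [NormedAddCommGroup E] {N : E → ℝ}
    (hN : Continuous N) (hN0 : ∀ x, 0 ≤ N x) (hNeq0 : ∀ x, N x = 0 ↔ x = 0)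
    {I : Set E} (hI : IsCompact I) (t : E) {δ : ℝ} (hδ : 0 < δ) :
    ∃ ρ > 0, ∀ u ∈ I, N (t - u) < ρ → dist u t < δ := by
  rcases (I \ Metric.ball t δ).eq_empty_or_nonempty with h | h
  · refine ⟨1, one_pos, fun u hu _ => ?_⟩
    by_contra hd
    exact (h ▸ (show u ∈ I \ Metric.ball t δ from ⟨hu, hd⟩) : u ∈ (∅ : Set E))
  · obtain ⟨u, hu, hmin⟩ := (hI.diff Metric.isOpen_ball).exists_isMinOn h
      (hN.comp (continuous_const.sub continuous_id)).continuousOn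
    refine ⟨N (t - u), (hN0 _).lt_of_ne fun h0 => ?_, fun v hv hlt => ?_⟩
    · have : t = u := sub_eq_zero.1 ((hNeq0 _).1 h0.symm)
      exact hu.2 (by simpa [this] using hδ)
    · by_contra hd
      exact absurd (hmin (show v ∈ I \ Metric.ball t δ from ⟨hv, hd⟩)) (not_le.2 hlt)

/-- Kernel weights, normalized by the weight of a nearest grid point, concentrate at `t`. -/
lemma concentratesAt_kernel {E : Type*} [NormedAddCommGroup E] {N : E → ℝ}
    (hN : Continuous N) (hN0 : ∀ x, 0 ≤ N x) (hNeq0 : ∀ x, N x = 0 ↔ x = 0)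
    {I : Set E} (hI : IsCompact I) {t : E} {K : ℝ → ℝ}
    (hKanti : StrictAntiOn K (Set.Ici 0)) (hKpos : ∀ x, 0 ≤ x → 0 < K x)
    (hKratio : Tendsto (fun x => K (2 * x) / K x) atTop (𝓝 0))
    {d : ℕ → ℕ} {s : (n : ℕ) → Fin (d n) → E} (hsI : ∀ n i, s n i ∈ I)
    {ε h : ℕ → ℝ} (hε : Tendsto ε atTop (𝓝 0)) (hh : ∀ n, 0 < h n)
    (hratio : Tendsto (fun n => ε n / h n) atTop atTop)
    {i₀ : ∀ n, Fin (d n)} (hi₀ : ∀ n j, N (t - s n (i₀ n)) ≤ N (t - s n j))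
    (hi₀ε : ∀ n, N (t - s n (i₀ n)) ≤ ε n) :
    ConcentratesAt t s
      (fun n j => K (N (t - s n j) / h n) / K (N (t - s n (i₀ n)) / h n)) := by
  have hdist : ∀ n j, 0 ≤ N (t - s n j) / h n := fun n j => div_nonneg (hN0 _) (hh n).le
  refine ⟨fun n j => div_pos (hKpos _ (hdist n j)) (hKpos _ (hdist n _)), fun n j => ?_,
    fun n => ⟨i₀ n, div_self (hKpos _ (hdist n _)).ne'⟩, fun δ hδ ρ hρ => ?_⟩
  · rw [div_le_one (hKpos _ (hdist n _))]
    exact hKanti.antitoneOn (hdist n _) (hdist n j)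
      (div_le_div_of_nonneg_right (hi₀ n j) (hh n).le)
  · obtain ⟨r, hr, hrN⟩ := exists_pos_forall_dist_lt hN hN0 hNeq0 hI t hδ
    filter_upwards [(tendsto_order.1 (hKratio.comp hratio)).2 ρ hρ,
      (tendsto_order.1 hε).2 (r / 2) (by linarith)] with n hn hεn
    intro j
    by_cases hj : N (t - s n j) ≤ 2 * ε n
    · exact .inl (hrN _ (hsI n j) (by linarith))
    · refine .inr (le_trans ?_ hn.le)
      have hε0 : 0 ≤ ε n := (hN0 _).trans (hi₀ε n)
      have h0 : 0 ≤ ε n / h n := div_nonneg hε0 (hh n).le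
      refine div_le_div₀ (hKpos _ (by positivity)).le ?_ (hKpos _ h0) ?_
      · refine hKanti.antitoneOn (Set.mem_Ici.2 (by positivity)) (hdist n j) ?_
        rw [← mul_div_assoc]
        exact div_le_div_of_nonneg_right (not_le.1 hj).le (hh n).le
      · exact hKanti.antitoneOn (hdist n _) h0 (div_le_div_of_nonneg_right (hi₀ε n) (hh n).le)

section StandardNegExponential

variable {Ω : Type*} [MeasurableSpace Ω] {μ : Measure Ω} [IsProbabilityMeasure μ]

/-- `f` has the standard negative exponential distribution. -/
structure IsStdNegExp (f : Ω → ℝ) (μ : Measure Ω) : Prop where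
  measurable : Measurable f
  measure_le : ∀ x ≤ 0, μ {ω | f ω ≤ x} = ENNReal.ofReal (Real.exp x)

lemma IsStdNegExp.measure_le_of_nonneg {f : Ω → ℝ} (hf : IsStdNegExp f μ) {x : ℝ} (hx : 0 ≤ x) :
    μ {ω | f ω ≤ x} = 1 := by
  refine le_antisymm prob_le_one ?_
  calc (1 : ENNReal) = μ {ω | f ω ≤ 0} := by simp [hf.measure_le 0 le_rfl]
    _ ≤ _ := measure_mono fun ω (h : f ω ≤ 0) => h.trans hx

lemma IsStdNegExp.ae_nonpos {f : Ω → ℝ} (hf : IsStdNegExp f μ) : ∀ᵐ ω ∂μ, f ω ≤ 0 :=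
  (prob_compl_eq_zero_iff (measurableSet_le hf.measurable measurable_const)).2
    (hf.measure_le_of_nonneg le_rfl)

lemma IsStdNegExp.identDistrib {f g : Ω → ℝ} (hf : IsStdNegExp f μ) (hg : IsStdNegExp g μ) :
    IdentDistrib f g μ μ := by
  refine ⟨hf.measurable.aemeasurable, hg.measurable.aemeasurable, ?_⟩
  have := Measure.isProbabilityMeasure_map (μ := μ) hf.measurable.aemeasurable
  refine Measure.ext_of_Iic _ _ fun x => ?_
  rw [Measure.map_apply hf.measurable measurableSet_Iic,
    Measure.map_apply hg.measurable measurableSet_Iic]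
  change μ {ω | f ω ≤ x} = μ {ω | g ω ≤ x}
  rcases le_total x 0 with hx | hx
  · rw [hf.measure_le x hx, hg.measure_le x hx]
  · rw [hf.measure_le_of_nonneg hx, hg.measure_le_of_nonneg hx]

lemma IsStdNegExp.memLp_two {f : Ω → ℝ} (hf : IsStdNegExp f μ) : MemLp f 2 μ := by
  rw [memLp_two_iff_integrable_sq hf.measurable.aestronglyMeasurable]
  refine ⟨(hf.measurable.pow_const 2).aestronglyMeasurable, ?_⟩
  rw [hasFiniteIntegral_iff_ofReal (.of_forall fun ω => sq_nonneg _)]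
  have h0 : 0 ≤ᵐ[μ] fun ω => - f ω := by
    filter_upwards [hf.ae_nonpos] with ω h
    simpa using h
  have key := lintegral_rpow_eq_lintegral_meas_le_mul μ h0 hf.measurable.neg.aemeasurable
    (p := 2) two_pos
  have hG := (Real.GammaIntegral_convergent (s := 2) two_pos).lintegral_lt_top
  have hsq : ∀ ω, ENNReal.ofReal ((-f ω) ^ (2 : ℝ)) = ENNReal.ofReal (f ω ^ 2) := fun ω => by
    rw [Real.rpow_two, neg_sq]
  simp only [hsq] at key
  rw [key]
  refine ENNReal.mul_lt_top ENNReal.ofReal_lt_top (lt_of_eq_of_lt ?_ hG)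
  refine setLIntegral_congr_fun measurableSet_Ioi fun x (hx : 0 < x) => ?_
  have : {ω | x ≤ -f ω} = {ω | f ω ≤ -x} := by
    ext ω
    exact le_neg (a := x) (b := f ω)
  simp only [this]
  rw [hf.measure_le (-x) (by linarith), ← ENNReal.ofReal_mul (Real.exp_pos _).le]

/-- Almost sure convergence of standard negative exponential variables implies convergence
in mean square. -/
lemma IsStdNegExp.tendsto_integral_sq {f : ℕ → Ω → ℝ} {g : Ω → ℝ}
    (hf : ∀ n, IsStdNegExp (f n) μ) (hg : IsStdNegExp g μ)
    (hfg : ∀ᵐ ω ∂μ, Tendsto (fun n => f n ω) atTop (𝓝 (g ω))) :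
    Tendsto (fun n => ∫ ω, (g ω - f n ω) ^ 2 ∂μ) atTop (𝓝 0) := by
  have hui : UniformIntegrable f 2 μ :=
    MemLp.uniformIntegrable_of_identDistrib (j := 0) (by norm_num) (by norm_num)
      (hf 0).memLp_two fun n => (hf n).identDistrib (hf 0)
  have h := tendsto_Lp_finite_of_tendsto_ae (by norm_num) (by norm_num)
    (fun n => (hf n).measurable.aestronglyMeasurable) hg.memLp_two hui.unifIntegrable hfg
  have hint : ∀ n, ∫ ω, (g ω - f n ω) ^ 2 ∂μ = (eLpNorm (f n - g) 2 μ).toReal ^ 2 := fun n => by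
    rw [((hf n).memLp_two.sub hg.memLp_two).eLpNorm_eq_integral_rpow_norm two_ne_zero
      ENNReal.ofNat_ne_top, ENNReal.toReal_ofReal (by positivity), ← Real.rpow_natCast,
      ← Real.rpow_mul (by positivity)]
    simp only [ENNReal.toReal_ofNat, Nat.cast_ofNat, Real.rpow_two, Real.norm_eq_abs, sq_abs,
      Pi.sub_apply]
    norm_num
    exact integral_congr_ae (.of_forall fun ω => by ring)
  simp only [hint]
  have := (ENNReal.tendsto_toReal ENNReal.zero_ne_top).comp h
  simpa using this.pow 2

end StandardNegExponential

section Generator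

variable {Ω : Type*} [MeasurableSpace Ω] {μ : Measure Ω}
  {E : Type*} [PseudoMetricSpace E] {I : Set E}

lemma le_iSup_of_continuousOn_compact (hI : IsCompact I) {z : E → ℝ} (hz : ContinuousOn z I)
    {u : E} (hu : u ∈ I) : z u ≤ ⨆ v : I, z v.1 := by
  have hb : BddAbove (Set.range fun v : I => z v.1) := by
    have := hI.bddAbove_image hz
    rwa [Set.image_eq_range] at this
  exact le_ciSup hb ⟨u, hu⟩

/-- A finite maximum of weighted values of a generator process is almost surely bounded in norm by
the supremum of the process. -/
lemma ae_norm_iSup_mul_le (hI : IsCompact I) {Z : Ω → E → ℝ}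
    (hZcont : ∀ ω, ContinuousOn (Z ω) I) (hZpos : ∀ t ∈ I, ∀ᵐ ω ∂μ, 0 ≤ Z ω t)
    {m : ℕ} (hm : 0 < m) {u : Fin m → E} (hu : ∀ i, u i ∈ I) {w : Fin m → ℝ}
    (hw0 : ∀ i, 0 ≤ w i) (hw1 : ∀ i, w i ≤ 1) :
    ∀ᵐ ω ∂μ, ‖⨆ i, w i * Z ω (u i)‖ ≤ ⨆ t : I, Z ω t.1 := by
  filter_upwards [ae_all_iff.2 fun i => hZpos (u i) (hu i)] with ω hω
  have : Nonempty (Fin m) := ⟨⟨0, hm⟩⟩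
  rw [Real.norm_of_nonneg (Real.iSup_nonneg fun i => mul_nonneg (hw0 i) (hω i))]
  exact ciSup_le fun i => (mul_le_of_le_one_left (hω i) (hw1 i)).trans
    (le_iSup_of_continuousOn_compact hI (hZcont ω) (hu i))

lemma integrable_iSup_mul (hI : IsCompact I) {Z : Ω → E → ℝ}
    (hZcont : ∀ ω, ContinuousOn (Z ω) I) (hZmeas : ∀ t ∈ I, Measurable fun ω => Z ω t)
    (hZpos : ∀ t ∈ I, ∀ᵐ ω ∂μ, 0 ≤ Z ω t) (hZsup : Integrable (fun ω => ⨆ t : I, Z ω t.1) μ)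
    {m : ℕ} (hm : 0 < m) {u : Fin m → E} (hu : ∀ i, u i ∈ I) {w : Fin m → ℝ}
    (hw0 : ∀ i, 0 ≤ w i) (hw1 : ∀ i, w i ≤ 1) :
    Integrable (fun ω => ⨆ i, w i * Z ω (u i)) μ :=
  hZsup.mono' (Measurable.iSup fun i => (hZmeas _ (hu i)).const_mul (w i)).aestronglyMeasurable
    (ae_norm_iSup_mul_le hI hZcont hZpos hm hu hw0 hw1)

lemma integral_iSup_mul_pos (hI : IsCompact I) {Z : Ω → E → ℝ}
    (hZcont : ∀ ω, ContinuousOn (Z ω) I) (hZmeas : ∀ t ∈ I, Measurable fun ω => Z ω t)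
    (hZpos : ∀ t ∈ I, ∀ᵐ ω ∂μ, 0 ≤ Z ω t) (hZone : ∀ t ∈ I, ∫ ω, Z ω t ∂μ = 1)
    (hZsup : Integrable (fun ω => ⨆ t : I, Z ω t.1) μ)
    {m : ℕ} (hm : 0 < m) {u : Fin m → E} (hu : ∀ i, u i ∈ I) {w : Fin m → ℝ}
    (hw0 : ∀ i, 0 < w i) (hw1 : ∀ i, w i ≤ 1) :
    0 < ∫ ω, ⨆ i, w i * Z ω (u i) ∂μ := by
  let i : Fin m := ⟨0, hm⟩
  calc 0 < w i := hw0 i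
    _ = ∫ ω, w i * Z ω (u i) ∂μ := by rw [integral_const_mul, hZone _ (hu i), mul_one]
    _ ≤ _ := integral_mono ((integrable_of_integral_eq_one (hZone _ (hu i))).const_mul _)
        (integrable_iSup_mul hI hZcont hZmeas hZpos hZsup hm hu (fun j => (hw0 j).le) hw1)
        fun ω => le_ciSup (f := fun j => w j * Z ω (u j)) (Set.finite_range _).bddAbove i

lemma ConcentratesAt.tendsto_integral_iSup_mul {t : E} {d : ℕ → ℕ}
    {s : ∀ n, Fin (d n) → E} {w : ∀ n, Fin (d n) → ℝ} (hw : ConcentratesAt t s w)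
    (hI : IsCompact I) (ht : t ∈ I) (hs : ∀ n i, s n i ∈ I) (hd : ∀ n, 0 < d n) {Z : Ω → E → ℝ}
    (hZcont : ∀ ω, ContinuousOn (Z ω) I) (hZmeas : ∀ t ∈ I, Measurable fun ω => Z ω t)
    (hZpos : ∀ t ∈ I, ∀ᵐ ω ∂μ, 0 ≤ Z ω t) (hZsup : Integrable (fun ω => ⨆ t : I, Z ω t.1) μ) :
    Tendsto (fun n => ∫ ω, ⨆ i, w n i * Z ω (s n i) ∂μ) atTop (𝓝 (∫ ω, Z ω t ∂μ)) := by
  refine tendsto_integral_of_dominated_convergence (fun ω => ⨆ t : I, Z ω t.1)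
    (fun n => (Measurable.iSup fun i =>
      (hZmeas _ (hs n i)).const_mul (w n i)).aestronglyMeasurable) hZsup
    (fun n => ae_norm_iSup_mul_le hI hZcont hZpos (hd n) (hs n) (fun i => (hw.pos n i).le)
      (hw.le_one n)) ?_
  filter_upwards [hZpos t ht, ae_all_iff.2 fun n => ae_all_iff.2 fun i => hZpos _ (hs n i)]
    with ω h1 h2
  exact hw.tendsto_iSup_mul hI ht hs (hZcont ω) h1 h2

variable [IsProbabilityMeasure μ]

/-- A standard max-stable process has almost surely strictly negative sample paths. -/
lemma ae_forall_neg_of_maxStable (hI : IsCompact I) {Z η : Ω → E → ℝ}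
    (hZcont : ∀ ω, ContinuousOn (Z ω) I) (hZmeas : ∀ t ∈ I, Measurable fun ω => Z ω t)
    (hZpos : ∀ t ∈ I, ∀ᵐ ω ∂μ, 0 ≤ Z ω t) (hZsup : Integrable (fun ω => ⨆ t : I, Z ω t.1) μ)
    (hηcont : ∀ ω, ContinuousOn (η ω) I) (hηmeas : ∀ t ∈ I, Measurable fun ω => η ω t)
    (hηfidi : ∀ (m : ℕ) (ts : Fin (m + 1) → E), (∀ i, ts i ∈ I) → ∀ x : Fin (m + 1) → ℝ,
      (∀ i, x i ≤ 0) → (μ {ω | ∀ i, η ω (ts i) ≤ x i}).toReal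
        = Real.exp (-(∫ ω, ⨆ i, |x i| * Z ω (ts i) ∂μ))) :
    ∀ᵐ ω ∂μ, ∀ u ∈ I, η ω u < 0 := by
  rcases I.eq_empty_or_nonempty with rfl | hne
  · simp
  have : CompactSpace I := isCompact_iff_compactSpace.1 hI
  have : Nonempty I := hne.to_subtype
  have : TopologicalSpace.SeparableSpace I := inferInstance
  set q : ℕ → I := TopologicalSpace.denseSeq I
  have hq : DenseRange q := TopologicalSpace.denseRange_denseSeq I
  set C := ∫ ω, ⨆ t : I, Z ω t.1 ∂μ
  have hfin : ∀ x : ℝ, x ≤ 0 → ∀ m : ℕ,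
      ENNReal.ofReal (Real.exp (x * C)) ≤ μ {ω | ∀ i ≤ m, η ω (q i) ≤ x} := fun x hx m => by
    have h1 := hηfidi m (fun i => q i) (fun i => (q i).2) (fun _ => x) fun _ => hx
    have h2 : ∫ ω, ⨆ i : Fin (m + 1), |x| * Z ω (q i) ∂μ ≤ |x| * C := by
      simp_rw [← Real.mul_iSup_of_nonneg (abs_nonneg x)]
      rw [integral_const_mul]
      gcongr
      have hint := integrable_iSup_mul hI hZcont hZmeas hZpos hZsup (Nat.succ_pos m)
        (u := fun i => (q i : E)) (fun i => (q i).2) (w := fun _ => 1)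
        (fun _ => zero_le_one) fun _ => le_rfl
      simp only [one_mul] at hint
      exact integral_mono hint hZsup fun ω => ciSup_le fun i =>
        le_iSup_of_continuousOn_compact hI (hZcont ω) (q i).2
    rw [← ENNReal.ofReal_toReal (measure_ne_top μ {ω | ∀ i ≤ m, η ω (q i) ≤ x})]
    refine ENNReal.ofReal_le_ofReal ?_
    have hset : {ω | ∀ i ≤ m, η ω (q i) ≤ x} = {ω | ∀ i : Fin (m + 1), η ω (q i) ≤ x} := by
      ext ω
      exact ⟨fun h i => h i (Nat.lt_succ_iff.1 i.2), fun h i hi => h ⟨i, Nat.lt_succ_iff.2 hi⟩⟩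
    rw [hset, h1]
    refine Real.exp_le_exp.2 ?_
    rw [abs_of_nonpos hx] at h2 ⊢
    linarith
  have hall : ∀ x : ℝ, x ≤ 0 →
      ENNReal.ofReal (Real.exp (x * C)) ≤ μ {ω | ∀ i, η ω (q i) ≤ x} := fun x hx => by
    have hlim := tendsto_measure_iInter_atTop (μ := μ)
      (s := fun m : ℕ => {ω | ∀ i ≤ m, η ω (q i) ≤ x})
      (fun m => by
        refine MeasurableSet.nullMeasurableSet ?_
        simp only [Set.ofPred_forall]
        exact .iInter fun i => .iInter fun _ =>
          measurableSet_le (hηmeas _ (q i).2) measurable_const)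
      (fun a b hab ω h i hi => h i (hi.trans hab)) ⟨0, measure_ne_top _ _⟩
    have hset : (⋂ m : ℕ, {ω | ∀ i ≤ m, η ω (q i) ≤ x}) = {ω | ∀ i, η ω (q i) ≤ x} := by
      ext ω
      simp only [Set.mem_iInter, Set.mem_ofPred_eq]
      exact ⟨fun h i => h i i le_rfl, fun h m i _ => h i⟩
    rw [hset] at hlim
    exact ge_of_tendsto' hlim fun m => hfin x hx m
  have hsub : ∀ x : ℝ, x < 0 → {ω | ∀ i, η ω (q i) ≤ x} ⊆ {ω | ∀ u ∈ I, η ω u < 0} :=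
    fun x hx ω h u hu => by
      have hc : Continuous fun v : I => η ω v := (hηcont ω).domRestrict
      have := hq.induction_on (p := fun v : I => η ω v ≤ x) ⟨u, hu⟩
        (isClosed_le hc continuous_const) h
      exact this.trans_lt hx
  have hx : Tendsto (fun m : ℕ => -(1 / ((m : ℝ) + 1))) atTop (𝓝 0) := by
    simpa using tendsto_one_div_add_atTop_nhds_zero_nat (𝕜 := ℝ) |>.neg
  have hlim : Tendsto (fun m : ℕ => ENNReal.ofReal (Real.exp (-(1 / ((m : ℝ) + 1)) * C)))
      atTop (𝓝 1) := by
    have := ENNReal.tendsto_ofReal ((Real.continuous_exp.tendsto _).comp (hx.mul_const C))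
    simpa using this
  set A : Set Ω := ⋃ m : ℕ, {ω | ∀ i, η ω (q i) ≤ -(1 / ((m : ℝ) + 1))}
  have hA : MeasurableSet A := .iUnion fun m => by
    simp only [Set.ofPred_forall]
    exact .iInter fun i => measurableSet_le (hηmeas _ (q i).2) measurable_const
  have hA1 : μ A = 1 := by
    refine le_antisymm prob_le_one (le_of_tendsto' hlim fun m => ?_)
    have hpos : 0 < 1 / ((m : ℝ) + 1) := by positivity
    exact (hall _ (by linarith)).trans
      (measure_mono (Set.subset_iUnion
        (fun m : ℕ => {ω | ∀ i, η ω (q i) ≤ -(1 / ((m : ℝ) + 1))}) m))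
  have hAae : ∀ᵐ ω ∂μ, ω ∈ A := (prob_compl_eq_zero_iff hA).2 hA1
  filter_upwards [hAae] with ω hω
  obtain ⟨m, hm⟩ := Set.mem_iUnion.1 hω
  exact hsub _ (neg_lt_zero.2 (by positivity)) hm

end Generator

/-- Weighted maxima of a standard max-stable process with normalized weights are standard negative
exponential. -/
lemma isStdNegExp_iSup_div {Ω : Type*} [MeasurableSpace Ω] {μ : Measure Ω}
    [IsProbabilityMeasure μ] {E : Type*} {I : Set E} {Z η : Ω → E → ℝ}
    (hηmeas : ∀ t ∈ I, Measurable fun ω => η ω t)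
    (hηfidi : ∀ (m : ℕ) (ts : Fin (m + 1) → E), (∀ i, ts i ∈ I) → ∀ x : Fin (m + 1) → ℝ,
      (∀ i, x i ≤ 0) → (μ {ω | ∀ i, η ω (ts i) ≤ x i}).toReal
        = Real.exp (-(∫ ω, ⨆ i, |x i| * Z ω (ts i) ∂μ)))
    {m : ℕ} (hm : 0 < m) {u : Fin m → E} (hu : ∀ i, u i ∈ I) {g : Fin m → ℝ}
    (hg : ∀ i, 0 < g i) (hnorm : ∫ ω, ⨆ i, g i * Z ω (u i) ∂μ = 1) :
    IsStdNegExp (fun ω => ⨆ i, η ω (u i) / g i) μ := by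
  obtain ⟨m, rfl⟩ := Nat.exists_eq_succ_of_ne_zero hm.ne'
  refine ⟨Measurable.iSup fun i => (hηmeas _ (hu i)).div_const _, fun x hx => ?_⟩
  have hset : {ω | ⨆ i, η ω (u i) / g i ≤ x} = {ω | ∀ i, η ω (u i) ≤ x * g i} := by
    ext ω
    simp only [Set.mem_ofPred_eq]
    rw [ciSup_le_iff (Set.finite_range _).bddAbove]
    exact forall_congr' fun i => div_le_iff₀ (hg i)
  rw [hset, ← ENNReal.ofReal_toReal (measure_ne_top μ _),
    hηfidi m u hu _ fun i => mul_nonpos_of_nonpos_of_nonneg hx (hg i).le]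
  have hmul : ∀ ω, ⨆ i, |x * g i| * Z ω (u i) = |x| * ⨆ i, g i * Z ω (u i) := fun ω => by
    rw [Real.mul_iSup_of_nonneg (abs_nonneg x)]
    exact iSup_congr fun i => by rw [abs_mul, abs_of_pos (hg i), mul_assoc]
  simp_rw [hmul]
  rw [integral_const_mul, hnorm, mul_one, abs_of_nonpos hx, neg_neg]

/-- Let `η` be a standard max-stable process on `I = [0,1]^k` with
generator process `Z`, `K` an admissible kernel, grids `𝒢_n` with mesh `ε_n → 0`,
bandwidths `h_n → 0` with `ε_n / h_n → ∞`, kernel weights `g_{i,n}`, and the kernel-based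
discretized version `η̂_{t,n} = max_i η_{s_{i,n}} / g_{i,n}(t)`.  Then for every `t ∈ I`,
`MSE(η̂_{t,n}) = E ((η_t - η̂_{t,n})²) → 0` as `n → ∞`. -/
theorem kernel_discretized_version_mse_tendsto_zero
    {Ω : Type*} [MeasureSpace Ω] [IsProbabilityMeasure (ℙ : Measure Ω)]
    {k : ℕ} (hk : 1 ≤ k)
    (N : (Fin k → ℝ) → ℝ)
    (hN0 : ∀ x, 0 ≤ N x)
    (hNeq0 : ∀ x, N x = 0 ↔ x = 0)
    (hNadd : ∀ x y, N (x + y) ≤ N x + N y)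
    (hNsmul : ∀ (c : ℝ) x, N (c • x) = |c| * N x)
    (Z : Ω → (Fin k → ℝ) → ℝ)
    (hZcont : ∀ ω, ContinuousOn (Z ω) (Set.Icc (0 : Fin k → ℝ) 1))
    (hZmeas : ∀ t ∈ Set.Icc (0 : Fin k → ℝ) 1, Measurable fun ω => Z ω t)
    (hZpos : ∀ t ∈ Set.Icc (0 : Fin k → ℝ) 1, ∀ᵐ ω ∂ℙ, 0 ≤ Z ω t)
    (hZone : ∀ t ∈ Set.Icc (0 : Fin k → ℝ) 1, ∫ ω, Z ω t = 1)
    (hZsup : Integrable (fun ω => ⨆ t : Set.Icc (0 : Fin k → ℝ) 1, Z ω t.1))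
    (η : Ω → (Fin k → ℝ) → ℝ)
    (hηcont : ∀ ω, ContinuousOn (η ω) (Set.Icc (0 : Fin k → ℝ) 1))
    (hηmeas : ∀ t ∈ Set.Icc (0 : Fin k → ℝ) 1, Measurable fun ω => η ω t)
    (hηneg : ∀ t ∈ Set.Icc (0 : Fin k → ℝ) 1, ∀ᵐ ω ∂ℙ, η ω t ≤ 0)
    (hηfidi : ∀ (m : ℕ) (ts : Fin (m + 1) → (Fin k → ℝ)),
      (∀ i, ts i ∈ Set.Icc (0 : Fin k → ℝ) 1) → ∀ x : Fin (m + 1) → ℝ,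
      (∀ i, x i ≤ 0) →
      (ℙ {ω | ∀ i, η ω (ts i) ≤ x i}).toReal
        = Real.exp (-(∫ ω, ⨆ i, |x i| * Z ω (ts i))))
    (K : ℝ → ℝ)
    (hKcont : ContinuousOn K (Set.Ici 0))
    (hKanti : StrictAntiOn K (Set.Ici 0))
    (hKzero : K 0 = 1)
    (hKrange : ∀ x ∈ Set.Ici (0 : ℝ), K x ∈ Set.Ioc (0 : ℝ) 1)
    (hKratio : ∀ a b : ℝ, 0 ≤ b → b < a →
      Tendsto (fun x => K (a * x) / K (b * x)) atTop (𝓝 0))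
    (d : ℕ → ℕ) (hd : ∀ n, 0 < d n)
    (s : (n : ℕ) → Fin (d n) → (Fin k → ℝ))
    (hsI : ∀ n i, s n i ∈ Set.Icc (0 : Fin k → ℝ) 1)
    (hsinj : ∀ n, Function.Injective (s n))
    (ε : ℕ → ℝ)
    (hmesh : ∀ n, ∀ t ∈ Set.Icc (0 : Fin k → ℝ) 1, ∃ i, N (t - s n i) ≤ ε n)
    (hε : Tendsto ε atTop (𝓝 0))
    (h : ℕ → ℝ) (hhpos : ∀ n, 0 < h n) (hh : Tendsto h atTop (𝓝 0))
    (hratio : Tendsto (fun n => ε n / h n) atTop atTop)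
    (g : (n : ℕ) → Fin (d n) → (Fin k → ℝ) → ℝ)
    (hgdef : ∀ n i t, g n i t
      = K (N (t - s n i) / h n) / ∫ ω, ⨆ j, K (N (t - s n j) / h n) * Z ω (s n j)) :
    ∀ t ∈ Set.Icc (0 : Fin k → ℝ) 1,
      Tendsto (fun n => ∫ ω, (η ω t - ⨆ i, η ω (s n i) / g n i t) ^ 2) atTop (𝓝 0) := by
  intro t ht
  have hI : IsCompact (Set.Icc (0 : Fin k → ℝ) 1) := isCompact_Icc
  have hKpos : ∀ x, 0 ≤ x → 0 < K x := fun x hx => (hKrange x hx).1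
  have hNcont := continuous_of_subadditive_of_abs_homogeneous hNadd hNsmul
  have hdist : ∀ n j, 0 ≤ N (t - s n j) / h n := fun n j => div_nonneg (hN0 _) (hhpos n).le
  have hmin : ∀ n, ∃ i, ∀ j, N (t - s n i) ≤ N (t - s n j) := fun n =>
    have : Nonempty (Fin (d n)) := ⟨⟨0, hd n⟩⟩
    Finite.exists_min fun j => N (t - s n j)
  choose i₀ hi₀ using hmin
  have hw := concentratesAt_kernel (t := t) hNcont hN0 hNeq0 hI hKanti hKpos
    (by simpa using hKratio 2 1 zero_le_one one_lt_two) hsI hε hhpos hratio hi₀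
    (fun n => let ⟨j, hj⟩ := hmesh n t ht; (hi₀ n j).trans hj)
  set w : ∀ n, Fin (d n) → ℝ :=
    fun n j => K (N (t - s n j) / h n) / K (N (t - s n (i₀ n)) / h n) with hw_def
  set c : ℕ → ℝ := fun n => ∫ ω, ⨆ i, w n i * Z ω (s n i)
  have hc : Tendsto c atTop (𝓝 1) := hZone t ht ▸
    hw.tendsto_integral_iSup_mul hI ht hsI hd hZcont hZmeas hZpos hZsup
  have hcpos : ∀ n, 0 < c n := fun n => integral_iSup_mul_pos hI hZcont hZmeas hZpos hZone hZsup
    (hd n) (hsI n) (hw.pos n) (hw.le_one n)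
  have hg : ∀ n i, g n i t = w n i / c n := fun n i => by
    have hK0 := hKpos _ (hdist n (i₀ n))
    have hcn : ∫ ω, ⨆ j, K (N (t - s n j) / h n) * Z ω (s n j)
        = K (N (t - s n (i₀ n)) / h n) * c n := by
      rw [← integral_const_mul]
      congr 1 with ω
      rw [Real.mul_iSup_of_nonneg hK0.le]
      refine iSup_congr fun j => ?_
      rw [hw_def]
      field_simp
    rw [hgdef, hcn, hw_def, div_div]
  have hgpos : ∀ n i, 0 < g n i t := fun n i => hg n i ▸ div_pos (hw.pos n i) (hcpos n)
  refine IsStdNegExp.tendsto_integral_sq (fun n => ?_) ?_ ?_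
  · refine isStdNegExp_iSup_div hηmeas hηfidi (hd n) (hsI n) (hgpos n) ?_
    have hcn : ∀ ω, ⨆ i, g n i t * Z ω (s n i) = (c n)⁻¹ * ⨆ i, w n i * Z ω (s n i) := fun ω => by
      rw [Real.mul_iSup_of_nonneg (inv_pos.2 (hcpos n)).le]
      exact iSup_congr fun i => by rw [hg]; ring
    simp_rw [hcn]
    rw [integral_const_mul]
    exact inv_mul_cancel₀ (hcpos n).ne'
  · have := isStdNegExp_iSup_div hηmeas hηfidi one_pos (u := fun _ : Fin 1 => t) (fun _ => ht)
      (g := fun _ => 1) (fun _ => one_pos) (by simpa using hZone t ht)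
    simpa using this
  · filter_upwards [ae_forall_neg_of_maxStable hI hZcont hZmeas hZpos hZsup hηcont hηmeas hηfidi]
      with ω hω
    have hcη : ∀ n, ⨆ i, η ω (s n i) / g n i t = c n * ⨆ i, η ω (s n i) / w n i := fun n => by
      rw [Real.mul_iSup_of_nonneg (hcpos n).le]
      exact iSup_congr fun i => by
        rw [hg, div_div_eq_mul_div, mul_comm, mul_div_assoc]
    simp_rw [hcη]
    simpa using hc.mul (hw.tendsto_iSup_div hI ht hsI (hηcont ω) hω)
end

section
/- Let Z be a generator process on I = [0,1]^k and let η be a standard max-stable process with generator process Z. Let K be an admissible kernel, grids 𝒢_n with mesh ε_n → 0, bandwidths h_n → 0 with ε_n/h_n → ∞, kernel weights g_{i,n}, and define η̂_{t,n} := max_{1≤i≤d(n)} η_{s_{i,n}} / g_{i,n}(t) for t ∈ I. Then the integrated mean squared error IMSE(η̂_n) := ∫_{[0,1]^k} E[(η_t − η̂_{t,n})²] dt converges to 0 as n → ∞. -/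
open MeasureTheory ProbabilityTheory Filter Topology

/-- A function that is subadditive, absolutely homogeneous, nonnegative and definite on a
finite-dimensional coordinate space dominates a multiple of the sup norm. -/
theorem exists_pos_mul_norm_le_of_norm_axioms {k : ℕ} (N : (Fin k → ℝ) → ℝ)
    (hN0 : ∀ x, 0 ≤ N x) (hNeq0 : ∀ x, N x = 0 ↔ x = 0)
    (hNadd : ∀ x y, N (x + y) ≤ N x + N y)
    (hNsmul : ∀ (c : ℝ) x, N (c • x) = |c| * N x) :
    ∃ c : ℝ, 0 < c ∧ ∀ x, c * ‖x‖ ≤ N x := by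
  let p : Seminorm ℝ (Fin k → ℝ) := Seminorm.of N hNadd (by simpa using hNsmul)
  have hpN : ∀ x, p x = N x := fun _ => rfl
  have hcont : Continuous N := by
    have hle : ∀ x, p x ≤ (∑ i, N (Pi.single i 1)) * ‖x‖ := by
      intro x
      have hx : x = ∑ i, x i • (Pi.single i (1 : ℝ) : Fin k → ℝ) := by
        simpa using (pi_eq_sum_univ' x)
      calc p x = p (∑ i, x i • (Pi.single i (1 : ℝ) : Fin k → ℝ)) := by rw [← hx]
        _ ≤ ∑ i, p (x i • (Pi.single i (1 : ℝ) : Fin k → ℝ)) :=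
          Finset.le_sum_of_subadditive p (map_zero p).le (map_add_le_add p) _ _
        _ ≤ ∑ i, N (Pi.single i 1) * ‖x‖ := by
          refine Finset.sum_le_sum fun i _ => ?_
          rw [hpN, hNsmul, mul_comm]
          exact mul_le_mul_of_nonneg_left (norm_le_pi_norm x i) (hN0 _)
        _ = _ := by rw [Finset.sum_mul]
    exact Seminorm.continuous_of_le (p := p)
      (q := (∑ i, N (Pi.single i 1)).toNNReal • normSeminorm ℝ (Fin k → ℝ))
      (by
        have : Continuous fun x : Fin k → ℝ => (∑ i, N (Pi.single i 1)).toNNReal * ‖x‖ := by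
          fun_prop
        exact this)
      (fun x => by
        change p x ≤ ((∑ i, N (Pi.single i 1)).toNNReal : ℝ) * ‖x‖
        rw [Real.coe_toNNReal _ (Finset.sum_nonneg fun i _ => hN0 _)]
        exact hle x)
  rcases subsingleton_or_nontrivial (Fin k → ℝ) with hs | hn
  · exact ⟨1, one_pos, fun x => by simpa [Subsingleton.elim x 0] using hN0 0⟩
  obtain ⟨x₀, hx₀, hmin⟩ := (isCompact_sphere (0 : Fin k → ℝ) 1).exists_isMinOn
    (NormedSpace.sphere_nonempty.2 zero_le_one) hcont.continuousOn
  have hx₀0 : x₀ ≠ 0 := by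
    rintro rfl
    simp at hx₀
  refine ⟨N x₀, lt_of_le_of_ne (hN0 _) fun h0 => hx₀0 ((hNeq0 _).1 h0.symm), fun x => ?_⟩
  rcases eq_or_ne x 0 with rfl | hx
  · simpa using hN0 0
  have hxn : 0 < ‖x‖ := norm_pos_iff.2 hx
  have hle : N x₀ ≤ N (‖x‖⁻¹ • x) := hmin (by simp [norm_smul, hxn.ne'])
  rw [hNsmul, abs_of_pos (inv_pos.2 hxn)] at hle
  calc N x₀ * ‖x‖ ≤ ‖x‖⁻¹ * N x * ‖x‖ := mul_le_mul_of_nonneg_right hle hxn.le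
    _ = N x := by field_simp

/-- Weighted maxima of a bounded continuous function converge to its value at `t` when the weights
are at most one, attain one, and concentrate at `t`. -/
theorem tendsto_iSup_mul_of_concentrating {E : Type*} [TopologicalSpace E] {S : Set E} {t : E}
    (ht : t ∈ S) {f : E → ℝ} (hf : ContinuousOn f S) (hf0 : ∀ x ∈ S, 0 ≤ f x)
    {B : ℝ} (hB : ∀ x ∈ S, f x ≤ B) {ι : ℕ → Type*} [∀ n, Finite (ι n)] [∀ n, Nonempty (ι n)]
    {s : ∀ n, ι n → E} (hs : ∀ n i, s n i ∈ S) {w : ∀ n, ι n → ℝ} (hw1 : ∀ n i, w n i ≤ 1)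
    (hw : ∀ n, ∃ i, w n i = 1)
    (hconc : ∀ V ∈ 𝓝 t, ∀ δ > 0, ∀ᶠ n in atTop, ∀ i, s n i ∈ V ∨ w n i ≤ δ) :
    Tendsto (fun n => ⨆ i, w n i * f (s n i)) atTop (𝓝 (f t)) := by
  rw [Metric.tendsto_atTop']
  intro e he
  have hB0 : 0 ≤ B := (hf0 t ht).trans (hB t ht)
  obtain ⟨V, hV, hVf⟩ : ∃ V ∈ 𝓝 t, ∀ x ∈ V, x ∈ S → |f x - f t| < e / 2 := by
    have := (hf t ht).eventually (Metric.ball_mem_nhds (f t) (half_pos he))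
    rw [eventually_nhdsWithin_iff] at this
    exact ⟨_, this, fun x hx hxS => by simpa [Real.dist_eq] using hx hxS⟩
  obtain ⟨δ, hδ0, hδ1, hδB⟩ : ∃ δ : ℝ, 0 < δ ∧ δ < 1 ∧ δ * B < e / 2 := by
    refine ⟨min (1 / 2) (e / 2 / (B + 1)), by positivity,
      (min_le_left _ _).trans_lt (by norm_num), ?_⟩
    calc min (1 / 2) (e / 2 / (B + 1)) * B ≤ e / 2 / (B + 1) * B := by gcongr; exact min_le_right _ _
      _ < e / 2 := by rw [div_mul_eq_mul_div, div_lt_iff₀ (by positivity)]; nlinarith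
  obtain ⟨n₀, hn₀⟩ := eventually_atTop.1 (hconc V hV δ hδ0)
  refine ⟨n₀, fun n hn => ?_⟩
  have hn' := hn₀ n hn.le
  rw [Real.dist_eq, abs_lt]
  constructor
  · obtain ⟨i, hi⟩ := hw n
    have hiV : s n i ∈ V := (hn' i).resolve_right (by rw [hi]; exact not_le.2 hδ1)
    have h1 := le_ciSup (Set.finite_range fun i => w n i * f (s n i)).bddAbove i
    have h2 := (abs_lt.1 (hVf _ hiV (hs n i))).1
    simp only [hi, one_mul] at h1
    linarith
  · have : (⨆ i, w n i * f (s n i)) ≤ f t + e / 2 := by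
      refine ciSup_le fun i => ?_
      rcases hn' i with hi | hi
      · have h2 := (abs_lt.1 (hVf _ hi (hs n i))).2
        nlinarith [hf0 _ (hs n i), hw1 n i]
      · have h3 := hf0 t ht
        have h4 : w n i * f (s n i) ≤ δ * B :=
          mul_le_mul hi (hB _ (hs n i)) (hf0 _ (hs n i)) hδ0.le
        linarith
    linarith

/-- The maximum of negated inverses of positive numbers is the negated inverse of the maximum. -/
theorem iSup_neg_inv_eq {ι : Type*} [Finite ι] [Nonempty ι] {a : ι → ℝ} (ha : ∀ i, 0 < a i) :
    ⨆ i, -(a i)⁻¹ = -(⨆ i, a i)⁻¹ := by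
  have hbdd := (Set.finite_range a).bddAbove
  obtain ⟨i₀, hi₀⟩ := exists_eq_ciSup_of_finite (f := a)
  refine le_antisymm (ciSup_le fun i => ?_) ?_
  · exact neg_le_neg (inv_anti₀ (ha i) (le_ciSup hbdd i))
  · rw [← hi₀]
    exact le_ciSup (f := fun i => -(a i)⁻¹) (Set.finite_range _).bddAbove i₀

/-- Kernel weights normalised by their maximum concentrate at `t`. -/
theorem kernel_weights_concentrate {E : Type*} [NormedAddCommGroup E] {N : E → ℝ} {c : ℝ}
    (hN0 : ∀ x, 0 ≤ N x) (hc : 0 < c) (hNc : ∀ x, c * ‖x‖ ≤ N x)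
    {K : ℝ → ℝ} (hKanti : AntitoneOn K (Set.Ici 0)) (hKpos : ∀ x ∈ Set.Ici (0 : ℝ), 0 < K x)
    (hKratio : Tendsto (fun x => K (2 * x) / K x) atTop (𝓝 0))
    {ι : ℕ → Type*} [∀ n, Finite (ι n)] {s : ∀ n, ι n → E} {t : E}
    {ε h : ℕ → ℝ} (hmesh : ∀ n, ∃ i, N (t - s n i) ≤ ε n)
    (hε : Tendsto ε atTop (𝓝 0)) (hhpos : ∀ n, 0 < h n)
    (hratio : Tendsto (fun n => ε n / h n) atTop atTop) :
    ∀ V ∈ 𝓝 t, ∀ δ > 0, ∀ᶠ n in atTop, ∀ i, s n i ∈ V ∨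
      K (N (t - s n i) / h n) / (⨆ j, K (N (t - s n j) / h n)) ≤ δ := by
  intro V hV δ hδ
  obtain ⟨r, hr, hrV⟩ := Metric.mem_nhds_iff.1 hV
  filter_upwards [(hKratio.comp hratio).eventually (gt_mem_nhds hδ),
    hε.eventually (gt_mem_nhds (show 0 < c * r / 2 by positivity)),
    hratio.eventually_gt_atTop 0] with n hn1 hn2 hn3 i
  simp only [Function.comp_apply] at hn1
  by_cases hi : N (t - s n i) < 2 * ε n
  · left
    apply hrV
    rw [Metric.mem_ball, dist_comm, dist_eq_norm]
    have := hNc (t - s n i)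
    by_contra! hle
    nlinarith
  · right
    refine le_trans ?_ hn1.le
    have hh := hhpos n
    obtain ⟨j, hj⟩ := hmesh n
    have hpos : ∀ i, (0 : ℝ) ≤ N (t - s n i) / h n := fun i => div_nonneg (hN0 _) hh.le
    have hnum : K (N (t - s n i) / h n) ≤ K (2 * (ε n / h n)) := by
      refine hKanti (by simp; positivity) (hpos i) ?_
      rw [← mul_div_assoc]
      exact div_le_div_of_nonneg_right (not_lt.1 hi) hh.le
    have hden : K (ε n / h n) ≤ ⨆ j, K (N (t - s n j) / h n) :=
      (hKanti (hpos j) hn3.le (div_le_div_of_nonneg_right hj hh.le)).trans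
        (le_ciSup (f := fun j => K (N (t - s n j) / h n)) (Set.finite_range _).bddAbove j)
    exact div_le_div₀ (hKpos _ (by simp; positivity)).le hnum (hKpos _ hn3.le) hden

/-- A process with continuous sample paths that is almost surely nonnegative at each point is
almost surely nonnegative everywhere. -/
theorem ae_forall_mem_nonneg_of_continuousOn {Ω E : Type*} [MeasurableSpace Ω] {μ : Measure Ω}
    [TopologicalSpace E] {S : Set E} [TopologicalSpace.SeparableSpace S] {Z : Ω → E → ℝ}
    (hZc : ∀ ω, ContinuousOn (Z ω) S) (hZ : ∀ t ∈ S, ∀ᵐ ω ∂μ, 0 ≤ Z ω t) :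
    ∀ᵐ ω ∂μ, ∀ t ∈ S, 0 ≤ Z ω t := by
  obtain ⟨D, hDc, hDd⟩ := TopologicalSpace.exists_countable_dense S
  have : ∀ᵐ ω ∂μ, ∀ t ∈ D, 0 ≤ Z ω t := (ae_ball_iff hDc).2 fun t _ => hZ t t.2
  filter_upwards [this] with ω hω t ht
  have hcl : IsClosed {x : S | 0 ≤ Z ω x} := isClosed_le continuous_const (hZc ω).domRestrict
  exact (hcl.closure_subset_iff.2 (fun x hx => hω x hx)) (hDd ⟨t, ht⟩)

/-- If the finite-dimensional probabilities of lying below `-x` are bounded below by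
`exp (-(x * C))`, then the continuous process is almost surely negative everywhere. -/
theorem ae_forall_mem_neg_of_exp_le {Ω E : Type*} [MeasurableSpace Ω] {μ : Measure Ω}
    [IsProbabilityMeasure μ] [TopologicalSpace E] {S : Set E} [TopologicalSpace.SeparableSpace S]
    [Nonempty S] {η : Ω → E → ℝ} (hηc : ∀ ω, ContinuousOn (η ω) S)
    (hηm : ∀ t ∈ S, Measurable fun ω => η ω t) {C : ℝ}
    (hη : ∀ (m : ℕ) (ts : Fin (m + 1) → E), (∀ i, ts i ∈ S) → ∀ x : ℝ, 0 ≤ x →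
      Real.exp (-(x * C)) ≤ (μ {ω | ∀ i, η ω (ts i) ≤ -x}).toReal) :
    ∀ᵐ ω ∂μ, ∀ t ∈ S, η ω t < 0 := by
  set q := TopologicalSpace.denseSeq S
  let A : ℝ → Set Ω := fun x => ⋂ m : ℕ, {ω | ∀ i : Fin (m + 1), η ω (q i) ≤ -x}
  have hAmeas : ∀ x m, MeasurableSet {ω | ∀ i : Fin (m + 1), η ω (q i) ≤ -x} := fun x m => by
    rw [Set.ofPred_forall]
    exact MeasurableSet.iInter fun i => measurableSet_le (hηm _ (q i).2) measurable_const
  have hA : ∀ x, 0 ≤ x → ENNReal.ofReal (Real.exp (-(x * C))) ≤ μ (A x) := by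
    intro x hx
    have hanti : Antitone fun m : ℕ => {ω | ∀ i : Fin (m + 1), η ω (q i) ≤ -x} :=
      fun m m' hmm ω hω i => hω (Fin.castLE (by lia) i)
    refine ge_of_tendsto' (tendsto_measure_iInter_atTop
      (fun m => (hAmeas x m).nullMeasurableSet) hanti ⟨0, measure_ne_top _ _⟩) fun m => ?_
    exact ENNReal.ofReal_le_of_le_toReal (hη m (fun i => q i) (fun i => (q i).2) x hx)
  have hU : μ (⋃ j : ℕ, A (1 / (j + 1 : ℝ))) = 1 := by
    refine le_antisymm prob_le_one ?_
    have hlim : Tendsto (fun j : ℕ => ENNReal.ofReal (Real.exp (-(1 / (j + 1 : ℝ) * C)))) atTop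
        (𝓝 1) := by
      have h0 := (tendsto_one_div_add_atTop_nhds_zero_nat (𝕜 := ℝ)).mul_const C |>.neg |>.rexp
      simpa using ENNReal.tendsto_ofReal h0
    exact le_of_tendsto' hlim fun j => (hA _ (by positivity)).trans
      (measure_mono (Set.subset_iUnion (fun j : ℕ => A (1 / (j + 1 : ℝ))) j))
  have hmeas : MeasurableSet (⋃ j : ℕ, A (1 / (j + 1 : ℝ))) :=
    MeasurableSet.iUnion fun j => MeasurableSet.iInter fun m => hAmeas _ m
  have hae : ∀ᵐ ω ∂μ, ω ∈ ⋃ j : ℕ, A (1 / (j + 1 : ℝ)) := (mem_ae_iff_prob_eq_one hmeas).2 hU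
  filter_upwards [hae] with ω hω t ht
  obtain ⟨j, hj⟩ := Set.mem_iUnion.1 hω
  have hcl : IsClosed {x : S | η ω x ≤ -(1 / (j + 1 : ℝ))} :=
    isClosed_le (hηc ω).domRestrict continuous_const
  have hsub : Set.range q ⊆ {x : S | η ω x ≤ -(1 / (j + 1 : ℝ))} := by
    rintro _ ⟨i, rfl⟩
    exact Set.mem_iInter.1 hj i ⟨i, by lia⟩
  have := hcl.closure_subset_iff.2 hsub (TopologicalSpace.denseRange_denseSeq S ⟨t, ht⟩)
  have hp : (0 : ℝ) < 1 / (j + 1 : ℝ) := by positivity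
  simp only [Set.mem_ofPred_eq] at this
  linarith

/-- Two random variables with the standard negative exponential distribution function are
identically distributed. -/
theorem identDistrib_of_negExponential {Ω : Type*} [MeasurableSpace Ω] {μ : Measure Ω}
    [IsProbabilityMeasure μ] {X Y : Ω → ℝ} (hX : Measurable X) (hY : Measurable Y)
    (hXd : ∀ x ≤ 0, μ.real {ω | X ω ≤ x} = Real.exp x)
    (hYd : ∀ x ≤ 0, μ.real {ω | Y ω ≤ x} = Real.exp x) : IdentDistrib X Y μ μ := by
  refine ⟨hX.aemeasurable, hY.aemeasurable, ?_⟩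
  have := Measure.isProbabilityMeasure_map (μ := μ) hX.aemeasurable
  refine Measure.ext_of_Iic _ _ fun x => ?_
  rw [Measure.map_apply hX measurableSet_Iic, Measure.map_apply hY measurableSet_Iic]
  change μ {ω | X ω ≤ x} = μ {ω | Y ω ≤ x}
  rcases le_total x 0 with hx | hx
  · rw [← measureReal_eq_measureReal_iff, hXd x hx, hYd x hx]
  · have key : ∀ W : Ω → ℝ, (∀ x ≤ 0, μ.real {ω | W ω ≤ x} = Real.exp x) →
        μ {ω | W ω ≤ x} = 1 := by
      intro W hW
      have h1 : μ {ω | W ω ≤ 0} = 1 := by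
        have := hW 0 le_rfl
        rw [Real.exp_zero, Measure.real, ENNReal.toReal_eq_one_iff] at this
        exact this
      exact le_antisymm prob_le_one (h1 ▸ measure_mono fun ω hω => le_trans hω hx)
    rw [key X hXd, key Y hYd]

/-- A standard negative exponential random variable is square integrable. -/
theorem memLp_two_of_negExponential {Ω : Type*} [MeasurableSpace Ω] {μ : Measure Ω}
    [IsProbabilityMeasure μ] {X : Ω → ℝ} (hX : Measurable X)
    (hXd : ∀ x ≤ 0, μ.real {ω | X ω ≤ x} = Real.exp x) : MemLp X 2 μ := by
  rw [memLp_two_iff_integrable_sq hX.aestronglyMeasurable]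
  have hneg : 0 ≤ᵐ[μ] fun ω => -X ω := by
    have h1 : μ {ω | X ω ≤ 0} = 1 := by
      have := hXd 0 le_rfl
      rw [Real.exp_zero, Measure.real, ENNReal.toReal_eq_one_iff] at this
      exact this
    have : ∀ᵐ ω ∂μ, ω ∈ {ω | X ω ≤ 0} :=
      (mem_ae_iff_prob_eq_one (measurableSet_le hX measurable_const)).2 h1
    filter_upwards [this] with ω hω
    simpa using hω
  refine ⟨(hX.pow_const 2).aestronglyMeasurable, ?_⟩
  rw [hasFiniteIntegral_iff_ofReal (Eventually.of_forall fun ω => sq_nonneg _)]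
  have hlc := lintegral_rpow_eq_lintegral_meas_le_mul μ hneg hX.neg.aemeasurable
    (p := 2) two_pos
  simp only [Real.rpow_two, neg_sq] at hlc
  rw [hlc]
  refine ENNReal.mul_lt_top ENNReal.ofReal_lt_top ?_
  have hint := Real.GammaIntegral_convergent (s := 2) two_pos
  refine lt_of_eq_of_lt (setLIntegral_congr_fun measurableSet_Ioi fun t ht => ?_)
    hint.lintegral_lt_top
  have ht0 : (0 : ℝ) < t := ht
  have : μ {a | t ≤ -X a} = ENNReal.ofReal (Real.exp (-t)) := by
    rw [← hXd (-t) (by linarith), ofReal_measureReal]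
    congr 1
    ext a
    simp [le_neg]
  simp only [this]
  rw [← ENNReal.ofReal_mul (Real.exp_pos _).le]

/-- Identically distributed square integrable random variables that converge almost surely
converge in mean square. -/
theorem tendsto_integral_sub_sq_of_identDistrib {Ω : Type*} [MeasurableSpace Ω] {μ : Measure Ω}
    [IsProbabilityMeasure μ] {X : ℕ → Ω → ℝ} {Y : Ω → ℝ} (hY : MemLp Y 2 μ)
    (hident : ∀ n, IdentDistrib (X n) Y μ μ)
    (hlim : ∀ᵐ ω ∂μ, Tendsto (fun n => X n ω) atTop (𝓝 (Y ω))) :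
    Tendsto (fun n => ∫ ω, (Y ω - X n ω) ^ 2 ∂μ) atTop (𝓝 0) := by
  have hX : ∀ n, MemLp (X n) 2 μ := fun n => (hident n).memLp_iff.2 hY
  have hui : UnifIntegrable X 2 μ :=
    (MemLp.uniformIntegrable_of_identDistrib (j := 0) one_le_two ENNReal.ofNat_ne_top (hX 0)
      fun n => (hident n).trans (hident 0).symm).unifIntegrable
  have h := tendsto_Lp_finite_of_tendsto_ae one_le_two ENNReal.ofNat_ne_top
    (fun n => (hX n).1) hY hui hlim
  have h2 := ((ENNReal.tendsto_toReal ENNReal.zero_ne_top).comp h).pow 2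
  simp only [ENNReal.toReal_zero, ne_eq, OfNat.ofNat_ne_zero, not_false_eq_true, zero_pow] at h2
  refine h2.congr fun n => ?_
  have hnn : 0 ≤ ∫ ω, (Y ω - X n ω) ^ 2 ∂μ := integral_nonneg fun ω => sq_nonneg _
  have heq : ∫ ω, ‖(X n - Y) ω‖ ^ (2 : ENNReal).toReal ∂μ = ∫ ω, (Y ω - X n ω) ^ 2 ∂μ := by
    refine integral_congr_ae (Eventually.of_forall fun ω => ?_)
    simp only [ENNReal.toReal_ofNat, Real.rpow_two, Real.norm_eq_abs, sq_abs, Pi.sub_apply]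
    ring
  rw [Function.comp_apply, ((hX n).sub hY).eLpNorm_eq_integral_rpow_norm two_ne_zero
    ENNReal.ofNat_ne_top, heq, ENNReal.toReal_ofReal (by positivity), ENNReal.toReal_ofNat,
    inv_eq_one_div, ← Real.sqrt_eq_rpow, Real.sq_sqrt hnn]

/-- The mean square distance of identically distributed random variables is at most four times
their second moment. -/
theorem integral_sub_sq_le_of_identDistrib {Ω : Type*} [MeasurableSpace Ω] {μ : Measure Ω}
    {X Y : Ω → ℝ} (hY : MemLp Y 2 μ) (hident : IdentDistrib X Y μ μ) :
    ∫ ω, (Y ω - X ω) ^ 2 ∂μ ≤ 4 * ∫ ω, Y ω ^ 2 ∂μ := by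
  have hX : MemLp X 2 μ := hident.memLp_iff.2 hY
  have hXY : ∫ ω, X ω ^ 2 ∂μ = ∫ ω, Y ω ^ 2 ∂μ :=
    (hident.comp (measurable_id.pow_const 2)).integral_eq
  calc ∫ ω, (Y ω - X ω) ^ 2 ∂μ ≤ ∫ ω, (2 * Y ω ^ 2 + 2 * X ω ^ 2) ∂μ :=
        integral_mono (hY.sub hX).integrable_sq
          ((hY.integrable_sq.const_mul 2).add (hX.integrable_sq.const_mul 2))
          fun ω => by nlinarith [sq_nonneg (Y ω + X ω)]
    _ = 4 * ∫ ω, Y ω ^ 2 ∂μ := by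
        rw [integral_add (hY.integrable_sq.const_mul 2) (hX.integrable_sq.const_mul 2),
          integral_const_mul, integral_const_mul, hXY]
        ring

/-- Dominated convergence to zero on a set of finite measure for Bochner integrals, without a
measurability hypothesis: non-measurable functions have integral zero. -/
theorem tendsto_setIntegral_zero_of_bounded {E : Type*} [MeasurableSpace E] {μ : Measure E}
    {S : Set E} (hS : MeasurableSet S) (hμS : μ S ≠ ⊤) {F : ℕ → E → ℝ} {C : ℝ}
    (hbound : ∀ n, ∀ t ∈ S, |F n t| ≤ C)
    (hlim : ∀ t ∈ S, Tendsto (fun n => F n t) atTop (𝓝 0)) :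
    Tendsto (fun n => ∫ t in S, F n t ∂μ) atTop (𝓝 0) := by
  classical
  let G : ℕ → E → ℝ := fun n =>
    if AEStronglyMeasurable (F n) (μ.restrict S) then F n else 0
  have hGF : ∀ n, ∫ t in S, G n t ∂μ = ∫ t in S, F n t ∂μ := fun n => by
    by_cases hn : AEStronglyMeasurable (F n) (μ.restrict S)
    · simp [G, hn]
    · simp [G, hn, integral_non_aestronglyMeasurable hn]
  have hGle : ∀ n t, |G n t| ≤ |F n t| := fun n t => by
    by_cases hn : AEStronglyMeasurable (F n) (μ.restrict S) <;> simp [G, hn]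
  have : Tendsto (fun n => ∫ t in S, G n t ∂μ) atTop (𝓝 (∫ _ in S, (0 : ℝ) ∂μ)) := by
    refine tendsto_integral_of_dominated_convergence (fun _ => C) (fun n => ?_)
      (integrableOn_const hμS) (fun n => ?_) ?_
    · by_cases hn : AEStronglyMeasurable (F n) (μ.restrict S)
      · simp [G, hn]
      · simp only [G, hn, if_false]
        exact aestronglyMeasurable_const
    · exact (ae_restrict_iff' hS).2 (Eventually.of_forall fun t ht =>
        (hGle n t).trans (hbound n t ht))
    · exact (ae_restrict_iff' hS).2 (Eventually.of_forall fun t ht =>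
        squeeze_zero_norm (hGle · t) (by simpa using (hlim t ht).abs))
  simpa [hGF] using this

/-- Weighted maxima of a process dominated by an integrable envelope are integrable. -/
theorem integrable_iSup_mul_of_le_envelope {Ω E ι : Type*} [MeasurableSpace Ω] {μ : Measure Ω}
    [Finite ι] [Nonempty ι] {S : Set E} {Z : Ω → E → ℝ} {W : Ω → ℝ}
    (hZm : ∀ t ∈ S, Measurable fun ω => Z ω t) (hZ0 : ∀ᵐ ω ∂μ, ∀ t ∈ S, 0 ≤ Z ω t)
    (hZW : ∀ ω, ∀ t ∈ S, Z ω t ≤ W ω) (hW : Integrable W μ)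
    {s : ι → E} (hs : ∀ i, s i ∈ S) {w : ι → ℝ} (hw0 : ∀ i, 0 ≤ w i) (hw1 : ∀ i, w i ≤ 1) :
    Integrable (fun ω => ⨆ i, w i * Z ω (s i)) μ ∧
      ∀ᵐ ω ∂μ, ‖⨆ i, w i * Z ω (s i)‖ ≤ W ω := by
  have hb : ∀ᵐ ω ∂μ, ‖⨆ i, w i * Z ω (s i)‖ ≤ W ω := by
    filter_upwards [hZ0] with ω hω
    rw [Real.norm_of_nonneg (Real.iSup_nonneg fun i => mul_nonneg (hw0 i) (hω _ (hs i)))]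
    exact ciSup_le fun i => (mul_le_of_le_one_left (hω _ (hs i)) (hw1 i)).trans (hZW ω _ (hs i))
  have hm : Measurable fun ω => ⨆ i, w i * Z ω (s i) :=
    Measurable.iSup fun i => (hZm _ (hs i)).const_mul (w i)
  exact ⟨hW.mono' hm.aestronglyMeasurable hb, hb⟩

/-- For a generator process and concentrating weights, the expectations of the weighted maxima
are at least one and tend to one. -/
theorem one_le_and_tendsto_integral_iSup_mul {Ω E : Type*} [MeasurableSpace Ω] {μ : Measure Ω}
    [TopologicalSpace E] {S : Set E} {Z : Ω → E → ℝ} {W : Ω → ℝ}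
    (hZc : ∀ ω, ContinuousOn (Z ω) S) (hZm : ∀ t ∈ S, Measurable fun ω => Z ω t)
    (hZ0 : ∀ᵐ ω ∂μ, ∀ t ∈ S, 0 ≤ Z ω t) (hZW : ∀ ω, ∀ t ∈ S, Z ω t ≤ W ω)
    (hW : Integrable W μ) (hZ1 : ∀ t ∈ S, ∫ ω, Z ω t ∂μ = 1) {t : E} (ht : t ∈ S)
    {ι : ℕ → Type*} [∀ n, Finite (ι n)] [∀ n, Nonempty (ι n)]
    {s : ∀ n, ι n → E} (hs : ∀ n i, s n i ∈ S) {w : ∀ n, ι n → ℝ} (hw0 : ∀ n i, 0 ≤ w n i)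
    (hw1 : ∀ n i, w n i ≤ 1) (hw : ∀ n, ∃ i, w n i = 1)
    (hconc : ∀ V ∈ 𝓝 t, ∀ δ > 0, ∀ᶠ n in atTop, ∀ i, s n i ∈ V ∨ w n i ≤ δ) :
    (∀ n, 1 ≤ ∫ ω, ⨆ i, w n i * Z ω (s n i) ∂μ) ∧
      Tendsto (fun n => ∫ ω, ⨆ i, w n i * Z ω (s n i) ∂μ) atTop (𝓝 1) := by
  have hint := fun n => integrable_iSup_mul_of_le_envelope hZm hZ0 hZW hW (hs n) (hw0 n) (hw1 n)
  constructor
  · intro n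
    obtain ⟨i, hi⟩ := hw n
    rw [← hZ1 _ (hs n i)]
    refine integral_mono (integrable_of_integral_eq_one (hZ1 _ (hs n i))) (hint n).1 fun ω => ?_
    simpa [hi] using
      le_ciSup (f := fun i => w n i * Z ω (s n i)) (Set.finite_range _).bddAbove i
  · rw [← hZ1 t ht]
    refine tendsto_integral_of_dominated_convergence W (fun n => (hint n).1.1) hW
      (fun n => (hint n).2) ?_
    filter_upwards [hZ0] with ω hω
    exact tendsto_iSup_mul_of_concentrating ht (hZc ω) hω (hZW ω) hs hw1 hw hconc

/-- Suitably normalised weighted maxima of a negative continuous function converge to its value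
at the point where the weights concentrate. -/
theorem tendsto_iSup_div_of_concentrating {E : Type*} [TopologicalSpace E] {S : Set E}
    (hS : IsCompact S) {t : E} (ht : t ∈ S) {f : E → ℝ} (hf : ContinuousOn f S)
    (hfneg : ∀ x ∈ S, f x < 0) {ι : ℕ → Type*} [∀ n, Finite (ι n)] [∀ n, Nonempty (ι n)]
    {s : ∀ n, ι n → E} (hs : ∀ n i, s n i ∈ S) {w : ∀ n, ι n → ℝ} (hw0 : ∀ n i, 0 < w n i)
    (hw1 : ∀ n i, w n i ≤ 1) (hw : ∀ n, ∃ i, w n i = 1)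
    (hconc : ∀ V ∈ 𝓝 t, ∀ δ > 0, ∀ᶠ n in atTop, ∀ i, s n i ∈ V ∨ w n i ≤ δ)
    {C : ℕ → ℝ} (hC0 : ∀ n, 0 ≤ C n) (hC : Tendsto C atTop (𝓝 1)) :
    Tendsto (fun n => ⨆ i, f (s n i) / (w n i / C n)) atTop (𝓝 (f t)) := by
  have hpos : ∀ x ∈ S, 0 < (-f x)⁻¹ := fun x hx => inv_pos.2 (neg_pos.2 (hfneg x hx))
  have hcont : ContinuousOn (fun x => (-f x)⁻¹) S :=
    hf.neg.inv₀ fun x hx => (neg_pos.2 (hfneg x hx)).ne'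
  obtain ⟨B, hB⟩ := (hS.image_of_continuousOn hcont).bddAbove
  have hlim := tendsto_iSup_mul_of_concentrating ht hcont (fun x hx => (hpos x hx).le)
    (fun x hx => hB (Set.mem_image_of_mem _ hx)) hs hw1 hw hconc
  have hlim' := hC.mul (hlim.inv₀ (hpos t ht).ne').neg
  rw [inv_inv, neg_neg, one_mul] at hlim'
  refine hlim'.congr fun n => ?_
  rw [← iSup_neg_inv_eq fun i => mul_pos (hw0 n i) (hpos _ (hs n i)),
    Real.mul_iSup_of_nonneg (hC0 n)]
  refine iSup_congr fun i => ?_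
  rw [mul_inv, inv_inv, div_div_eq_mul_div, div_eq_mul_inv]
  ring

/-- Weighted maxima of a standard max-stable process, with weights normalised by the
generator, have the standard negative exponential distribution. -/
theorem measureReal_iSup_div_le_eq_exp {Ω E : Type*} [MeasurableSpace Ω] {μ : Measure Ω}
    {Z η : Ω → E → ℝ} {D : ℕ} [Nonempty (Fin D)] {p : Fin D → E}
    (hfidi : ∀ x : Fin D → ℝ, (∀ i, x i ≤ 0) →
      μ.real {ω | ∀ i, η ω (p i) ≤ x i} = Real.exp (-(∫ ω, ⨆ i, |x i| * Z ω (p i) ∂μ)))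
    {w : Fin D → ℝ} (hw : ∀ i, 0 < w i) (hC : 0 < ∫ ω, ⨆ i, w i * Z ω (p i) ∂μ)
    {x : ℝ} (hx : x ≤ 0) :
    μ.real {ω | ⨆ i, η ω (p i) / (w i / ∫ ω, ⨆ i, w i * Z ω (p i) ∂μ) ≤ x} = Real.exp x := by
  set C := ∫ ω, ⨆ i, w i * Z ω (p i) ∂μ with hCdef
  have hg : ∀ i, 0 < w i / C := fun i => div_pos (hw i) hC
  have hset : {ω | ⨆ i, η ω (p i) / (w i / C) ≤ x} =
      {ω | ∀ i, η ω (p i) ≤ x * (w i / C)} := by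
    ext ω
    simp only [Set.mem_ofPred_eq, ciSup_le_iff (Set.finite_range _).bddAbove,
      div_le_iff₀ (hg _)]
  rw [hset, hfidi _ fun i => mul_nonpos_of_nonpos_of_nonneg hx (hg i).le]
  congr 1
  have hfun : ∀ ω, ⨆ i, |x * (w i / C)| * Z ω (p i) = -x / C * ⨆ i, w i * Z ω (p i) := by
    intro ω
    rw [Real.mul_iSup_of_nonneg (div_nonneg (neg_nonneg.2 hx) hC.le)]
    refine iSup_congr fun i => ?_
    rw [abs_mul, abs_of_nonpos hx, abs_of_pos (hg i)]
    ring
  simp only [hfun]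
  rw [integral_const_mul, ← hCdef, div_mul_cancel₀ _ hC.ne', neg_neg]

/-- Let `η` be a standard max-stable process on `I = [0,1]^k` with
generator process `Z`, `K` an admissible kernel, grids `𝒢_n` with mesh `ε_n → 0`,
bandwidths `h_n → 0` with `ε_n / h_n → ∞`, kernel weights `g_{i,n}`, and
`η̂_{t,n} = max_i η_{s_{i,n}} / g_{i,n}(t)`.  Then the integrated mean squared error
`IMSE(η̂_n) = ∫_{[0,1]^k} E ((η_t - η̂_{t,n})²) dt → 0` as `n → ∞`. -/
theorem kernel_discretized_version_imse_tendsto_zero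
    {Ω : Type*} [MeasureSpace Ω] [IsProbabilityMeasure (ℙ : Measure Ω)]
    {k : ℕ} (hk : 1 ≤ k)
    (N : (Fin k → ℝ) → ℝ)
    (hN0 : ∀ x, 0 ≤ N x)
    (hNeq0 : ∀ x, N x = 0 ↔ x = 0)
    (hNadd : ∀ x y, N (x + y) ≤ N x + N y)
    (hNsmul : ∀ (c : ℝ) x, N (c • x) = |c| * N x)
    (Z : Ω → (Fin k → ℝ) → ℝ)
    (hZcont : ∀ ω, ContinuousOn (Z ω) (Set.Icc (0 : Fin k → ℝ) 1))
    (hZmeas : ∀ t ∈ Set.Icc (0 : Fin k → ℝ) 1, Measurable fun ω => Z ω t)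
    (hZpos : ∀ t ∈ Set.Icc (0 : Fin k → ℝ) 1, ∀ᵐ ω ∂ℙ, 0 ≤ Z ω t)
    (hZone : ∀ t ∈ Set.Icc (0 : Fin k → ℝ) 1, ∫ ω, Z ω t = 1)
    (hZsup : Integrable (fun ω => ⨆ t : Set.Icc (0 : Fin k → ℝ) 1, Z ω t.1))
    (η : Ω → (Fin k → ℝ) → ℝ)
    (hηcont : ∀ ω, ContinuousOn (η ω) (Set.Icc (0 : Fin k → ℝ) 1))
    (hηmeas : ∀ t ∈ Set.Icc (0 : Fin k → ℝ) 1, Measurable fun ω => η ω t)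
    (hηneg : ∀ t ∈ Set.Icc (0 : Fin k → ℝ) 1, ∀ᵐ ω ∂ℙ, η ω t ≤ 0)
    (hηfidi : ∀ (m : ℕ) (ts : Fin (m + 1) → (Fin k → ℝ)),
      (∀ i, ts i ∈ Set.Icc (0 : Fin k → ℝ) 1) → ∀ x : Fin (m + 1) → ℝ,
      (∀ i, x i ≤ 0) →
      (ℙ {ω | ∀ i, η ω (ts i) ≤ x i}).toReal
        = Real.exp (-(∫ ω, ⨆ i, |x i| * Z ω (ts i))))
    (K : ℝ → ℝ)
    (hKcont : ContinuousOn K (Set.Ici 0))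
    (hKanti : StrictAntiOn K (Set.Ici 0))
    (hKzero : K 0 = 1)
    (hKrange : ∀ x ∈ Set.Ici (0 : ℝ), K x ∈ Set.Ioc (0 : ℝ) 1)
    (hKratio : ∀ a b : ℝ, 0 ≤ b → b < a →
      Tendsto (fun x => K (a * x) / K (b * x)) atTop (𝓝 0))
    (d : ℕ → ℕ) (hd : ∀ n, 0 < d n)
    (s : (n : ℕ) → Fin (d n) → (Fin k → ℝ))
    (hsI : ∀ n i, s n i ∈ Set.Icc (0 : Fin k → ℝ) 1)
    (hsinj : ∀ n, Function.Injective (s n))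
    (ε : ℕ → ℝ)
    (hmesh : ∀ n, ∀ t ∈ Set.Icc (0 : Fin k → ℝ) 1, ∃ i, N (t - s n i) ≤ ε n)
    (hε : Tendsto ε atTop (𝓝 0))
    (h : ℕ → ℝ) (hhpos : ∀ n, 0 < h n) (hh : Tendsto h atTop (𝓝 0))
    (hratio : Tendsto (fun n => ε n / h n) atTop atTop)
    (g : (n : ℕ) → Fin (d n) → (Fin k → ℝ) → ℝ)
    (hgdef : ∀ n i t, g n i t
      = K (N (t - s n i) / h n) / ∫ ω, ⨆ j, K (N (t - s n j) / h n) * Z ω (s n j)) :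
    Tendsto (fun n => ∫ t in Set.Icc (0 : Fin k → ℝ) 1,
        ∫ ω, (η ω t - ⨆ i, η ω (s n i) / g n i t) ^ 2) atTop (𝓝 0) := by
  have hne : ∀ n, Nonempty (Fin (d n)) := fun n => Fin.pos_iff_nonempty.1 (hd n)
  have h0S : (0 : Fin k → ℝ) ∈ Set.Icc (0 : Fin k → ℝ) 1 := ⟨le_rfl, zero_le_one⟩
  have hSne : Nonempty (Set.Icc (0 : Fin k → ℝ) 1) := ⟨⟨0, h0S⟩⟩
  have hZW : ∀ ω, ∀ t ∈ Set.Icc (0 : Fin k → ℝ) 1,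
      Z ω t ≤ ⨆ t : Set.Icc (0 : Fin k → ℝ) 1, Z ω t.1 := by
    intro ω t ht
    have hbdd := (isCompact_Icc.image_of_continuousOn (hZcont ω)).bddAbove
    rw [Set.image_eq_range] at hbdd
    exact le_ciSup hbdd ⟨t, ht⟩
  have hZnn := ae_forall_mem_nonneg_of_continuousOn hZcont hZpos
  have hηlt : ∀ᵐ ω ∂ℙ, ∀ t ∈ Set.Icc (0 : Fin k → ℝ) 1, η ω t < 0 := by
    refine ae_forall_mem_neg_of_exp_le hηcont hηmeas
      (C := ∫ ω, ⨆ t : Set.Icc (0 : Fin k → ℝ) 1, Z ω t.1) fun m ts hts x hx => ?_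
    rw [hηfidi m ts hts (fun _ => -x) fun _ => neg_nonpos.2 hx, ← integral_const_mul]
    refine Real.exp_le_exp.2 (neg_le_neg (integral_mono_of_nonneg ?_ (hZsup.const_mul x) ?_))
    · filter_upwards [hZnn] with ω hω
      exact Real.iSup_nonneg fun i => mul_nonneg (abs_nonneg _) (hω _ (hts i))
    · refine Eventually.of_forall fun ω => ciSup_le fun i => ?_
      rw [abs_neg, abs_of_nonneg hx]
      exact mul_le_mul_of_nonneg_left (hZW ω _ (hts i)) hx
  have hfidi : ∀ D : ℕ, 0 < D → ∀ p : Fin D → (Fin k → ℝ),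
      (∀ i, p i ∈ Set.Icc (0 : Fin k → ℝ) 1) → ∀ x : Fin D → ℝ, (∀ i, x i ≤ 0) →
      (ℙ : Measure Ω).real {ω | ∀ i, η ω (p i) ≤ x i}
        = Real.exp (-(∫ ω, ⨆ i, |x i| * Z ω (p i))) := by
    rintro (_ | m) hD
    · exact absurd hD (lt_irrefl 0)
    · exact hηfidi m
  have hηlaw : ∀ t ∈ Set.Icc (0 : Fin k → ℝ) 1, ∀ x ≤ 0,
      (ℙ : Measure Ω).real {ω | η ω t ≤ x} = Real.exp x := by
    intro t ht x hx
    have := measureReal_iSup_div_le_eq_exp (hfidi 1 one_pos (fun _ => t) fun _ => ht)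
      (w := fun _ => 1) (fun _ => one_pos) (by simp [hZone t ht]) hx
    simpa [hZone t ht] using this
  have hηL2 : ∀ t ∈ Set.Icc (0 : Fin k → ℝ) 1, MemLp (fun ω => η ω t) 2 ℙ := fun t ht =>
    memLp_two_of_negExponential (hηmeas t ht) (hηlaw t ht)
  obtain ⟨c, hc, hNc⟩ := exists_pos_mul_norm_le_of_norm_axioms N hN0 hNeq0 hNadd hNsmul
  have hpos : ∀ n (x : Fin k → ℝ), N x / h n ∈ Set.Ici (0 : ℝ) := fun n x =>
    div_nonneg (hN0 x) (hhpos n).le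
  have hpointwise : ∀ t ∈ Set.Icc (0 : Fin k → ℝ) 1,
      (∀ n, IdentDistrib (fun ω => ⨆ i, η ω (s n i) / g n i t) (fun ω => η ω t) ℙ ℙ) ∧
      ∀ᵐ ω ∂ℙ, Tendsto (fun n => ⨆ i, η ω (s n i) / g n i t) atTop (𝓝 (η ω t)) := by
    intro t ht
    set M : ℕ → ℝ := fun n => ⨆ j, K (N (t - s n j) / h n)
    set w : (n : ℕ) → Fin (d n) → ℝ := fun n i => K (N (t - s n i) / h n) / M n with hw
    have hKM : ∀ n i, K (N (t - s n i) / h n) ≤ M n := fun n i =>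
      le_ciSup (f := fun j => K (N (t - s n j) / h n)) (Set.finite_range _).bddAbove i
    have hKpos : ∀ n i, 0 < K (N (t - s n i) / h n) := fun n i => (hKrange _ (hpos n _)).1
    have hMpos : ∀ n, 0 < M n := fun n => (hKpos n ⟨0, hd n⟩).trans_le (hKM n _)
    have hw0 : ∀ n i, 0 < w n i := fun n i => div_pos (hKpos n i) (hMpos n)
    have hw1 : ∀ n i, w n i ≤ 1 := fun n i => (div_le_one (hMpos n)).2 (hKM n i)
    have hwmax : ∀ n, ∃ i, w n i = 1 := fun n => by
      obtain ⟨i, hi⟩ := exists_eq_ciSup_of_finite (f := fun j => K (N (t - s n j) / h n))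
      exact ⟨i, (div_eq_one_iff_eq (hMpos n).ne').2 hi⟩
    have hconc : ∀ V ∈ 𝓝 t, ∀ δ > 0, ∀ᶠ n in atTop, ∀ i, s n i ∈ V ∨ w n i ≤ δ :=
      kernel_weights_concentrate hN0 hc hNc hKanti.antitoneOn (fun x hx => (hKrange x hx).1)
        (by simpa using hKratio 2 1 zero_le_one one_lt_two) (fun n => hmesh n t ht) hε hhpos hratio
    obtain ⟨hC1, hC⟩ := one_le_and_tendsto_integral_iSup_mul hZcont hZmeas hZnn hZW hZsup hZone
      ht hsI (fun n i => (hw0 n i).le) hw1 hwmax hconc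
    have hg : ∀ n i, g n i t = w n i / ∫ ω, ⨆ j, w n j * Z ω (s n j) := by
      intro n i
      have hfun : ∀ ω, ⨆ j, w n j * Z ω (s n j)
          = (M n)⁻¹ * ⨆ j, K (N (t - s n j) / h n) * Z ω (s n j) := fun ω => by
        rw [Real.mul_iSup_of_nonneg (inv_nonneg.2 (hMpos n).le)]
        refine iSup_congr fun j => ?_
        simp only [hw]
        ring
      simp only [hfun]
      rw [hgdef, integral_const_mul, hw, ← div_eq_inv_mul, div_div_div_cancel_right₀ (hMpos n).ne']
    simp only [hg]
    refine ⟨fun n => ?_, ?_⟩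
    · exact identDistrib_of_negExponential
        (Measurable.iSup fun i => (hηmeas _ (hsI n i)).div_const _) (hηmeas t ht)
        (fun x hx => measureReal_iSup_div_le_eq_exp (hfidi (d n) (hd n) (s n) (hsI n)) (hw0 n)
          (one_pos.trans_le (hC1 n)) hx) (hηlaw t ht)
    · filter_upwards [hηlt] with ω hω
      exact tendsto_iSup_div_of_concentrating isCompact_Icc ht (hηcont ω) hω hsI hw0 hw1 hwmax
        hconc (fun n => zero_le_one.trans (hC1 n)) hC
  refine tendsto_setIntegral_zero_of_bounded (C := 4 * ∫ ω, η ω 0 ^ 2) measurableSet_Icc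
    isCompact_Icc.measure_lt_top.ne (fun n t ht => ?_) fun t ht =>
      tendsto_integral_sub_sq_of_identDistrib (hηL2 t ht) (hpointwise t ht).1 (hpointwise t ht).2
  rw [abs_of_nonneg (integral_nonneg fun ω => sq_nonneg _)]
  have hsame : ∫ ω, η ω t ^ 2 = ∫ ω, η ω 0 ^ 2 :=
    ((identDistrib_of_negExponential (hηmeas t ht) (hηmeas 0 h0S) (hηlaw t ht)
      (hηlaw 0 h0S)).comp (measurable_id.pow_const 2)).integral_eq
  rw [← hsame]
  exact integral_sub_sq_le_of_identDistrib (hηL2 t ht) ((hpointwise t ht).1 n)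
end
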